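/- Strong comparison principle for the nonlocal HJB variational inequality: under Assumption (A), if u is a bounded viscosity subsolution of the HJBVI and v is a bounded viscosity supersolution of the HJBVI with u(0,x) ≤ v(0,x) for all x ∈ ℝ^d, then u(t,x) ≤ v(t,x) for all (t,x) ∈ [0,T]×ℝ^d. -/

import Mathlib

open MeasureTheory Set Filter Topology Metric
open scoped RealInnerProductSpace Matrix

attribute [local instance] Matrix.normedAddCommGroup Matrix.normedSpace

noncomputable section

abbrev Vec (d : ℕ) := EuclideanSpace ℝ (Fin d)

structure C12 (d : ℕ) where
  toFun : ℝ → Vec d → ℝ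
  dt : ℝ → Vec d → ℝ
  grad : ℝ → Vec d → Vec d
  hess : ℝ → Vec d → Matrix (Fin d) (Fin d) ℝ
  hasDt : ∀ t x, HasDerivAt (fun s => toFun s x) (dt t x) t
  hasGrad : ∀ t x, HasGradientAt (toFun t) (grad t x) x
  hasHess : ∀ t x, HasFDerivAt (grad t)
      ((Matrix.toEuclideanLin (hess t x)).toContinuousLinearMap) x
  cont : Continuous fun p : ℝ × Vec d => toFun p.1 p.2
  cont_dt : Continuous fun p : ℝ × Vec d => dt p.1 p.2
  cont_grad : Continuous fun p : ℝ × Vec d => grad p.1 p.2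
  cont_hess : Continuous fun p : ℝ × Vec d => hess p.1 p.2

def mvE {d : ℕ} (M : Matrix (Fin d) (Fin d) ℝ) (v : Vec d) : Vec d :=
  (EuclideanSpace.equiv (Fin d) ℝ).symm (M.mulVec ((EuclideanSpace.equiv (Fin d) ℝ) v))

variable {n d m : ℕ}

/-- Assumption (A) of the paper. -/
structure AssumptionA (ν : Measure (Vec n)) (A : Set (Vec m)) (T : ℝ)
    (b : Vec m → Vec d → Vec d) (σ : Vec m → Vec d → Matrix (Fin d) (Fin d) ℝ)
    (η : Vec m → Vec d → Vec n → Vec d) (γ : Vec d → Vec n → ℝ)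
    (f : Vec m → ℝ → Vec d → ℝ → Vec d → ℝ → ℝ)
    (ζ : ℝ → Vec d → ℝ) (g : Vec d → ℝ) (C : ℝ) : Prop where
  hC : 0 < C
  hT : 0 < T
  hAcpt : IsCompact A
  hAne : A.Nonempty
  hν_sf : SigmaFinite ν
  hν_zero : ν {0} = 0
  hν_int : Integrable (fun e => min 1 (‖e‖ ^ 2)) ν
  hη_meas : ∀ α x, Measurable (η α x)
  hγ_meas : ∀ x, Measurable (γ x)
  hb : ∀ α ∈ A, ∀ α' ∈ A, ∀ x x' : Vec d,
      ‖b α x - b α' x'‖ + ‖σ α x - σ α' x'‖ ≤ C * (‖x - x'‖ + ‖α - α'‖)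
  hη_lip : ∀ α ∈ A, ∀ α' ∈ A, ∀ (x x' : Vec d) (e : Vec n),
      ‖η α x e - η α' x' e‖ ≤ C * (‖x - x'‖ + ‖α - α'‖) * min 1 ‖e‖
  hη_bdd : ∀ α ∈ A, ∀ (x : Vec d) (e : Vec n), ‖η α x e‖ ≤ C * min 1 ‖e‖
  hγ_lip : ∀ (x x' : Vec d) (e : Vec n),
      |γ x e - γ x' e| ≤ C * ‖x - x'‖ * min 1 (‖e‖ ^ 2)
  hγ_nonneg : ∀ x e, 0 ≤ γ x e
  hγ_bdd : ∀ (x : Vec d) (e : Vec n), γ x e ≤ C * min 1 ‖e‖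
  hf_t_cont : ∀ α x u p k, Continuous fun t => f α t x u p k
  hf_bdd : ∀ α ∈ A, ∀ t ∈ Icc (0:ℝ) T, ∀ x : Vec d, |f α t x 0 0 0| ≤ C
  hf_mono : ∀ α ∈ A, ∀ t ∈ Icc (0:ℝ) T, ∀ (x : Vec d) (p : Vec d) (k u v : ℝ),
      v ≤ u → C * (u - v) ≤ f α t x v p k - f α t x u p k
  hf_k_mono : ∀ α ∈ A, ∀ t ∈ Icc (0:ℝ) T, ∀ (x : Vec d) (u : ℝ) (p : Vec d),
      Monotone fun k => f α t x u p k
  hf_lip : ∀ α ∈ A, ∀ α' ∈ A, ∀ t ∈ Icc (0:ℝ) T, ∀ (x : Vec d) (u v : ℝ) (p q : Vec d) (k k' : ℝ),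
      |f α t x u p k - f α' t x v q k'| ≤ C * (‖α - α'‖ + |u - v| + ‖p - q‖ + |k - k'|)
  hf_x : ∀ R > (0:ℝ), ∃ mR : ℝ → ℝ, Continuous mR ∧ mR 0 = 0 ∧ (∀ r, 0 ≤ mR r) ∧
      ∀ α ∈ A, ∀ t ∈ Icc (0:ℝ) T, ∀ (x x' : Vec d) (u : ℝ) (p : Vec d) (k : ℝ),
        ‖x‖ ≤ R → ‖x'‖ ≤ R → |u| ≤ R →
        |f α t x u p k - f α t x' u p k| ≤ mR (‖x - x'‖ * (1 + ‖p‖))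
  hζ_t_cont : ∀ x, Continuous fun t => ζ t x
  hζg_lip : ∀ (t : ℝ) (x x' : Vec d), |g x - g x'| + |ζ t x - ζ t x'| ≤ C * ‖x - x'‖
  hζg_bdd : ∀ (t : ℝ) (x : Vec d), |g x| + |ζ t x| ≤ C
  hgζ : ∀ x, ζ 0 x ≤ g x

/-- The nonlocal operator `K^α`. -/
def Kop (ν : Measure (Vec n)) (η : Vec m → Vec d → Vec n → Vec d)
    (φ : C12 d) (α : Vec m) (t : ℝ) (x : Vec d) : ℝ :=
  ∫ e, (φ.toFun t (x + η α x e) - φ.toFun t x - ⟪η α x e, φ.grad t x⟫) ∂ν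

/-- The nonlocal operator `B^α`. -/
def Bop (ν : Measure (Vec n)) (η : Vec m → Vec d → Vec n → Vec d) (γ : Vec d → Vec n → ℝ)
    (φ : C12 d) (α : Vec m) (t : ℝ) (x : Vec d) : ℝ :=
  ∫ e, (φ.toFun t (x + η α x e) - φ.toFun t x) * γ x e ∂ν

/-- The local operator `A^α`. -/
def Aop (b : Vec m → Vec d → Vec d) (σ : Vec m → Vec d → Matrix (Fin d) (Fin d) ℝ)
    (φ : C12 d) (α : Vec m) (t : ℝ) (x : Vec d) : ℝ :=
  (1/2) * Matrix.trace (σ α x * (σ α x)ᵀ * φ.hess t x) + ⟪b α x, φ.grad t x⟫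

/-- `L^α = A^α + K^α`. -/
def Lop (ν : Measure (Vec n)) (b : Vec m → Vec d → Vec d)
    (σ : Vec m → Vec d → Matrix (Fin d) (Fin d) ℝ) (η : Vec m → Vec d → Vec n → Vec d)
    (φ : C12 d) (α : Vec m) (t : ℝ) (x : Vec d) : ℝ :=
  Aop b σ φ α t x + Kop ν η φ α t x

/-- Modified diffusion matrix `σ̃`. -/
def sigmaTilde (ν : Measure (Vec n)) (σ : Vec m → Vec d → Matrix (Fin d) (Fin d) ℝ)
    (η : Vec m → Vec d → Vec n → Vec d) (ε : ℝ) (α : Vec m) (x : Vec d) :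
    Matrix (Fin d) (Fin d) ℝ :=
  Matrix.of fun i j =>
    if i = j then
      Real.sqrt ((σ α x i i) ^ 2 + ∫ e in {e : Vec n | ‖e‖ < ε}, (η α x e i) ^ 2 ∂ν)
    else σ α x i j

/-- Truncated `K_ε^α`. -/
def Ktr (ν : Measure (Vec n)) (η : Vec m → Vec d → Vec n → Vec d) (ε : ℝ)
    (φ : C12 d) (α : Vec m) (t : ℝ) (x : Vec d) : ℝ :=
  Kop (ν.restrict {e : Vec n | ε < ‖e‖}) η φ α t x

/-- Truncated `B_ε^α`. -/
def Btr (ν : Measure (Vec n)) (η : Vec m → Vec d → Vec n → Vec d) (γ : Vec d → Vec n → ℝ)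
    (ε : ℝ) (φ : C12 d) (α : Vec m) (t : ℝ) (x : Vec d) : ℝ :=
  Bop (ν.restrict {e : Vec n | ε < ‖e‖}) η γ φ α t x

/-- Truncated `L_ε^α`. -/
def Ltr (ν : Measure (Vec n)) (b : Vec m → Vec d → Vec d)
    (σ : Vec m → Vec d → Matrix (Fin d) (Fin d) ℝ) (η : Vec m → Vec d → Vec n → Vec d)
    (ε : ℝ) (φ : C12 d) (α : Vec m) (t : ℝ) (x : Vec d) : ℝ :=
  (1/2) * Matrix.trace (sigmaTilde ν σ η ε α x * (sigmaTilde ν σ η ε α x)ᵀ * φ.hess t x)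
    + ⟪b α x, φ.grad t x⟫ + Ktr ν η ε φ α t x

/-- Viscosity subsolution of the HJBVI
`min{ u − ζ, ∂ₜu + inf_{α∈A}( −L^α u − f(α,t,x,u,σᵀDu,B^α u) ) } = 0`. -/
def SubsolnHJBVI (ν : Measure (Vec n)) (A : Set (Vec m)) (T : ℝ)
    (b : Vec m → Vec d → Vec d) (σ : Vec m → Vec d → Matrix (Fin d) (Fin d) ℝ)
    (η : Vec m → Vec d → Vec n → Vec d) (γ : Vec d → Vec n → ℝ)
    (f : Vec m → ℝ → Vec d → ℝ → Vec d → ℝ → ℝ) (ζ : ℝ → Vec d → ℝ)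
    (u : ℝ → Vec d → ℝ) : Prop :=
  ∀ (φ : C12 d) (t₀ : ℝ) (x₀ : Vec d), t₀ ∈ Ioc (0:ℝ) T →
    (∀ t ∈ Icc (0:ℝ) T, ∀ x, u t x - φ.toFun t x ≤ u t₀ x₀ - φ.toFun t₀ x₀) →
    min (u t₀ x₀ - ζ t₀ x₀)
      (φ.dt t₀ x₀ + ⨅ α : A, (-(Lop ν b σ η φ (↑α) t₀ x₀)
        - f (↑α) t₀ x₀ (u t₀ x₀) (mvE ((σ (↑α) x₀)ᵀ) (φ.grad t₀ x₀))
            (Bop ν η γ φ (↑α) t₀ x₀))) ≤ 0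

/-- Viscosity supersolution of the HJBVI. -/
def SupersolnHJBVI (ν : Measure (Vec n)) (A : Set (Vec m)) (T : ℝ)
    (b : Vec m → Vec d → Vec d) (σ : Vec m → Vec d → Matrix (Fin d) (Fin d) ℝ)
    (η : Vec m → Vec d → Vec n → Vec d) (γ : Vec d → Vec n → ℝ)
    (f : Vec m → ℝ → Vec d → ℝ → Vec d → ℝ → ℝ) (ζ : ℝ → Vec d → ℝ)
    (u : ℝ → Vec d → ℝ) : Prop :=
  ∀ (φ : C12 d) (t₀ : ℝ) (x₀ : Vec d), t₀ ∈ Ioc (0:ℝ) T →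
    (∀ t ∈ Icc (0:ℝ) T, ∀ x, u t₀ x₀ - φ.toFun t₀ x₀ ≤ u t x - φ.toFun t x) →
    0 ≤ min (u t₀ x₀ - ζ t₀ x₀)
      (φ.dt t₀ x₀ + ⨅ α : A, (-(Lop ν b σ η φ (↑α) t₀ x₀)
        - f (↑α) t₀ x₀ (u t₀ x₀) (mvE ((σ (↑α) x₀)ᵀ) (φ.grad t₀ x₀))
            (Bop ν η γ φ (↑α) t₀ x₀)))

/-- Viscosity subsolution of the `A'`-HJBVI with `ε`-truncated operators. -/
def SubsolnHJBVIe (ν : Measure (Vec n)) (A' : Set (Vec m)) (T : ℝ)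
    (b : Vec m → Vec d → Vec d) (σ : Vec m → Vec d → Matrix (Fin d) (Fin d) ℝ)
    (η : Vec m → Vec d → Vec n → Vec d) (γ : Vec d → Vec n → ℝ)
    (f : Vec m → ℝ → Vec d → ℝ → Vec d → ℝ → ℝ) (ζ : ℝ → Vec d → ℝ) (ε : ℝ)
    (u : ℝ → Vec d → ℝ) : Prop :=
  ∀ (φ : C12 d) (t₀ : ℝ) (x₀ : Vec d), t₀ ∈ Ioc (0:ℝ) T →
    (∀ t ∈ Icc (0:ℝ) T, ∀ x, u t x - φ.toFun t x ≤ u t₀ x₀ - φ.toFun t₀ x₀) →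
    min (u t₀ x₀ - ζ t₀ x₀)
      (φ.dt t₀ x₀ + ⨅ α : A', (-(Ltr ν b σ η ε φ (↑α) t₀ x₀)
        - f (↑α) t₀ x₀ (u t₀ x₀) (mvE ((sigmaTilde ν σ η ε (↑α) x₀)ᵀ) (φ.grad t₀ x₀))
            (Btr ν η γ ε φ (↑α) t₀ x₀))) ≤ 0

/-- Viscosity supersolution of the `A'`-HJBVI with `ε`-truncated operators. -/
def SupersolnHJBVIe (ν : Measure (Vec n)) (A' : Set (Vec m)) (T : ℝ)
    (b : Vec m → Vec d → Vec d) (σ : Vec m → Vec d → Matrix (Fin d) (Fin d) ℝ)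
    (η : Vec m → Vec d → Vec n → Vec d) (γ : Vec d → Vec n → ℝ)
    (f : Vec m → ℝ → Vec d → ℝ → Vec d → ℝ → ℝ) (ζ : ℝ → Vec d → ℝ) (ε : ℝ)
    (u : ℝ → Vec d → ℝ) : Prop :=
  ∀ (φ : C12 d) (t₀ : ℝ) (x₀ : Vec d), t₀ ∈ Ioc (0:ℝ) T →
    (∀ t ∈ Icc (0:ℝ) T, ∀ x, u t₀ x₀ - φ.toFun t₀ x₀ ≤ u t x - φ.toFun t x) →
    0 ≤ min (u t₀ x₀ - ζ t₀ x₀)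
      (φ.dt t₀ x₀ + ⨅ α : A', (-(Ltr ν b σ η ε φ (↑α) t₀ x₀)
        - f (↑α) t₀ x₀ (u t₀ x₀) (mvE ((sigmaTilde ν σ η ε (↑α) x₀)ᵀ) (φ.grad t₀ x₀))
            (Btr ν η γ ε φ (↑α) t₀ x₀)))

/-- The switching obstacle `M_j U = max_{k ≠ j} (U_k − c)`. -/
def MaxSw {J : ℕ} (U : Fin J → ℝ → Vec d → ℝ) (c : ℝ) (j : Fin J) (t : ℝ) (x : Vec d) : ℝ :=
  ⨆ k : {k : Fin J // k ≠ j}, (U (↑k) t x - c)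

/-- Viscosity subsolution of the switching system. -/
def SubsolnSwitch (ν : Measure (Vec n)) (T : ℝ)
    (b : Vec m → Vec d → Vec d) (σ : Vec m → Vec d → Matrix (Fin d) (Fin d) ℝ)
    (η : Vec m → Vec d → Vec n → Vec d) (γ : Vec d → Vec n → ℝ)
    (f : Vec m → ℝ → Vec d → ℝ → Vec d → ℝ → ℝ) (ζ : ℝ → Vec d → ℝ) (ε : ℝ)
    {J : ℕ} (αs : Fin J → Vec m) (c : ℝ) (U : Fin J → ℝ → Vec d → ℝ) : Prop :=
  ∀ (j : Fin J) (φ : C12 d) (t₀ : ℝ) (x₀ : Vec d), t₀ ∈ Ioc (0:ℝ) T →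
    (∀ t ∈ Icc (0:ℝ) T, ∀ x, U j t x - φ.toFun t x ≤ U j t₀ x₀ - φ.toFun t₀ x₀) →
    min (U j t₀ x₀ - ζ t₀ x₀)
      (min (φ.dt t₀ x₀ - Ltr ν b σ η ε φ (αs j) t₀ x₀
          - f (αs j) t₀ x₀ (U j t₀ x₀)
              (mvE ((sigmaTilde ν σ η ε (αs j) x₀)ᵀ) (φ.grad t₀ x₀))
              (Btr ν η γ ε φ (αs j) t₀ x₀))
        (U j t₀ x₀ - MaxSw U c j t₀ x₀)) ≤ 0

/-- Viscosity supersolution of the switching system. -/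
def SupersolnSwitch (ν : Measure (Vec n)) (T : ℝ)
    (b : Vec m → Vec d → Vec d) (σ : Vec m → Vec d → Matrix (Fin d) (Fin d) ℝ)
    (η : Vec m → Vec d → Vec n → Vec d) (γ : Vec d → Vec n → ℝ)
    (f : Vec m → ℝ → Vec d → ℝ → Vec d → ℝ → ℝ) (ζ : ℝ → Vec d → ℝ) (ε : ℝ)
    {J : ℕ} (αs : Fin J → Vec m) (c : ℝ) (U : Fin J → ℝ → Vec d → ℝ) : Prop :=
  ∀ (j : Fin J) (φ : C12 d) (t₀ : ℝ) (x₀ : Vec d), t₀ ∈ Ioc (0:ℝ) T →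
    (∀ t ∈ Icc (0:ℝ) T, ∀ x, U j t₀ x₀ - φ.toFun t₀ x₀ ≤ U j t x - φ.toFun t x) →
    0 ≤ min (U j t₀ x₀ - ζ t₀ x₀)
      (min (φ.dt t₀ x₀ - Ltr ν b σ η ε φ (αs j) t₀ x₀
          - f (αs j) t₀ x₀ (U j t₀ x₀)
              (mvE ((sigmaTilde ν σ η ε (αs j) x₀)ᵀ) (φ.grad t₀ x₀))
              (Btr ν η γ ε φ (αs j) t₀ x₀))
        (U j t₀ x₀ - MaxSw U c j t₀ x₀))

/-- Every point of the graph of `W` is touched from below by a paraboloid of opening `lam`. -/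
def HasLowerParaboloids {E : Type*} [NormedAddCommGroup E] [InnerProductSpace ℝ E]
    (lam : ℝ) (W : E → ℝ) : Prop :=
  ∀ x, ∃ p : E, ∀ z, W x + ⟪p, z - x⟫ - lam * ‖z - x‖ ^ 2 ≤ W z

section Jensen

variable {E : Type*} [NormedAddCommGroup E] [InnerProductSpace ℝ E]

lemma HasLowerParaboloids.of_contact {lam : ℝ} (hlam : 0 < lam) {W : E → ℝ}
    (hS : HasLowerParaboloids lam W) {y G : E} (hy : ∀ z, W z ≤ W y + ⟪G, z - y⟫) (z : E) :
    W y + ⟪G, z - y⟫ - lam * ‖z - y‖ ^ 2 ≤ W z := by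
  obtain ⟨p, hp⟩ := hS y
  have hpG : p = G := by
    have h1 := hp (y + (1 / (2 * lam)) • (p - G))
    have h2 := hy (y + (1 / (2 * lam)) • (p - G))
    simp only [add_sub_cancel_left, inner_smul_right, norm_smul] at h1 h2
    have h3 : ⟪p, p - G⟫ - ⟪G, p - G⟫ = ‖p - G‖ ^ 2 := by
      rw [← inner_sub_left, real_inner_self_eq_norm_sq]
    have h4 : lam * (‖1 / (2 * lam)‖ * ‖p - G‖) ^ 2 = 1 / (4 * lam) * ‖p - G‖ ^ 2 := by
      rw [Real.norm_of_nonneg (by positivity)]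
      field_simp; ring
    rw [h4] at h1
    have h5 : 1 / (2 * lam) * ‖p - G‖ ^ 2 ≤ 1 / (4 * lam) * ‖p - G‖ ^ 2 := by
      rw [← h3] at h1 ⊢
      nlinarith
    have h6 : 1 / (2 * lam) = 2 * (1 / (4 * lam)) := by field_simp; ring
    have h7 : 0 < 1 / (4 * lam) := by positivity
    have h8 : ‖p - G‖ ^ 2 ≤ 0 := by
      rw [h6] at h5
      nlinarith [sq_nonneg ‖p - G‖]
    have h9 : ‖p - G‖ = 0 := by
      have := sq_nonneg ‖p - G‖
      exact pow_eq_zero_iff (two_ne_zero) |>.1 (le_antisymm h8 this)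
    exact sub_eq_zero.1 (norm_eq_zero.1 h9)
  rw [← hpG]
  exact hp z

lemma norm_sub_le_of_contact {lam : ℝ} (hlam : 0 < lam) {W : E → ℝ}
    (hS : HasLowerParaboloids lam W) {y y' P G : E} (hy' : ∀ z, W z ≤ W y' + ⟪G, z - y'⟫)
    (hP : ∀ z, W y + ⟪P, z - y⟫ - lam * ‖z - y‖ ^ 2 ≤ W z) :
    ‖P - G‖ ≤ 2 * lam * ‖y - y'‖ := by
  have h1 := hS.of_contact hlam hy' y
  have h2 := hP (y + (1 / (2 * lam)) • (P - G))
  have h3 := hy' (y + (1 / (2 * lam)) • (P - G))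
  have e : y + (1 / (2 * lam)) • (P - G) - y' = (y - y') + (1 / (2 * lam)) • (P - G) := by abel
  rw [e, inner_add_right] at h3
  simp only [add_sub_cancel_left, inner_smul_right, norm_smul] at h2 h3
  have h4 : ⟪P, P - G⟫ - ⟪G, P - G⟫ = ‖P - G‖ ^ 2 := by
    rw [← inner_sub_left, real_inner_self_eq_norm_sq]
  have h5 : lam * (‖1 / (2 * lam)‖ * ‖P - G‖) ^ 2 = 1 / (4 * lam) * ‖P - G‖ ^ 2 := by
    rw [Real.norm_of_nonneg (by positivity)]
    field_simp; ring
  rw [h5] at h2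
  have h6 : 1 / (2 * lam) * ‖P - G‖ ^ 2 - 1 / (4 * lam) * ‖P - G‖ ^ 2 ≤ lam * ‖y - y'‖ ^ 2 := by
    have h6' : 1 / (2 * lam) * (⟪P, P - G⟫ - ⟪G, P - G⟫) - 1 / (4 * lam) * ‖P - G‖ ^ 2
        ≤ lam * ‖y - y'‖ ^ 2 := by rw [mul_sub]; linarith
    rwa [h4] at h6'
  have h7 : 1 / (2 * lam) * ‖P - G‖ ^ 2 - 1 / (4 * lam) * ‖P - G‖ ^ 2
      = ‖P - G‖ ^ 2 / (4 * lam) := by field_simp; ring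
  rw [h7, div_le_iff₀ (by positivity)] at h6
  apply abs_le_of_sq_le_sq' _ (by positivity) |>.2
  nlinarith

lemma HasLowerParaboloids.convexOn {lam : ℝ} {W : E → ℝ}
    (hS : HasLowerParaboloids lam W) : ConvexOn ℝ univ (fun x => W x + lam * ‖x‖ ^ 2) := by
  refine ⟨convex_univ, fun x _ y _ a b ha hb hab => ?_⟩
  obtain ⟨p, hp⟩ := hS (a • x + b • y)
  set z := a • x + b • y with hz
  have key : ∀ w, W z + lam * ‖z‖ ^ 2 + ⟪p + (2 * lam) • z, w - z⟫ ≤ W w + lam * ‖w‖ ^ 2 := by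
    intro w
    have h1 := hp w
    have h2 : ‖w - z‖ ^ 2 = ‖w‖ ^ 2 - 2 * ⟪w, z⟫ + ‖z‖ ^ 2 := norm_sub_sq_real w z
    rw [inner_add_left, inner_smul_left, inner_sub_right z, real_inner_self_eq_norm_sq,
      real_inner_comm w z]
    rw [h2] at h1
    simp only [conj_trivial]
    linarith
  have hx := mul_le_mul_of_nonneg_left (key x) ha
  have hy := mul_le_mul_of_nonneg_left (key y) hb
  have h0 : a * ⟪p + (2 * lam) • z, x - z⟫ + b * ⟪p + (2 * lam) • z, y - z⟫ = 0 := by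
    rw [← inner_smul_right, ← inner_smul_right, ← inner_add_right]
    have : a • (x - z) + b • (y - z) = 0 := by
      have : a • (x - z) + b • (y - z) = (a • x + b • y) - (a + b) • z := by
        rw [smul_sub, smul_sub, add_smul]; abel
      rw [this, hab, one_smul, hz, sub_self]
    rw [this, inner_zero_right]
  simp only [smul_eq_mul]
  have hb' : b = 1 - a := by linarith
  subst hb'
  linarith

lemma HasLowerParaboloids.continuous [FiniteDimensional ℝ E] {lam : ℝ} {W : E → ℝ}
    (hS : HasLowerParaboloids lam W) : Continuous W := by
  have h := (hS.convexOn.continuousOn isOpen_univ)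
  rw [← continuousOn_univ]
  have h2 : ContinuousOn (fun x : E => lam * ‖x‖ ^ 2) univ := by fun_prop
  exact (h.sub h2).congr fun x _ => by simp

/-- A function on `[0, 1]` that is Lipschitz up to a quadratic error is Lipschitz. -/
lemma abs_sub_le_of_quadratic_error {g : ℝ → ℝ} {a b : ℝ}
    (h : ∀ s ∈ Icc (0 : ℝ) 1, ∀ s' ∈ Icc (0 : ℝ) 1,
      |g s' - g s| ≤ a * |s' - s| + b * |s' - s| ^ 2) : |g 1 - g 0| ≤ a := by
  have key : ∀ N : ℕ, 0 < N → |g 1 - g 0| ≤ a + b * (1 / (N : ℝ)) := by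
    intro N hN
    have hN' : (0 : ℝ) < N := by exact_mod_cast hN
    have hk : ∀ k : ℕ, k ≤ N → |g (k / N) - g 0| ≤ k * (a / N + b / (N : ℝ) ^ 2) := by
      intro k
      induction k with
      | zero => intro _; simp
      | succ k ih =>
        intro hk
        have h1 := ih (by omega)
        have hkN : (k : ℝ) + 1 ≤ N := by exact_mod_cast hk
        have h2 := h (k / N) ⟨by positivity, by rw [div_le_one hN']; linarith⟩
          ((k + 1) / N) ⟨by positivity, by rw [div_le_one hN']; linarith⟩
        have e : ((k : ℝ) + 1) / N - k / N = 1 / N := by field_simp; ring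
        rw [e, abs_of_pos (a := 1 / (N : ℝ)) (by positivity)] at h2
        push_cast
        calc |g ((k + 1) / N) - g 0| ≤ |g ((k + 1) / N) - g (k / N)| + |g (k / N) - g 0| :=
              abs_sub_le _ _ _
          _ ≤ (a * (1 / N) + b * (1 / N) ^ 2) + k * (a / N + b / (N : ℝ) ^ 2) := by linarith
          _ = _ := by field_simp; ring
    have h1 := hk N le_rfl
    rw [div_self hN'.ne'] at h1
    calc _ ≤ _ := h1
      _ = _ := by field_simp
  have lim : Tendsto (fun N : ℕ => a + b * (1 / (N : ℝ))) atTop (𝓝 (a + b * 0)) :=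
    tendsto_const_nhds.add (tendsto_const_nhds.mul tendsto_one_div_atTop_nhds_zero_nat)
  rw [mul_zero, add_zero] at lim
  exact ge_of_tendsto lim (eventually_atTop.2 ⟨1, fun N hN => key N hN⟩)

/-- Second order expansion at a density point of the contact set at which the contact slopes
are differentiable. -/
lemma second_order_expansion_of_contact {lam : ℝ} (hlam : 0 < lam) {W : E → ℝ}
    (hS : HasLowerParaboloids lam W) {K : Set E} {G : E → E}
    (hK : ∀ y ∈ K, ∀ z, W z ≤ W y + ⟪G y, z - y⟫) {x : E} (_hx : x ∈ K) {A : E →L[ℝ] E}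
    (hG : HasFDerivWithinAt G A K x)
    (hdens : ∀ c > 0, ∃ r > 0, ∀ y, ‖y - x‖ ≤ r → ∃ y' ∈ K, ‖y' - y‖ ≤ c * ‖y - x‖)
    {c : ℝ} (hc : 0 < c) :
    ∃ r > 0, ∀ h, ‖h‖ ≤ r →
      |W (x + h) - (W x + ⟪G x, h⟫ + 1 / 2 * ⟪A h, h⟫)| ≤ c * ‖h‖ ^ 2 := by
  set c1 : ℝ := min 1 (c / (2 * lam + ‖A‖ + 2)) with hc1
  have hden : 0 < 2 * lam + ‖A‖ + 2 := by positivity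
  have hc1pos : 0 < c1 := lt_min one_pos (by positivity)
  have hc1le : c1 ≤ 1 := min_le_left _ _
  have hc1c : c1 * (2 * lam + ‖A‖ + 2) ≤ c := by
    rw [← le_div_iff₀ hden]; exact min_le_right _ _
  obtain ⟨r1, hr1, hd⟩ := hdens c1 hc1pos
  have hG' := hasFDerivWithinAt_iff_isLittleO.1 hG
  have hG2 := hG'.def hc1pos
  rw [eventually_nhdsWithin_iff, Metric.eventually_nhds_iff] at hG2
  obtain ⟨r2, hr2, hG3⟩ := hG2
  refine ⟨min r1 (r2 / 3), by positivity, fun h hh => ?_⟩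
  have hh1 : ‖h‖ ≤ r1 := hh.trans (min_le_left _ _)
  have hh2 : ‖h‖ ≤ r2 / 3 := hh.trans (min_le_right _ _)
  -- slopes at every point of the segment
  have slope : ∀ s ∈ Icc (0 : ℝ) 1, ∀ P : E,
      (∀ z, W (x + s • h) + ⟪P, z - (x + s • h)⟫ - lam * ‖z - (x + s • h)‖ ^ 2 ≤ W z) →
      |⟪P, h⟫ - ⟪G x, h⟫ - s * ⟪A h, h⟫| ≤ c * ‖h‖ ^ 2 := by
    intro s hs P hP
    set y := x + s • h with hy
    have hyx : y - x = s • h := by rw [hy]; abel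
    have hyn : ‖y - x‖ ≤ ‖h‖ := by
      rw [hyx, norm_smul, Real.norm_of_nonneg hs.1]
      exact mul_le_of_le_one_left (norm_nonneg _) hs.2
    obtain ⟨y', hy'K, hy'⟩ := hd y (hyn.trans hh1)
    have hy'1 : ‖y' - y‖ ≤ c1 * ‖h‖ := hy'.trans (by gcongr)
    have hy'x : ‖y' - x‖ ≤ 2 * ‖h‖ := by
      calc ‖y' - x‖ = ‖(y' - y) + (y - x)‖ := by congr 1; abel
        _ ≤ ‖y' - y‖ + ‖y - x‖ := norm_add_le _ _
        _ ≤ c1 * ‖h‖ + ‖h‖ := by gcongr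
        _ ≤ 1 * ‖h‖ + ‖h‖ := by gcongr
        _ = _ := by ring
    have e1 : ‖P - G y'‖ ≤ 2 * lam * (c1 * ‖h‖) := by
      refine (norm_sub_le_of_contact hlam hS (hK y' hy'K) hP).trans ?_
      rw [norm_sub_rev]; gcongr
    have e2 : ‖G y' - G x - A (y' - x)‖ ≤ c1 * (2 * ‖h‖) := by
      refine (hG3 (y := y') ?_ hy'K).trans (by gcongr)
      rw [dist_eq_norm]
      rcases eq_or_ne h 0 with h0 | h0
      · rw [h0, norm_zero, mul_zero] at hy'x; linarith
      · have := norm_pos_iff.2 h0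
        linarith
    have e3 : ‖A (y' - y)‖ ≤ ‖A‖ * (c1 * ‖h‖) := (A.le_opNorm _).trans (by gcongr)
    have e4 : P - G x - s • A h
        = (P - G y') + (G y' - G x - A (y' - x)) + A (y' - y) := by
      have : A (y' - x) = A (y' - y) + s • A h := by
        rw [← map_smul, ← hyx, ← map_add]; congr 1; abel
      rw [this]; abel
    have e5 : ‖P - G x - s • A h‖ ≤ c * ‖h‖ := by
      rw [e4]
      calc _ ≤ ‖P - G y'‖ + ‖G y' - G x - A (y' - x)‖ + ‖A (y' - y)‖ := norm_add₃_le
        _ ≤ 2 * lam * (c1 * ‖h‖) + c1 * (2 * ‖h‖) + ‖A‖ * (c1 * ‖h‖) := by gcongr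
        _ = c1 * (2 * lam + ‖A‖ + 2) * ‖h‖ := by ring
        _ ≤ c * ‖h‖ := by gcongr
    have e6 : ⟪P, h⟫ - ⟪G x, h⟫ - s * ⟪A h, h⟫ = ⟪P - G x - s • A h, h⟫ := by
      rw [inner_sub_left, inner_sub_left, inner_smul_left]; simp
    rw [e6]
    calc _ ≤ ‖P - G x - s • A h‖ * ‖h‖ := abs_real_inner_le_norm _ _
      _ ≤ c * ‖h‖ * ‖h‖ := by gcongr
      _ = _ := by ring
  set g : ℝ → ℝ := fun s => W (x + s • h) - s * ⟪G x, h⟫ - s ^ 2 / 2 * ⟪A h, h⟫ with hg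
  set b : ℝ := lam * ‖h‖ ^ 2 + |⟪A h, h⟫| / 2 with hb
  have lower : ∀ s ∈ Icc (0 : ℝ) 1, ∀ s' ∈ Icc (0 : ℝ) 1,
      -(c * ‖h‖ ^ 2 * |s' - s| + b * |s' - s| ^ 2) ≤ g s' - g s := by
    intro s hs s' _
    obtain ⟨P, hP⟩ := hS (x + s • h)
    have h1 := slope s hs P hP
    have h2 := hP (x + s' • h)
    have e : x + s' • h - (x + s • h) = (s' - s) • h := by rw [sub_smul]; abel
    rw [e, inner_smul_right, norm_smul, mul_pow, Real.norm_eq_abs] at h2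
    have h3 : g s' - g s = (W (x + s' • h) - W (x + s • h)) - (s' - s) * ⟪P, h⟫
        + (s' - s) * (⟪P, h⟫ - ⟪G x, h⟫ - s * ⟪A h, h⟫) - (s' - s) ^ 2 * (⟪A h, h⟫ / 2) := by
      simp only [hg]; ring
    have h4 : -(|s' - s| * (c * ‖h‖ ^ 2)) ≤ (s' - s) * (⟪P, h⟫ - ⟪G x, h⟫ - s * ⟪A h, h⟫) := by
      have : |(s' - s) * (⟪P, h⟫ - ⟪G x, h⟫ - s * ⟪A h, h⟫)| ≤ |s' - s| * (c * ‖h‖ ^ 2) := by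
        rw [abs_mul]; gcongr
      linarith [neg_abs_le ((s' - s) * (⟪P, h⟫ - ⟪G x, h⟫ - s * ⟪A h, h⟫))]
    have h5 : (s' - s) ^ 2 * (⟪A h, h⟫ / 2) ≤ |s' - s| ^ 2 * (|⟪A h, h⟫| / 2) := by
      rw [sq_abs]; gcongr; exact le_abs_self _
    rw [h3, hb]
    linarith
  have hfin := abs_sub_le_of_quadratic_error (g := g) (a := c * ‖h‖ ^ 2) (b := b) (by
    intro s hs s' hs'
    have h1 := lower s hs s' hs'
    have h2 := lower s' hs' s hs
    rw [abs_sub_comm s s'] at h2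
    rw [abs_le]
    constructor <;> linarith)
  have e : g 1 - g 0 = W (x + h) - (W x + ⟪G x, h⟫ + 1 / 2 * ⟪A h, h⟫) := by
    simp only [hg]; simp; ring
  rwa [e] at hfin

end Jensen

lemma HasLowerParaboloids.sub_sq {E : Type*} [NormedAddCommGroup E] [InnerProductSpace ℝ E]
    {lam : ℝ} {W : E → ℝ} (hS : HasLowerParaboloids lam W)
    (κ : ℝ) (z₀ : E) : HasLowerParaboloids (lam + κ) (fun z => W z - κ * ‖z - z₀‖ ^ 2) := by
  intro x
  obtain ⟨p, hp⟩ := hS x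
  refine ⟨p - (2 * κ) • (x - z₀), fun z => ?_⟩
  have h1 := hp z
  have h2 : ‖z - z₀‖ ^ 2 = ‖z - x‖ ^ 2 + 2 * ⟪z - x, x - z₀⟫ + ‖x - z₀‖ ^ 2 := by
    rw [← norm_add_sq_real]; congr 2; abel
  have h3 : ⟪p - (2 * κ) • (x - z₀), z - x⟫ = ⟪p, z - x⟫ - 2 * κ * ⟪z - x, x - z₀⟫ := by
    rw [inner_sub_left, real_inner_smul_left, real_inner_comm (z - x) (x - z₀)]
  simp only [h2, h3]
  linarith

section SmoothTouching

variable {E : Type*} [NormedAddCommGroup E] [InnerProductSpace ℝ E] [FiniteDimensional ℝ E]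

open scoped Pointwise in
lemma exists_mem_near_of_density [MeasurableSpace E] [BorelSpace E] (μ : Measure E)
    [μ.IsAddHaarMeasure] {K : Set E} {x : E} (hxK : x ∈ K)
    (hx : Tendsto (fun r => μ (K ∩ closedBall x r) / μ (closedBall x r)) (𝓝[>] 0) (𝓝 1))
    {c : ℝ} (hc : 0 < c) :
    ∃ r > 0, ∀ y, ‖y - x‖ ≤ r → ∃ y' ∈ K, ‖y' - y‖ ≤ c * ‖y - x‖ := by
  obtain ⟨t, -, htfin, ht⟩ := finite_cover_balls_of_compact (isCompact_closedBall (0 : E) 1)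
    (e := c / 2) (by positivity)
  have h1 : ∀ v ∈ t, ∀ᶠ r in 𝓝[>] (0 : ℝ), (K ∩ (({x} : Set E) + r • closedBall v (c / 2))).Nonempty :=
    fun v _ => Measure.eventually_nonempty_inter_smul_of_density_one μ K x hx _
      measurableSet_closedBall (measure_closedBall_pos μ v (by positivity)).ne'
  have h2 := (htfin.eventually_all).2 h1
  rw [eventually_nhdsWithin_iff, Metric.eventually_nhds_iff] at h2
  obtain ⟨r0, hr0, h3⟩ := h2
  refine ⟨r0 / 2, by positivity, fun y hy => ?_⟩
  rcases eq_or_ne y x with rfl | hyx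
  · exact ⟨y, hxK, by simp⟩
  have hpos : 0 < ‖y - x‖ := norm_pos_iff.2 (sub_ne_zero.2 hyx)
  have hmem : (‖y - x‖⁻¹ • (y - x)) ∈ closedBall (0 : E) 1 := by
    rw [mem_closedBall_zero_iff, norm_smul, norm_inv, norm_norm, inv_mul_cancel₀ hpos.ne']
  obtain ⟨v, hv⟩ := mem_iUnion.1 (ht hmem)
  obtain ⟨hvt, hvb⟩ := mem_iUnion.1 hv
  have h4 := h3 (y := ‖y - x‖) (by
    rw [dist_zero_right, norm_norm]; linarith) hpos v hvt
  obtain ⟨y', hy'K, hy'⟩ := h4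
  refine ⟨y', hy'K, ?_⟩
  obtain ⟨a, ha, b, hb, hab⟩ := Set.mem_add.1 hy'
  rw [mem_singleton_iff] at ha
  obtain ⟨w, hw, rfl⟩ := Set.mem_smul_set.1 hb
  have e : y' - y = ‖y - x‖ • (w - ‖y - x‖⁻¹ • (y - x)) := by
    rw [smul_sub, smul_smul, mul_inv_cancel₀ hpos.ne', one_smul, ← hab, ha]; abel
  rw [e, norm_smul, norm_norm, mul_comm]
  gcongr
  rw [mem_ball] at hvb
  rw [mem_closedBall] at hw
  have := dist_triangle_right w (‖y - x‖⁻¹ • (y - x)) v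
  rw [← dist_eq_norm]
  linarith

lemma ContactSlope.exists_second_order_expansion {lam : ℝ} (hlam : 0 < lam) {W : E → ℝ}
    (hS : HasLowerParaboloids lam W) {ρ : ℝ} (hρ : 0 < ρ)
    (hmax : ∀ q : E, ‖q‖ ≤ ρ → ∃ x, ∀ z, W z ≤ W x + ⟪q, z - x⟫) :
    ∃ (x q : E) (A : E →L[ℝ] E), ‖q‖ ≤ ρ ∧ (∀ z, W z ≤ W x + ⟪q, z - x⟫) ∧
      ∀ c > 0, ∃ r > 0, ∀ h, ‖h‖ ≤ r →
        |W (x + h) - (W x + ⟪q, h⟫ + 1 / 2 * ⟪A h, h⟫)| ≤ c * ‖h‖ ^ 2 := by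
  classical
  set K : Set E := {x | ∃ q, ‖q‖ ≤ ρ ∧ ∀ z, W z ≤ W x + ⟪q, z - x⟫} with hKdef
  choose! G hG using fun x (hx : x ∈ K) => hx
  have hK : ∀ y ∈ K, ∀ z, W z ≤ W y + ⟪G y, z - y⟫ := fun y hy => (hG y hy).2
  have hLip : LipschitzOnWith (Real.toNNReal (2 * lam)) G K := by
    refine LipschitzOnWith.of_dist_le_mul fun x hx y hy => ?_
    rw [Real.coe_toNNReal _ (by positivity), dist_eq_norm, dist_eq_norm]
    exact norm_sub_le_of_contact hlam hS (hK y hy) (hS.of_contact hlam (hK x hx))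
  have hsurj : closedBall (0 : E) ρ ⊆ G '' K := by
    intro q hq
    rw [mem_closedBall_zero_iff] at hq
    obtain ⟨x, hx⟩ := hmax q hq
    have hxK : x ∈ K := ⟨q, hq, hx⟩
    refine ⟨x, hxK, ?_⟩
    have := norm_sub_le_of_contact hlam hS hx (hS.of_contact hlam (hK x hxK))
    rw [sub_self, norm_zero, mul_zero] at this
    exact sub_eq_zero.1 (norm_le_zero_iff.1 this)
  let _ : MeasurableSpace E := borel E
  have : BorelSpace E := ⟨rfl⟩
  set μ : Measure E := Measure.hausdorffMeasure (Module.finrank ℝ E) with hμ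
  have hpos : 0 < μ (G '' K) := (measure_closedBall_pos μ 0 hρ).trans_le (measure_mono hsurj)
  have hKpos : μ K ≠ 0 := by
    intro h0
    have := hLip.hausdorffMeasure_image_le (d := Module.finrank ℝ E) (by positivity)
    rw [← hμ, h0, mul_zero] at this
    exact absurd this (not_le.2 hpos)
  have hd := hLip.ae_differentiableWithinAt_of_mem (μ := μ)
  have hdens := ae_imp_of_ae_restrict (Besicovitch.ae_tendsto_measure_inter_div μ K)
  have hex : ∃ x ∈ K, DifferentiableWithinAt ℝ G K x ∧
      Tendsto (fun r => μ (K ∩ closedBall x r) / μ (closedBall x r)) (𝓝[>] 0) (𝓝 1) := by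
    by_contra! hcon
    apply hKpos
    have : ∀ᵐ x ∂μ, x ∉ K := by
      filter_upwards [hd, hdens] with x h1 h2 hx
      exact hcon x hx (h1 hx) (h2 hx)
    rw [measure_eq_zero_iff_ae_notMem]
    exact this
  obtain ⟨x, hxK, hdx, hdensx⟩ := hex
  refine ⟨x, G x, fderivWithin ℝ G K x, (hG x hxK).1, hK x hxK, fun c hc => ?_⟩
  exact second_order_expansion_of_contact hlam hS hK hxK hdx.hasFDerivWithinAt
    (fun c hc => exists_mem_near_of_density μ hxK hdensx hc) hc

/-- A continuous function with a second order expansion at `x` is touched from above at `x` by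
a smooth function that stays within `κ ‖z - x‖²` of it. -/
lemma exists_contDiff_touching {W : E → ℝ} (hW : Continuous W) {x : E} {Q : E → ℝ}
    (hQ : ContDiff ℝ 2 Q) (hQx : Q x = W x) {κ r : ℝ} (hκ : 0 < κ) (hr : 0 < r)
    (hlow : ∀ z, ‖z - x‖ ≤ r → W z ≤ Q z)
    (hup : ∀ z, ‖z - x‖ ≤ r → Q z ≤ W z + κ * ‖z - x‖ ^ 2) :
    ∃ F : E → ℝ, ContDiff ℝ 2 F ∧ F x = W x ∧ (∀ z, W z ≤ F z) ∧
      ∀ z, F z ≤ W z + κ * ‖z - x‖ ^ 2 := by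
  obtain ⟨F₀, hF₀, hF₀d, -⟩ := hW.exists_contDiff_approx 2
    (ε := fun _ => κ * r ^ 2 / 8) continuous_const (fun _ => by positivity)
  let χ : ContDiffBump x := ⟨r / 2, r, by positivity, by linarith⟩
  refine ⟨fun z => χ z * Q z + (1 - χ z) * (F₀ z + κ * r ^ 2 / 8), ?_, ?_, ?_, ?_⟩
  · have hχ : ContDiff ℝ 2 (χ : E → ℝ) := χ.contDiff
    exact (hχ.mul hQ).add ((contDiff_const.sub hχ).mul (hF₀.add contDiff_const))
  · have : χ x = 1 := χ.one_of_mem_closedBall (mem_closedBall_self (by positivity))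
    simp [this, hQx]
  · intro z
    have hF := abs_lt.1 (by simpa [Real.dist_eq] using hF₀d z)
    have h0 := χ.nonneg (x := z)
    have h1 := χ.le_one (x := z)
    by_cases hz : ‖z - x‖ ≤ r
    · have := hlow z hz
      nlinarith
    · have : χ z = 0 := χ.zero_of_le_dist (by rw [dist_eq_norm]; exact (not_le.1 hz).le)
      simp only [this]; linarith
  · intro z
    have hF := abs_lt.1 (by simpa [Real.dist_eq] using hF₀d z)
    have h0 := χ.nonneg (x := z)
    have h1 := χ.le_one (x := z)
    by_cases hz2 : ‖z - x‖ ≤ r / 2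
    · have : χ z = 1 := χ.one_of_mem_closedBall (by rw [mem_closedBall, dist_eq_norm]; exact hz2)
      have h3 := hup z (hz2.trans (by linarith))
      simp only [this]; linarith
    · have hz3 : r / 2 ≤ ‖z - x‖ := (not_le.1 hz2).le
      have hb : F₀ z + κ * r ^ 2 / 8 ≤ W z + κ * ‖z - x‖ ^ 2 := by
        have : (r / 2) ^ 2 ≤ ‖z - x‖ ^ 2 := by gcongr
        nlinarith
      by_cases hz : ‖z - x‖ ≤ r
      · have := hup z hz
        nlinarith
      · have : χ z = 0 := χ.zero_of_le_dist (by rw [dist_eq_norm]; exact (not_le.1 hz).le)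
        simp only [this]; linarith

theorem HasLowerParaboloids.exists_smooth_touching {lam : ℝ} (hlam : 0 < lam) {W : E → ℝ}
    (hS : HasLowerParaboloids lam W) {M : ℝ} (hM : ∀ z, W z ≤ M) {κ : ℝ} (hκ : 0 < κ) :
    ∃ (x p : E) (F : E → ℝ), ContDiff ℝ 2 F ∧ F x = W x ∧ (∀ z, W z ≤ F z) ∧
      (∀ z, F z ≤ W z + κ * ‖z - x‖ ^ 2) ∧ (∀ z, W z ≤ W x + κ) ∧ ‖p‖ ≤ κ ∧
      ∀ z, W z ≤ W x + ⟪p, z - x⟫ + κ * ‖z - x‖ ^ 2 := by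
  have hbdd : BddAbove (range W) := ⟨M, by rintro _ ⟨z, rfl⟩; exact hM z⟩
  obtain ⟨z₀, hz₀⟩ : ∃ z₀, ∀ z, W z ≤ W z₀ + κ / 64 := by
    obtain ⟨z₀, h⟩ := exists_lt_of_lt_ciSup (show (⨆ z, W z) - κ / 64 < ⨆ z, W z by linarith)
    exact ⟨z₀, fun z => by linarith [le_ciSup hbdd z]⟩
  have hS' := hS.sub_sq κ z₀
  set V : E → ℝ := fun z => W z - κ * ‖z - z₀‖ ^ 2 with hV
  have hWc := hS.continuous
  have hmax : ∀ q : E, ‖q‖ ≤ κ / 16 → ∃ x, ∀ z, V z ≤ V x + ⟪q, z - x⟫ := by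
    intro q hq
    obtain ⟨x, -, hx⟩ := (isCompact_closedBall z₀ 1).exists_isMaxOn
      ⟨z₀, mem_closedBall_self zero_le_one⟩
      (f := fun z => V z - ⟪q, z - z₀⟫) (by simp only [hV]; fun_prop)
    refine ⟨x, fun z => ?_⟩
    have hx' : ∀ z, V z - ⟪q, z - z₀⟫ ≤ V x - ⟪q, x - z₀⟫ := by
      intro z
      by_cases hz : z ∈ closedBall z₀ 1
      · exact hx hz
      · have h1 := hx (mem_closedBall_self zero_le_one : z₀ ∈ closedBall z₀ 1)
        simp only [mem_ofPred_eq, hV, sub_self, inner_zero_right, norm_zero] at h1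
        rw [mem_closedBall, dist_eq_norm, not_le] at hz
        have h2 := hz₀ z
        have h3 : |⟪q, z - z₀⟫| ≤ κ / 16 * ‖z - z₀‖ :=
          (abs_real_inner_le_norm _ _).trans (by gcongr)
        have h4 := neg_abs_le ⟪q, z - z₀⟫
        have h5 : κ * ‖z - z₀‖ ≤ κ * ‖z - z₀‖ ^ 2 := by
          gcongr; nlinarith
        have h6 : κ * 1 < κ * ‖z - z₀‖ := by gcongr
        simp only [hV]
        linarith
    have h1 := hx' z
    have : ⟪q, z - x⟫ = ⟪q, z - z₀⟫ - ⟪q, x - z₀⟫ := by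
      rw [← inner_sub_right]; congr 1; abel
    linarith
  obtain ⟨x, q, A, hq, hcon, hexp⟩ :=
    ContactSlope.exists_second_order_expansion (by positivity) hS' (by positivity) hmax
  set s := ‖x - z₀‖ with hs
  have hs0 : 0 ≤ s := norm_nonneg _
  have hz0 := hcon z₀
  have hin : ⟪q, z₀ - x⟫ ≤ κ / 16 * s := by
    refine (real_inner_le_norm _ _).trans ?_
    rw [norm_sub_rev z₀ x]; gcongr
  simp only [hV, sub_self, norm_zero] at hz0
  have hx0 := hz₀ x
  rw [← hs] at hz0
  have hsle : s ≤ 1 / 4 := by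
    by_contra hcon
    push Not at hcon
    have h5 : κ * (s * (1 / 4)) ≤ κ * s ^ 2 := by
      rw [sq]; gcongr
    have h6 : κ * (1 / 4) < κ * s := by gcongr
    linarith
  obtain ⟨r, hr, hexp'⟩ := hexp (κ / 2) (by positivity)
  set Q : E → ℝ := fun z => V x + ⟪q, z - x⟫ + 1 / 2 * ⟪A (z - x), z - x⟫ + κ * ‖z - z₀‖ ^ 2
    + κ / 2 * ‖z - x‖ ^ 2 with hQdef
  have hQd : ContDiff ℝ 2 Q := by
    have h1 : ContDiff ℝ 2 fun z : E => z - x := contDiff_id.sub contDiff_const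
    have h2 : ContDiff ℝ 2 fun z : E => ‖z - z₀‖ ^ 2 :=
      (contDiff_id.sub contDiff_const).norm_sq ℝ
    have h3 : ContDiff ℝ 2 fun z : E => ‖z - x‖ ^ 2 := h1.norm_sq ℝ
    have h4 : ContDiff ℝ 2 fun z : E => ⟪A (z - x), z - x⟫ :=
      (A.contDiff.comp h1).inner ℝ h1
    have h5 : ContDiff ℝ 2 fun z : E => ⟪q, z - x⟫ := contDiff_const.inner ℝ h1
    exact (((contDiff_const.add h5).add (contDiff_const.mul h4)).add
      (contDiff_const.mul h2)).add (contDiff_const.mul h3)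
  have hQb : ∀ z, ‖z - x‖ ≤ r → |V z - (V x + ⟪q, z - x⟫ + 1 / 2 * ⟪A (z - x), z - x⟫)|
      ≤ κ / 2 * ‖z - x‖ ^ 2 := by
    intro z hz
    have := hexp' (z - x) hz
    rwa [add_sub_cancel] at this
  obtain ⟨F, hF1, hF2, hF3, hF4⟩ := exists_contDiff_touching hWc (x := x) hQd
    (by simp [hQdef, hV]) hκ hr
    (fun z hz => by
      have := (abs_le.1 (hQb z hz)).2
      simp only [hQdef, hV] at this ⊢; linarith)
    (fun z hz => by
      have := (abs_le.1 (hQb z hz)).1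
      simp only [hQdef, hV] at this ⊢; linarith)
  refine ⟨x, q + (2 * κ) • (x - z₀), F, hF1, hF2, hF3, hF4, fun z => ?_, ?_, fun z => ?_⟩
  · have := hz₀ z
    nlinarith
  · calc ‖q + (2 * κ) • (x - z₀)‖ ≤ ‖q‖ + ‖(2 * κ) • (x - z₀)‖ := norm_add_le _ _
      _ = ‖q‖ + 2 * κ * s := by rw [norm_smul, Real.norm_of_nonneg (by positivity)]
      _ ≤ κ / 16 + 2 * κ * (1 / 4) := by gcongr
      _ ≤ κ := by linarith
  · have h1 := hcon z
    have h2 : ‖z - z₀‖ ^ 2 = ‖z - x‖ ^ 2 + 2 * ⟪z - x, x - z₀⟫ + ‖x - z₀‖ ^ 2 := by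
      rw [← norm_add_sq_real]; congr 2; abel
    rw [inner_add_left, inner_smul_left, real_inner_comm (z - x) (x - z₀)]
    simp only [hV, h2, conj_trivial] at h1 ⊢
    linarith

end SmoothTouching

/-- Norm version of `HasLowerParaboloids.exists_smooth_touching`. -/
theorem exists_smooth_touching_of_lower_paraboloids {E : Type*} [NormedAddCommGroup E]
    [NormedSpace ℝ E] [FiniteDimensional ℝ E] {lam : ℝ} (hlam : 0 < lam) {W : E → ℝ}
    (hS : ∀ x, ∃ p : E →ₗ[ℝ] ℝ, ∀ z, W x + p (z - x) - lam * ‖z - x‖ ^ 2 ≤ W z)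
    {M : ℝ} (hM : ∀ z, W z ≤ M) {κ : ℝ} (hκ : 0 < κ) :
    ∃ (x : E) (p : E →L[ℝ] ℝ) (F : E → ℝ), ContDiff ℝ 2 F ∧ F x = W x ∧ (∀ z, W z ≤ F z) ∧
      (∀ z, F z ≤ W z + κ * ‖z - x‖ ^ 2) ∧ (∀ z, W z ≤ W x + κ) ∧ (∀ h, p h ≤ κ * ‖h‖) ∧
      ∀ z, W z ≤ W x + p (z - x) + κ * ‖z - x‖ ^ 2 := by
  let e := toEuclidean (E := E)
  set a : ℝ := ‖(e : E →L[ℝ] EuclideanSpace ℝ (Fin (Module.finrank ℝ E)))‖ + 1 with ha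
  set b : ℝ := ‖(e.symm : EuclideanSpace ℝ (Fin (Module.finrank ℝ E)) →L[ℝ] E)‖ + 1 with hb
  have ha1 : 1 ≤ a := by simp [ha]
  have hb1 : 1 ≤ b := by simp [hb]
  have hea : ∀ h, ‖e h‖ ≤ a * ‖h‖ := fun h =>
    ((e : E →L[ℝ] EuclideanSpace ℝ (Fin (Module.finrank ℝ E))).le_opNorm h).trans
      (by rw [ha]; gcongr; linarith)
  have heb : ∀ h, ‖e.symm h‖ ≤ b * ‖h‖ := fun h =>
    ((e.symm : EuclideanSpace ℝ (Fin (Module.finrank ℝ E)) →L[ℝ] E).le_opNorm h).trans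
      (by rw [hb]; gcongr; linarith)
  have hS' : HasLowerParaboloids (lam * b ^ 2) (W ∘ e.symm) := by
    intro x
    obtain ⟨p, hp⟩ := hS (e.symm x)
    refine ⟨(InnerProductSpace.toDual ℝ _).symm
      (LinearMap.toContinuousLinearMap (p ∘ₗ e.symm.toLinearEquiv.toLinearMap)), fun z => ?_⟩
    have h1 := hp (e.symm z)
    rw [InnerProductSpace.toDual_symm_apply]
    have h2 : ‖e.symm z - e.symm x‖ ≤ b * ‖z - x‖ := by rw [← map_sub]; exact heb _
    have h3 : ‖e.symm z - e.symm x‖ ^ 2 ≤ b ^ 2 * ‖z - x‖ ^ 2 := by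
      rw [← mul_pow]; gcongr
    have h4 : lam * ‖e.symm z - e.symm x‖ ^ 2 ≤ lam * b ^ 2 * ‖z - x‖ ^ 2 := by
      rw [mul_assoc]; gcongr
    have h5 : (LinearMap.toContinuousLinearMap
        (p ∘ₗ e.symm.toLinearEquiv.toLinearMap)) (z - x) = p (e.symm z - e.symm x) := by
      simp
    rw [h5]
    simp only [Function.comp_apply]
    linarith
  obtain ⟨x, p, F, hF, hFx, h1, h2, h3, h4, h5⟩ := hS'.exists_smooth_touching (by positivity)
    (M := M) (fun z => hM _) (κ := κ / a ^ 2) (by positivity)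
  have hκa : κ / a ^ 2 ≤ κ := div_le_self hκ.le (one_le_pow₀ ha1)
  have hsq : ∀ z, κ / a ^ 2 * ‖e z - x‖ ^ 2 ≤ κ * ‖z - e.symm x‖ ^ 2 := by
    intro z
    have : ‖e z - x‖ ≤ a * ‖z - e.symm x‖ := by
      have := hea (z - e.symm x)
      rwa [map_sub, e.apply_symm_apply] at this
    calc κ / a ^ 2 * ‖e z - x‖ ^ 2 ≤ κ / a ^ 2 * (a * ‖z - e.symm x‖) ^ 2 := by gcongr
      _ = _ := by field_simp
  refine ⟨e.symm x, (InnerProductSpace.toDual ℝ _ p).comp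
      (e : E →L[ℝ] EuclideanSpace ℝ (Fin (Module.finrank ℝ E))), F ∘ e,
    hF.comp e.contDiff, by simpa using hFx, fun z => by simpa using h1 (e z),
    fun z => ?_, fun z => ?_, fun h => ?_, fun z => ?_⟩
  · have := h2 (e z)
    simp only [Function.comp_apply, e.symm_apply_apply] at this ⊢
    linarith [hsq z]
  · have := h3 (e z)
    simp only [Function.comp_apply, e.symm_apply_apply] at this ⊢
    linarith
  · simp only [ContinuousLinearMap.comp_apply, InnerProductSpace.toDual_apply_apply]
    refine (real_inner_le_norm _ _).trans ?_
    calc ‖p‖ * ‖e h‖ ≤ κ / a ^ 2 * (a * ‖h‖) := by gcongr; exact hea h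
      _ = κ / a * ‖h‖ := by field_simp
      _ ≤ κ * ‖h‖ := by gcongr; exact div_le_self hκ.le ha1
  · have := h5 (e z)
    simp only [Function.comp_apply, e.symm_apply_apply, ContinuousLinearMap.comp_apply,
      InnerProductSpace.toDual_apply_apply, ContinuousLinearEquiv.coe_coe, map_sub,
      e.apply_symm_apply, inner_sub_right] at this ⊢
    linarith [hsq z]

/-- A `C²` function of `(t, x)` as a test function. -/
def C12.ofContDiff (Φ : ℝ × Vec d → ℝ) (h : ContDiff ℝ 2 Φ) : C12 d :=
  let G : ℝ × Vec d → Vec d := fun p => (InnerProductSpace.toDual ℝ (Vec d)).symm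
    ((fderiv ℝ Φ p).comp (ContinuousLinearMap.inr ℝ ℝ (Vec d)))
  have hf : ContDiff ℝ 1 (fderiv ℝ Φ) := h.fderiv_right (by norm_num)
  have hG : ContDiff ℝ 1 G :=
    (InnerProductSpace.toDual ℝ (Vec d)).symm.contDiff.comp (hf.clm_comp contDiff_const)
  have hG' : Continuous (fderiv ℝ G) := hG.continuous_fderiv one_ne_zero
  have hΦd : Differentiable ℝ Φ := h.differentiable two_ne_zero
  have hGd : Differentiable ℝ G := hG.differentiable one_ne_zero
  have hsl : ∀ (t : ℝ) (x : Vec d), HasFDerivAt (fun y : Vec d => (t, y))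
      (ContinuousLinearMap.inr ℝ ℝ (Vec d)) x := fun t x => hasFDerivAt_prodMk_right t x
  { toFun := fun t x => Φ (t, x)
    dt := fun t x => fderiv ℝ Φ (t, x) (1, 0)
    grad := fun t x => G (t, x)
    hess := fun t x => Matrix.toEuclideanLin.symm
      (((fderiv ℝ G (t, x)).comp (ContinuousLinearMap.inr ℝ ℝ (Vec d))).toLinearMap)
    hasDt := fun t x => by
      have h1 : HasDerivAt (fun s : ℝ => (s, x)) ((1 : ℝ), (0 : Vec d)) t :=
        (hasDerivAt_id t).prodMk (hasDerivAt_const t x)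
      exact (hΦd (t, x)).hasFDerivAt.comp_hasDerivAt t h1
    hasGrad := fun t x => by
      rw [hasGradientAt_iff_hasFDerivAt]
      simp only [G, LinearIsometryEquiv.apply_symm_apply]
      exact (hΦd (t, x)).hasFDerivAt.comp x (hsl t x)
    hasHess := fun t x => by
      have h1 := (hGd (t, x)).hasFDerivAt.comp x (hsl t x)
      refine h1.congr_fderiv ?_
      rw [LinearEquiv.apply_symm_apply]
      ext; rfl
    cont := h.continuous
    cont_dt := (hf.continuous.clm_apply continuous_const)
    cont_grad := hG.continuous
    cont_hess := by
      have h2 : Continuous fun p : ℝ × Vec d =>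
          ((fderiv ℝ G p).comp (ContinuousLinearMap.inr ℝ ℝ (Vec d))) :=
        hG'.clm_comp continuous_const
      let e : (Vec d →L[ℝ] Vec d) →ₗ[ℝ] Matrix (Fin d) (Fin d) ℝ :=
        Matrix.toEuclideanLin.symm.toLinearMap ∘ₗ ContinuousLinearMap.coeLM ℝ
      exact (LinearMap.continuous_of_finiteDimensional e).comp h2 }

lemma C12.ofContDiff_toFun (Φ : ℝ × Vec d → ℝ) (h : ContDiff ℝ 2 Φ) (t : ℝ) (x : Vec d) :
    (C12.ofContDiff Φ h).toFun t x = Φ (t, x) := rfl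

/-- The opposite of a test function. -/
def C12.neg (φ : C12 d) : C12 d where
  toFun := fun t x => -φ.toFun t x
  dt := fun t x => -φ.dt t x
  grad := fun t x => -φ.grad t x
  hess := fun t x => -φ.hess t x
  hasDt := fun t x => (φ.hasDt t x).neg
  hasGrad := fun t x => by
    rw [hasGradientAt_iff_hasFDerivAt, map_neg]
    exact (φ.hasGrad t x).hasFDerivAt.neg
  hasHess := fun t x => by
    refine (φ.hasHess t x).neg.congr_fderiv ?_
    rw [map_neg, map_neg]
  cont := φ.cont.neg
  cont_dt := φ.cont_dt.neg
  cont_grad := φ.cont_grad.neg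
  cont_hess := φ.cont_hess.neg

/-- A differentiable function touched from above by a parabola has the same slope. -/
lemma deriv_eq_of_quadratic_upper {G : ℝ → ℝ} {G' L K : ℝ} (hG : HasDerivAt G G' 0)
    (h : ∀ s, G s ≤ G 0 + L * s + K * s ^ 2) : G' = L := by
  have h1 : HasDerivAt (fun s => G s - (G 0 + L * s + K * s ^ 2)) (G' - L) 0 := by
    have h2 : HasDerivAt (fun s : ℝ => G 0 + L * s + K * s ^ 2) (L * 1 + K * (2 * 0 ^ 1 * 1)) 0 := by
      have := ((hasDerivAt_const (0:ℝ) (G 0)).add ((hasDerivAt_id (0:ℝ)).const_mul L)).add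
        (((hasDerivAt_id (0:ℝ)).pow 2).const_mul K)
      exact this.congr_deriv (by simp)
    exact (hG.sub h2).congr_deriv (by ring)
  have h2 : IsLocalMax (fun s => G s - (G 0 + L * s + K * s ^ 2)) 0 := by
    refine Filter.Eventually.of_forall fun s => ?_
    have := h s
    simp only
    linarith
  linarith [h2.hasDerivAt_eq_zero h1]

/-- A one-dimensional function with a quadratic upper bound has second derivative bounded by it. -/
lemma second_deriv_le_of_quadratic_upper {G G₁ : ℝ → ℝ} {L K H : ℝ}
    (hG : ∀ s, HasDerivAt G (G₁ s) s) (hG₁ : HasDerivAt G₁ H 0)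
    (h : ∀ s, G s ≤ G 0 + L * s + K * s ^ 2) : H ≤ 2 * K := by
  have hL := deriv_eq_of_quadratic_upper (hG 0) h
  by_contra! hlt
  set P : ℝ → ℝ := fun s => G s - (G 0 + L * s + K * s ^ 2) with hP
  have hP1 : ∀ s, HasDerivAt P (G₁ s - (L + K * (2 * s))) s := by
    intro s
    have := ((hasDerivAt_const s (G 0)).add ((hasDerivAt_id s).const_mul L)).add
        (((hasDerivAt_id s).pow 2).const_mul K)
    exact ((hG s).sub this).congr_deriv (by simp)
  have hP2 : HasDerivAt (fun s => G₁ s - (L + K * (2 * s))) (H - 2 * K) 0 := by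
    have := (hasDerivAt_const (0:ℝ) L).add (((hasDerivAt_id (0:ℝ)).const_mul 2).const_mul K)
    exact (hG₁.sub this).congr_deriv (by ring)
  have hd : deriv P = fun s => G₁ s - (L + K * (2 * s)) := funext fun s => (hP1 s).deriv
  have hdd : 0 < deriv (deriv P) 0 := by rw [hd, hP2.deriv]; linarith
  have hd0 : deriv P 0 = 0 := by rw [hd]; simp [hL]
  have hmin := isLocalMin_of_deriv_deriv_pos hdd hd0 (hP1 0).continuousAt
  have hP0 : P 0 = 0 := by simp [hP]
  have hz : P =ᶠ[𝓝 0] fun _ => 0 := by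
    filter_upwards [hmin] with s hs
    rw [hP0] at hs
    have := h s
    refine le_antisymm ?_ hs
    simp only [hP]; linarith
  have : deriv (deriv P) 0 = 0 := by
    have h1 := hz.deriv
    rw [h1.deriv_eq]
    simp
  linarith

lemma C12.hasDerivAt_line (φ : C12 d) (t : ℝ) (x h : Vec d) (s : ℝ) :
    HasDerivAt (fun s : ℝ => φ.toFun t (x + s • h)) ⟪φ.grad t (x + s • h), h⟫ s := by
  have h1 : HasDerivAt (fun s : ℝ => x + s • h) h s := by
    simpa using ((hasDerivAt_id s).smul_const h).const_add x
  have := (φ.hasGrad t (x + s • h)).hasFDerivAt.comp_hasDerivAt s h1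
  exact this.congr_deriv (by simp)

lemma C12.hasDerivAt_grad_line (φ : C12 d) (t : ℝ) (x h : Vec d) :
    HasDerivAt (fun s : ℝ => ⟪φ.grad t (x + s • h), h⟫)
      ⟪Matrix.toEuclideanLin (φ.hess t x) h, h⟫ 0 := by
  have h1 : HasDerivAt (fun s : ℝ => x + s • h) h 0 := by
    simpa using ((hasDerivAt_id (0:ℝ)).smul_const h).const_add x
  have h2 : HasFDerivAt (φ.grad t)
      ((Matrix.toEuclideanLin (φ.hess t x)).toContinuousLinearMap) (x + (0:ℝ) • h) := by
    rw [zero_smul, add_zero]; exact φ.hasHess t x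
  have h3 := h2.comp_hasDerivAt (0:ℝ) h1
  have := h3.inner ℝ (hasDerivAt_const (0:ℝ) h)
  simpa using this

/-- Linear bound with quadratic error determines the gradient. -/
lemma C12.grad_eq_of_upper (φ : C12 d) (t : ℝ) (x g : Vec d) (K : ℝ)
    (h : ∀ k, φ.toFun t (x + k) ≤ φ.toFun t x + ⟪g, k⟫ + K * ‖k‖ ^ 2) : φ.grad t x = g := by
  refine ext_inner_right ℝ fun k => ?_
  have h1 := φ.hasDerivAt_line t x k 0
  rw [zero_smul, add_zero] at h1
  refine deriv_eq_of_quadratic_upper (K := K * ‖k‖ ^ 2) h1 fun s => ?_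
  have := h (s • k)
  simp only [zero_smul, add_zero]
  rw [real_inner_smul_right, norm_smul, mul_pow, Real.norm_eq_abs, sq_abs] at this
  linarith

lemma C12.grad_eq_of_lower (φ : C12 d) (t : ℝ) (x g : Vec d) (K : ℝ)
    (h : ∀ k, φ.toFun t x + ⟪g, k⟫ - K * ‖k‖ ^ 2 ≤ φ.toFun t (x + k)) : φ.grad t x = g := by
  have := φ.neg.grad_eq_of_upper t x (-g) K (fun k => by
    have := h k
    simp only [C12.neg, inner_neg_left]
    linarith)
  simpa [C12.neg] using this

lemma C12.dt_eq_of_upper (φ : C12 d) (t : ℝ) (x : Vec d) (L K : ℝ)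
    (h : ∀ s, φ.toFun (t + s) x ≤ φ.toFun t x + L * s + K * s ^ 2) : φ.dt t x = L := by
  have h1 : HasDerivAt (fun s : ℝ => φ.toFun (t + s) x) (φ.dt t x) 0 := by
    have h2 : HasDerivAt (fun s => φ.toFun s x) (φ.dt t x) (t + 0) := by
      rw [add_zero]; exact φ.hasDt t x
    simpa using h2.comp_const_add t 0
  exact deriv_eq_of_quadratic_upper (K := K) h1 fun s => by simpa using h s

/-- Joint second order inequality for a pair of test functions. -/
lemma C12.hess_add_hess_le (φ₁ φ₂ : C12 d) (t₁ t₂ : ℝ) (x₁ x₂ h k : Vec d) (L K : ℝ)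
    (hle : ∀ s : ℝ, φ₁.toFun t₁ (x₁ + s • h) + φ₂.toFun t₂ (x₂ + s • k) ≤
      φ₁.toFun t₁ x₁ + φ₂.toFun t₂ x₂ + L * s + K * s ^ 2) :
    ⟪Matrix.toEuclideanLin (φ₁.hess t₁ x₁) h, h⟫ + ⟪Matrix.toEuclideanLin (φ₂.hess t₂ x₂) k, k⟫
      ≤ 2 * K :=
  second_deriv_le_of_quadratic_upper (L := L)
    (fun s => (φ₁.hasDerivAt_line t₁ x₁ h s).add (φ₂.hasDerivAt_line t₂ x₂ k s))
    ((φ₁.hasDerivAt_grad_line t₁ x₁ h).add (φ₂.hasDerivAt_grad_line t₂ x₂ k))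
    (fun s => by simpa using hle s)

/-- The `i`-th column of a matrix, as a Euclidean vector. -/
def colE (M : Matrix (Fin d) (Fin d) ℝ) (i : Fin d) : Vec d := WithLp.toLp 2 (fun j => M j i)

lemma trace_mul_transpose_mul (S H : Matrix (Fin d) (Fin d) ℝ) :
    Matrix.trace (S * Sᵀ * H) = ∑ i, ⟪Matrix.toEuclideanLin H (colE S i), colE S i⟫ := by
  rw [Matrix.mul_assoc, Matrix.trace_mul_comm, Matrix.trace]
  refine Finset.sum_congr rfl fun i _ => ?_
  have : Matrix.toEuclideanLin H (colE S i) = WithLp.toLp 2 (H *ᵥ fun j => S j i) := rfl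
  rw [this]
  simp only [Matrix.diag_apply, colE, PiLp.inner_apply, Matrix.mul_apply,
    Matrix.mulVec, dotProduct, Matrix.transpose_apply, RCLike.inner_apply, conj_trivial]
  simp only [Finset.sum_mul, Finset.mul_sum]
  rw [Finset.sum_comm]
  refine Finset.sum_congr rfl fun j _ => Finset.sum_congr rfl fun k _ => ?_
  ring

lemma norm_le_sum_abs (v : Vec d) : ‖v‖ ≤ ∑ j, |v j| := by
  rw [EuclideanSpace.norm_eq, Real.sqrt_le_left (Finset.sum_nonneg fun _ _ => abs_nonneg _)]
  simp only [Real.norm_eq_abs]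
  exact Finset.sum_sq_le_sq_sum_of_nonneg fun _ _ => abs_nonneg _

lemma norm_colE_le (S : Matrix (Fin d) (Fin d) ℝ) (i : Fin d) : ‖colE S i‖ ≤ d * ‖S‖ := by
  refine (norm_le_sum_abs _).trans ?_
  calc ∑ j, |colE S i j| ≤ ∑ _j : Fin d, ‖S‖ :=
        Finset.sum_le_sum fun j _ => Matrix.norm_entry_le_entrywise_sup_norm S
    _ = d * ‖S‖ := by simp

lemma colE_sub (S S' : Matrix (Fin d) (Fin d) ℝ) (i : Fin d) :
    colE (S - S') i = colE S i - colE S' i := rfl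

lemma mvE_transpose_apply (S : Matrix (Fin d) (Fin d) ℝ) (v : Vec d) (i : Fin d) :
    mvE Sᵀ v i = ⟪v, colE S i⟫ := by
  simp [mvE, colE, Matrix.mulVec, dotProduct, PiLp.inner_apply]

lemma norm_mvE_transpose_le (S : Matrix (Fin d) (Fin d) ℝ) (v : Vec d) :
    ‖mvE Sᵀ v‖ ≤ d * (d * ‖S‖ * ‖v‖) := by
  refine (norm_le_sum_abs _).trans ?_
  calc ∑ j, |mvE Sᵀ v j| ≤ ∑ _j : Fin d, d * ‖S‖ * ‖v‖ :=
        Finset.sum_le_sum fun j _ => by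
          rw [mvE_transpose_apply]
          refine (abs_real_inner_le_norm _ _).trans ?_
          rw [mul_comm]; gcongr; exact norm_colE_le S j
    _ = _ := by simp

/-- The slowly growing weight `log (1 + ‖x‖²)`. -/
def logw (x : Vec d) : ℝ := Real.log (1 + ‖x‖ ^ 2)

lemma logw_nonneg (x : Vec d) : 0 ≤ logw x := Real.log_nonneg (by nlinarith [sq_nonneg ‖x‖])

lemma logw_add_le (x h : Vec d) :
    logw (x + h) ≤ logw x + (2 * ⟪x, h⟫ + ‖h‖ ^ 2) / (1 + ‖x‖ ^ 2) := by
  have h1 : 0 < 1 + ‖x‖ ^ 2 := by positivity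
  have h2 : 0 < 1 + ‖x + h‖ ^ 2 := by positivity
  have h3 := Real.log_le_sub_one_of_pos (div_pos h2 h1)
  rw [Real.log_div h2.ne' h1.ne'] at h3
  have h4 : (1 + ‖x + h‖ ^ 2) / (1 + ‖x‖ ^ 2) - 1 = (2 * ⟪x, h⟫ + ‖h‖ ^ 2) / (1 + ‖x‖ ^ 2) := by
    rw [div_sub_one h1.ne', norm_add_sq_real]; congr 1; ring
  rw [h4] at h3
  simp only [logw]
  linarith

lemma contDiff_logw : ContDiff ℝ 2 (logw : Vec d → ℝ) :=
  (contDiff_const.add (contDiff_id.norm_sq ℝ)).log fun x => by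
    have : 0 < 1 + ‖x‖ ^ 2 := by positivity
    exact ne_of_gt this

/-- The anisotropic quadratic form used for sup-convolutions. -/
def qd (c a : ℝ) (z : ℝ × Vec d) : ℝ := c * ‖z.2‖ ^ 2 + a * z.1 ^ 2

/-- The doubling penalty with a logarithmic localization. -/
def pen (c a β : ℝ) (ξ₁ ξ₂ : ℝ × Vec d) : ℝ :=
  c * ‖ξ₁.2 - ξ₂.2‖ ^ 2 + a * (ξ₁.1 - ξ₂.1) ^ 2 + β * (logw ξ₁.2 + logw ξ₂.2)

lemma qd_nonneg {c a : ℝ} (hc : 0 ≤ c) (ha : 0 ≤ a) (z : ℝ × Vec d) : 0 ≤ qd c a z := by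
  unfold qd; positivity

lemma pen_nonneg {c a β : ℝ} (hc : 0 ≤ c) (ha : 0 ≤ a) (hβ : 0 ≤ β) (ξ₁ ξ₂ : ℝ × Vec d) :
    0 ≤ pen c a β ξ₁ ξ₂ := by
  have h1 := logw_nonneg ξ₁.2
  have h2 := logw_nonneg ξ₂.2
  unfold pen; positivity

lemma qd_sub_add (c a : ℝ) (w h : ℝ × Vec d) :
    qd c a (w - h) = qd c a w - 2 * c * ⟪w.2, h.2⟫ - 2 * a * w.1 * h.1 + qd c a h := by
  simp only [qd, Prod.snd_sub, Prod.fst_sub, norm_sub_sq_real]; ring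

lemma pen_add_le {c a β : ℝ} (hβ : 0 ≤ β) (ξ₁ ξ₂ h₁ h₂ : ℝ × Vec d) :
    pen c a β (ξ₁ + h₁) (ξ₂ + h₂) ≤ pen c a β ξ₁ ξ₂
      + 2 * c * ⟪ξ₁.2 - ξ₂.2, h₁.2 - h₂.2⟫ + c * ‖h₁.2 - h₂.2‖ ^ 2
      + 2 * a * (ξ₁.1 - ξ₂.1) * (h₁.1 - h₂.1) + a * (h₁.1 - h₂.1) ^ 2
      + β * ((2 * ⟪ξ₁.2, h₁.2⟫ + ‖h₁.2‖ ^ 2) / (1 + ‖ξ₁.2‖ ^ 2))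
      + β * ((2 * ⟪ξ₂.2, h₂.2⟫ + ‖h₂.2‖ ^ 2) / (1 + ‖ξ₂.2‖ ^ 2)) := by
  have h1 := mul_le_mul_of_nonneg_left (logw_add_le ξ₁.2 h₁.2) hβ
  have h2 := mul_le_mul_of_nonneg_left (logw_add_le ξ₂.2 h₂.2) hβ
  have h3 : (ξ₁ + h₁).2 - (ξ₂ + h₂).2 = (ξ₁.2 - ξ₂.2) + (h₁.2 - h₂.2) := by
    simp only [Prod.snd_add]; abel
  have h4 : (ξ₁ + h₁).1 - (ξ₂ + h₂).1 = (ξ₁.1 - ξ₂.1) + (h₁.1 - h₂.1) := by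
    simp only [Prod.fst_add]; ring
  simp only [pen, h3, h4, norm_add_sq_real]
  simp only [Prod.snd_add]
  linarith

lemma div_one_add_sq_le (x : Vec d) (r : ℝ) (hr : 0 ≤ r) : r / (1 + ‖x‖ ^ 2) ≤ r :=
  div_le_self hr (by nlinarith [sq_nonneg ‖x‖])

lemma contDiff_pen (c a β : ℝ) :
    ContDiff ℝ 2 fun p : (ℝ × Vec d) × (ℝ × Vec d) => pen c a β p.1 p.2 := by
  have h1 : ContDiff ℝ 2 fun p : (ℝ × Vec d) × (ℝ × Vec d) => p.1.2 := by fun_prop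
  have h2 : ContDiff ℝ 2 fun p : (ℝ × Vec d) × (ℝ × Vec d) => p.2.2 := by fun_prop
  have h3 : ContDiff ℝ 2 fun p : (ℝ × Vec d) × (ℝ × Vec d) => p.1.1 - p.2.1 := by fun_prop
  unfold pen
  exact ((contDiff_const.mul ((h1.sub h2).norm_sq ℝ)).add (contDiff_const.mul (h3.pow 2))).add
    (contDiff_const.mul ((contDiff_logw.comp h1).add (contDiff_logw.comp h2)))

/-- `U` is the sup-convolution of `u` over `[0, T] × ℝ^d`, with maximizers `Z`. -/
structure IsSupConv (T c a : ℝ) (u : ℝ → Vec d → ℝ) (U : ℝ × Vec d → ℝ)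
    (Z : ℝ × Vec d → ℝ × Vec d) : Prop where
  mem : ∀ ξ, (Z ξ).1 ∈ Icc (0 : ℝ) T
  eq : ∀ ξ, U ξ = u (Z ξ).1 (Z ξ).2 - qd c a (Z ξ - ξ)
  ge : ∀ ξ y, y.1 ∈ Icc (0 : ℝ) T → u y.1 y.2 - qd c a (y - ξ) ≤ U ξ

lemma exists_isSupConv {T c a M : ℝ} (hT : 0 ≤ T) (hc : 0 < c) (ha : 0 < a)
    {u : ℝ → Vec d → ℝ} (hM : ∀ t x, |u t x| ≤ M)
    (hu : UpperSemicontinuousOn (fun p : ℝ × Vec d => u p.1 p.2) (Icc 0 T ×ˢ univ)) :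
    ∃ U Z, IsSupConv T c a u U Z := by
  have key : ∀ ξ : ℝ × Vec d, ∃ z : ℝ × Vec d, z.1 ∈ Icc (0 : ℝ) T ∧
      ∀ y : ℝ × Vec d, y.1 ∈ Icc (0 : ℝ) T →
        u y.1 y.2 - qd c a (y - ξ) ≤ u z.1 z.2 - qd c a (z - ξ) := by
    intro ξ
    have hM0 : 0 ≤ M := (abs_nonneg _).trans (hM 0 0)
    set r := Real.sqrt ((2 * M + a * ξ.1 ^ 2 + a * 0) / c) with hr
    have hK : IsCompact (Icc (0 : ℝ) T ×ˢ closedBall ξ.2 r) :=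
      isCompact_Icc.prod (isCompact_closedBall _ _)
    have hne : ((0 : ℝ), ξ.2) ∈ Icc (0 : ℝ) T ×ˢ closedBall ξ.2 r :=
      ⟨⟨le_rfl, hT⟩, mem_closedBall_self (Real.sqrt_nonneg _)⟩
    have hcont : Continuous fun y : ℝ × Vec d => -qd c a (y - ξ) := by
      unfold qd; fun_prop
    have husc : UpperSemicontinuousOn (fun y : ℝ × Vec d => u y.1 y.2 + -qd c a (y - ξ))
        (Icc (0 : ℝ) T ×ˢ closedBall ξ.2 r) :=
      (hu.mono (prod_mono_right (subset_univ _))).add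
        hcont.continuousOn.upperSemicontinuousOn
    obtain ⟨z, hz, hzmax⟩ := husc.exists_isMaxOn ⟨_, hne⟩ hK
    refine ⟨z, hz.1, fun y hy => ?_⟩
    by_cases hyr : y.2 ∈ closedBall ξ.2 r
    · have := hzmax (show y ∈ Icc (0 : ℝ) T ×ˢ closedBall ξ.2 r from ⟨hy, hyr⟩)
      simp only [mem_ofPred_eq] at this
      linarith
    · have h0 := hzmax hne
      simp only [mem_ofPred_eq] at h0
      rw [mem_closedBall, dist_eq_norm, not_le] at hyr
      have h1 : (2 * M + a * ξ.1 ^ 2 + a * 0) / c < ‖y.2 - ξ.2‖ ^ 2 :=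
        (Real.sqrt_lt' ((Real.sqrt_nonneg _).trans_lt hyr)).1 hyr
      rw [div_lt_iff₀ hc] at h1
      have h2 := abs_le.1 (hM y.1 y.2)
      have h3 := abs_le.1 (hM 0 ξ.2)
      have h4 : 0 ≤ a * (y.1 - ξ.1) ^ 2 := by positivity
      simp only [qd, Prod.fst_sub, Prod.snd_sub, sub_self, norm_zero] at h0 ⊢
      nlinarith
  choose Z hZ1 hZ2 using key
  exact ⟨fun ξ => u (Z ξ).1 (Z ξ).2 - qd c a (Z ξ - ξ), Z, hZ1, fun _ => rfl, fun ξ y hy => hZ2 ξ y hy⟩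

namespace IsSupConv

variable {T c a : ℝ} {u : ℝ → Vec d → ℝ} {U : ℝ × Vec d → ℝ} {Z : ℝ × Vec d → ℝ × Vec d}

lemma le_of_bound (h : IsSupConv T c a u U Z) (hc : 0 ≤ c) (ha : 0 ≤ a) {M : ℝ}
    (hM : ∀ t x, |u t x| ≤ M) (ξ : ℝ × Vec d) : U ξ ≤ M := by
  rw [h.eq]
  linarith [(abs_le.1 (hM (Z ξ).1 (Z ξ).2)).2, qd_nonneg hc ha (Z ξ - ξ)]

lemma lower (h : IsSupConv T c a u U Z) (ξ k : ℝ × Vec d) :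
    U ξ + 2 * c * ⟪(Z ξ - ξ).2, k.2⟫ + 2 * a * (Z ξ - ξ).1 * k.1 - qd c a k ≤ U (ξ + k) := by
  have h1 := h.ge (ξ + k) (Z ξ) (h.mem ξ)
  rw [← sub_sub, qd_sub_add] at h1
  rw [h.eq ξ]
  linarith

/-- A smooth function touching the sup-convolution from above gives, after a shift, a test
function for the original function. -/
lemma exists_test (h : IsSupConv T c a u U Z) {F : ℝ × Vec d → ℝ} (hF : ContDiff ℝ 2 F)
    {ξ : ℝ × Vec d} (hFξ : F ξ = U ξ) (hUF : ∀ z, U z ≤ F z) :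
    ∃ φ : C12 d,
      (∀ k, φ.toFun ((Z ξ).1 + k.1) ((Z ξ).2 + k.2) = F (ξ + k) + qd c a (Z ξ - ξ)) ∧
      φ.toFun (Z ξ).1 (Z ξ).2 = u (Z ξ).1 (Z ξ).2 ∧
      (∀ t ∈ Icc (0 : ℝ) T, ∀ x, u t x ≤ φ.toFun t x) := by
  have hd : ContDiff ℝ 2 fun y : ℝ × Vec d => F (y - Z ξ + ξ) + qd c a (Z ξ - ξ) :=
    (hF.comp ((contDiff_id.sub contDiff_const).add contDiff_const)).add contDiff_const
  refine ⟨C12.ofContDiff _ hd, fun k => ?_, ?_, fun t ht x => ?_⟩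
  · rw [C12.ofContDiff_toFun]
    congr 2
    rw [show ((Z ξ).1 + k.1, (Z ξ).2 + k.2) = Z ξ + k from rfl]
    abel
  · rw [C12.ofContDiff_toFun, Prod.mk.eta, sub_self, zero_add, hFξ, h.eq]; ring
  · rw [C12.ofContDiff_toFun]
    have h1 := h.ge ((t, x) - Z ξ + ξ) (t, x) ht
    have h2 := hUF ((t, x) - Z ξ + ξ)
    rw [show (t, x) - ((t, x) - Z ξ + ξ) = Z ξ - ξ by abel] at h1
    linarith

end IsSupConv

/-- The doubled functional with sup-convolution variables. -/
def dbl (c a β : ℝ) (u₁ u₂ : ℝ → Vec d → ℝ) (y₁ y₂ ξ₁ ξ₂ : ℝ × Vec d) : ℝ :=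
  u₁ y₁.1 y₁.2 + u₂ y₂.1 y₂.2 - qd c a (y₁ - ξ₁) - qd c a (y₂ - ξ₂) - pen c a β ξ₁ ξ₂

/-- A pair of test functions at an approximate maximum of the doubled functional, with the
matrix inequality of the theorem on sums in increment form. -/
structure DoublingJets (T c a β κ M : ℝ) (u₁ u₂ : ℝ → Vec d → ℝ) where
  (ξ₁ ξ₂ z₁ z₂ : ℝ × Vec d)
  (φ₁ φ₂ : C12 d)
  mem₁ : z₁.1 ∈ Icc (0 : ℝ) T
  mem₂ : z₂.1 ∈ Icc (0 : ℝ) T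
  max₁ : ∀ t ∈ Icc (0 : ℝ) T, ∀ x,
    u₁ t x - φ₁.toFun t x ≤ u₁ z₁.1 z₁.2 - φ₁.toFun z₁.1 z₁.2
  max₂ : ∀ t ∈ Icc (0 : ℝ) T, ∀ x,
    u₂ t x - φ₂.toFun t x ≤ u₂ z₂.1 z₂.2 - φ₂.toFun z₂.1 z₂.2
  value : ∀ y₁ y₂ ζ₁ ζ₂ : ℝ × Vec d, y₁.1 ∈ Icc (0 : ℝ) T → y₂.1 ∈ Icc (0 : ℝ) T →
    dbl c a β u₁ u₂ y₁ y₂ ζ₁ ζ₂ ≤ dbl c a β u₁ u₂ z₁ z₂ ξ₁ ξ₂ + κ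
  dt : |φ₁.dt z₁.1 z₁.2 + φ₂.dt z₂.1 z₂.2| ≤ κ
  grad₁ : ‖φ₁.grad z₁.1 z₁.2 - ((2 * c) • (ξ₁.2 - ξ₂.2)
    + (2 * β / (1 + ‖ξ₁.2‖ ^ 2)) • ξ₁.2)‖ ≤ κ
  grad₂ : ‖φ₂.grad z₂.1 z₂.2 - (-((2 * c) • (ξ₁.2 - ξ₂.2))
    + (2 * β / (1 + ‖ξ₂.2‖ ^ 2)) • ξ₂.2)‖ ≤ κ
  upper : ∀ h k : Vec d, φ₁.toFun z₁.1 (z₁.2 + h) + φ₂.toFun z₂.1 (z₂.2 + k) ≤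
    φ₁.toFun z₁.1 z₁.2 + φ₂.toFun z₂.1 z₂.2
      + ⟪φ₁.grad z₁.1 z₁.2, h⟫ + ⟪φ₂.grad z₂.1 z₂.2, k⟫ + c * ‖h - k‖ ^ 2
      + β * (‖h‖ ^ 2 / (1 + ‖ξ₁.2‖ ^ 2)) + β * (‖k‖ ^ 2 / (1 + ‖ξ₂.2‖ ^ 2))
      + κ * (‖h‖ ^ 2 + ‖k‖ ^ 2)
  lower₁ : ∀ h : Vec d, φ₁.toFun z₁.1 z₁.2 + ⟪φ₁.grad z₁.1 z₁.2, h⟫ - c * ‖h‖ ^ 2 ≤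
    φ₁.toFun z₁.1 (z₁.2 + h)
  lower₂ : ∀ h : Vec d, φ₂.toFun z₂.1 z₂.2 + ⟪φ₂.grad z₂.1 z₂.2, h⟫ - c * ‖h‖ ^ 2 ≤
    φ₂.toFun z₂.1 (z₂.2 + h)
  osc₁ : ∀ h : Vec d, |φ₁.toFun z₁.1 (z₁.2 + h) - φ₁.toFun z₁.1 z₁.2| ≤ 4 * M + κ * ‖h‖ ^ 2
  osc₂ : ∀ h : Vec d, |φ₂.toFun z₂.1 (z₂.2 + h) - φ₂.toFun z₂.1 z₂.2| ≤ 4 * M + κ * ‖h‖ ^ 2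

lemma exists_lower_paraboloid_doubling {T c a β : ℝ} (hc : 0 < c) (ha : 0 < a) (hβ : 0 < β)
    {u₁ u₂ : ℝ → Vec d → ℝ} {U₁ U₂ : ℝ × Vec d → ℝ} {Z₁ Z₂ : ℝ × Vec d → ℝ × Vec d}
    (h₁ : IsSupConv T c a u₁ U₁ Z₁) (h₂ : IsSupConv T c a u₂ U₂ Z₂)
    (ξ : (ℝ × Vec d) × (ℝ × Vec d)) :
    ∃ p : (ℝ × Vec d) × (ℝ × Vec d) →ₗ[ℝ] ℝ, ∀ z,
      U₁ ξ.1 + U₂ ξ.2 - pen c a β ξ.1 ξ.2 + p (z - ξ) - (6 * c + 6 * a + 2 * β) * ‖z - ξ‖ ^ 2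
        ≤ U₁ z.1 + U₂ z.2 - pen c a β z.1 z.2 := by
  refine ⟨{
        toFun := fun H => 2 * c * ⟪(Z₁ ξ.1 - ξ.1).2, H.1.2⟫ + 2 * a * (Z₁ ξ.1 - ξ.1).1 * H.1.1
          + 2 * c * ⟪(Z₂ ξ.2 - ξ.2).2, H.2.2⟫ + 2 * a * (Z₂ ξ.2 - ξ.2).1 * H.2.1
          - 2 * c * ⟪ξ.1.2 - ξ.2.2, H.1.2 - H.2.2⟫ - 2 * a * (ξ.1.1 - ξ.2.1) * (H.1.1 - H.2.1)
          - β * ((2 * ⟪ξ.1.2, H.1.2⟫) / (1 + ‖ξ.1.2‖ ^ 2))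
          - β * ((2 * ⟪ξ.2.2, H.2.2⟫) / (1 + ‖ξ.2.2‖ ^ 2))
        map_add' := fun H H' => by
          simp only [Prod.fst_add, Prod.snd_add, inner_add_right, inner_sub_right]; ring
        map_smul' := fun s H => by
          simp only [Prod.smul_fst, Prod.smul_snd, real_inner_smul_right, inner_sub_right,
            smul_eq_mul, RingHom.id_apply]
          ring }, fun z => ?_⟩
  obtain ⟨H, rfl⟩ : ∃ H, z = ξ + H := ⟨z - ξ, by abel⟩
  simp only [LinearMap.coe_mk, AddHom.coe_mk, add_sub_cancel_left]
  have e1 := h₁.lower ξ.1 H.1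
  have e2 := h₂.lower ξ.2 H.2
  have e3 := pen_add_le (c := c) (a := a) hβ.le ξ.1 ξ.2 H.1 H.2
  have n1 : ‖H.1.2‖ ≤ ‖H‖ := (norm_snd_le H.1).trans (norm_fst_le H)
  have n2 : ‖H.2.2‖ ≤ ‖H‖ := (norm_snd_le H.2).trans (norm_snd_le H)
  have n3 : |H.1.1| ≤ ‖H‖ := (norm_fst_le H.1).trans (norm_fst_le H)
  have n4 : |H.2.1| ≤ ‖H‖ := (norm_fst_le H.2).trans (norm_snd_le H)
  have n5 : ‖H.1.2 - H.2.2‖ ≤ 2 * ‖H‖ := (norm_sub_le _ _).trans (by linarith)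
  have n6 : |H.1.1 - H.2.1| ≤ 2 * ‖H‖ := (abs_sub _ _).trans (by linarith)
  have q1 : c * ‖H.1.2‖ ^ 2 ≤ c * ‖H‖ ^ 2 := by gcongr
  have q2 : c * ‖H.2.2‖ ^ 2 ≤ c * ‖H‖ ^ 2 := by gcongr
  have q3 : a * H.1.1 ^ 2 ≤ a * ‖H‖ ^ 2 := by rw [← sq_abs]; gcongr
  have q4 : a * H.2.1 ^ 2 ≤ a * ‖H‖ ^ 2 := by rw [← sq_abs]; gcongr
  have q5 : c * ‖H.1.2 - H.2.2‖ ^ 2 ≤ c * (2 * ‖H‖) ^ 2 := by gcongr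
  have q6 : a * (H.1.1 - H.2.1) ^ 2 ≤ a * (2 * ‖H‖) ^ 2 := by rw [← sq_abs]; gcongr
  have q7 : β * (‖H.1.2‖ ^ 2 / (1 + ‖ξ.1.2‖ ^ 2)) ≤ β * ‖H‖ ^ 2 := by
    gcongr; exact (div_one_add_sq_le _ _ (by positivity)).trans (by gcongr)
  have q8 : β * (‖H.2.2‖ ^ 2 / (1 + ‖ξ.2.2‖ ^ 2)) ≤ β * ‖H‖ ^ 2 := by
    gcongr; exact (div_one_add_sq_le _ _ (by positivity)).trans (by gcongr)
  rw [add_div, add_div, mul_add, mul_add] at e3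
  simp only [qd] at e1 e2
  simp only [Prod.fst_add, Prod.snd_add] at e3 ⊢
  linarith

set_option maxHeartbeats 1000000 in
theorem exists_doublingJets {T c a β κ M : ℝ} (hT : 0 ≤ T) (hc : 0 < c) (ha : 0 < a)
    (hβ : 0 < β) (hκ : 0 < κ) {u₁ u₂ : ℝ → Vec d → ℝ}
    (hM₁ : ∀ t x, |u₁ t x| ≤ M) (hM₂ : ∀ t x, |u₂ t x| ≤ M)
    (hu₁ : UpperSemicontinuousOn (fun p : ℝ × Vec d => u₁ p.1 p.2) (Icc 0 T ×ˢ univ))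
    (hu₂ : UpperSemicontinuousOn (fun p : ℝ × Vec d => u₂ p.1 p.2) (Icc 0 T ×ˢ univ))
    {z : ℝ × Vec d} (hzT : z.1 ∈ Icc (0 : ℝ) T) (hz : κ ≤ dbl c a β u₁ u₂ z z z z) :
    Nonempty (DoublingJets T c a β κ M u₁ u₂) := by
  obtain ⟨U₁, Z₁, h₁⟩ := exists_isSupConv hT hc ha hM₁ hu₁
  obtain ⟨U₂, Z₂, h₂⟩ := exists_isSupConv hT hc ha hM₂ hu₂
  obtain ⟨κ', hκ', rfl⟩ : ∃ κ', 0 < κ' ∧ κ = 2 * κ' := ⟨κ / 2, by positivity, by ring⟩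
  obtain ⟨ξ, p, F, hF, hFξ, hWF, hFW, hval, hp, hWp⟩ := exists_smooth_touching_of_lower_paraboloids
    (show 0 < 6 * c + 6 * a + 2 * β by positivity)
    (fun ξ => exists_lower_paraboloid_doubling hc ha hβ h₁ h₂ ξ)
    (M := 2 * M) (fun ζ => by
      linarith [h₁.le_of_bound hc.le ha.le hM₁ ζ.1, h₂.le_of_bound hc.le ha.le hM₂ ζ.2,
        pen_nonneg hc.le ha.le hβ.le ζ.1 ζ.2]) hκ'
  obtain ⟨ξ₁, ξ₂⟩ := ξ
  simp only at hFξ hWF hFW hval hWp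
  have hFp : ∀ H, F ((ξ₁, ξ₂) + H) ≤ F (ξ₁, ξ₂) + p H + 2 * κ' * ‖H‖ ^ 2 := by
    intro H
    have e1 := hFW ((ξ₁, ξ₂) + H)
    have e2 := hWp ((ξ₁, ξ₂) + H)
    rw [add_sub_cancel_left] at e1 e2
    linarith
  have hvalue : ∀ y₁ y₂ ζ₁ ζ₂ : ℝ × Vec d, y₁.1 ∈ Icc (0 : ℝ) T → y₂.1 ∈ Icc (0 : ℝ) T →
      dbl c a β u₁ u₂ y₁ y₂ ζ₁ ζ₂ ≤ dbl c a β u₁ u₂ (Z₁ ξ₁) (Z₂ ξ₂) ξ₁ ξ₂ + κ' := by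
    intro y₁ y₂ ζ₁ ζ₂ hy₁ hy₂
    have e1 := hval (ζ₁, ζ₂)
    have e2 := h₁.ge ζ₁ y₁ hy₁
    have e3 := h₂.ge ζ₂ y₂ hy₂
    simp only [dbl]
    have e4 := h₁.eq ξ₁
    have e5 := h₂.eq ξ₂
    simp only at e1
    linarith
  have hlow : 0 ≤ dbl c a β u₁ u₂ (Z₁ ξ₁) (Z₂ ξ₂) ξ₁ ξ₂ := by
    have := hvalue z z z z hzT hzT
    linarith
  have hq₁ := qd_nonneg hc.le ha.le (Z₁ ξ₁ - ξ₁)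
  have hq₂ := qd_nonneg hc.le ha.le (Z₂ ξ₂ - ξ₂)
  have hpn := pen_nonneg hc.le ha.le hβ.le ξ₁ ξ₂
  have hU₁ := h₁.eq ξ₁
  have hU₂ := h₂.eq ξ₂
  have hb₁ := hM₁ (Z₁ ξ₁).1 (Z₁ ξ₁).2
  have hb₂ := hM₂ (Z₂ ξ₂).1 (Z₂ ξ₂).2
  have b₁ := abs_le.1 hb₁
  have b₂ := abs_le.1 hb₂
  simp only [dbl] at hlow
  obtain ⟨φ₁, hφ₁, hφz₁, hφu₁⟩ := h₁.exists_test (ξ := ξ₁)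
    (F := fun y => F (y, ξ₂) + pen c a β y ξ₂ - U₂ ξ₂)
    (((hF.comp (contDiff_id.prodMk contDiff_const)).add
      ((contDiff_pen c a β).comp (contDiff_id.prodMk contDiff_const))).sub contDiff_const)
    (by simp only [hFξ]; ring) (fun y => by linarith [hWF (y, ξ₂)])
  obtain ⟨φ₂, hφ₂, hφz₂, hφu₂⟩ := h₂.exists_test (ξ := ξ₂)
    (F := fun y => F (ξ₁, y) + pen c a β ξ₁ y - U₁ ξ₁)
    (((hF.comp (contDiff_const.prodMk contDiff_id)).add
      ((contDiff_pen c a β).comp (contDiff_const.prodMk contDiff_id))).sub contDiff_const)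
    (by simp only [hFξ]; ring) (fun y => by linarith [hWF (ξ₁, y)])
  beta_reduce at hφ₁ hφ₂
  set z₁ := Z₁ ξ₁ with hz₁
  set z₂ := Z₂ ξ₂ with hz₂
  have up₁ : ∀ k : ℝ × Vec d, φ₁.toFun (z₁.1 + k.1) (z₁.2 + k.2) ≤
      U₁ (ξ₁ + k) + κ' * ‖k‖ ^ 2 + qd c a (z₁ - ξ₁) := by
    intro k
    have e := hFW (ξ₁ + k, ξ₂)
    have e2 : (ξ₁ + k, ξ₂) - (ξ₁, ξ₂) = (k, (0 : ℝ × Vec d)) := by simp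
    rw [e2, Prod.norm_mk, norm_zero, max_eq_left (norm_nonneg _)] at e
    simp only at e
    rw [hφ₁]; linarith
  have up₂ : ∀ k : ℝ × Vec d, φ₂.toFun (z₂.1 + k.1) (z₂.2 + k.2) ≤
      U₂ (ξ₂ + k) + κ' * ‖k‖ ^ 2 + qd c a (z₂ - ξ₂) := by
    intro k
    have e := hFW (ξ₁, ξ₂ + k)
    have e2 : (ξ₁, ξ₂ + k) - (ξ₁, ξ₂) = ((0 : ℝ × Vec d), k) := by simp
    rw [e2, Prod.norm_mk, norm_zero, max_eq_right (norm_nonneg _)] at e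
    simp only at e
    rw [hφ₂]; linarith
  have lo₁ : ∀ h : Vec d, φ₁.toFun z₁.1 z₁.2 + ⟪(2 * c) • (z₁ - ξ₁).2, h⟫ - c * ‖h‖ ^ 2 ≤
      φ₁.toFun z₁.1 (z₁.2 + h) := by
    intro h
    have e := hφ₁ (0, h)
    have e2 := hWF (ξ₁ + (0, h), ξ₂)
    have e3 := h₁.lower ξ₁ (0, h)
    simp only [add_zero, qd, mul_zero, ne_eq, OfNat.ofNat_ne_zero, not_false_eq_true, zero_pow]
      at e e2 e3 hU₁ hφz₁ ⊢
    rw [real_inner_smul_left]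
    linarith
  have lo₂ : ∀ h : Vec d, φ₂.toFun z₂.1 z₂.2 + ⟪(2 * c) • (z₂ - ξ₂).2, h⟫ - c * ‖h‖ ^ 2 ≤
      φ₂.toFun z₂.1 (z₂.2 + h) := by
    intro h
    have e := hφ₂ (0, h)
    have e2 := hWF (ξ₁, ξ₂ + (0, h))
    have e3 := h₂.lower ξ₂ (0, h)
    simp only [add_zero, qd, mul_zero, ne_eq, OfNat.ofNat_ne_zero, not_false_eq_true, zero_pow]
      at e e2 e3 hU₂ hφz₂ ⊢
    rw [real_inner_smul_left]
    linarith
  have g₁ := φ₁.grad_eq_of_lower _ _ _ _ lo₁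
  have g₂ := φ₂.grad_eq_of_lower _ _ _ _ lo₂
  let i₁ : Vec d →L[ℝ] (ℝ × Vec d) × (ℝ × Vec d) :=
    (ContinuousLinearMap.inl ℝ _ _).comp (ContinuousLinearMap.inr ℝ ℝ (Vec d))
  let i₂ : Vec d →L[ℝ] (ℝ × Vec d) × (ℝ × Vec d) :=
    (ContinuousLinearMap.inr ℝ _ _).comp (ContinuousLinearMap.inr ℝ ℝ (Vec d))
  have hi₁ : ∀ k, i₁ k = ((0, k), 0) := fun k => rfl
  have hi₂ : ∀ k, i₂ k = (0, (0, k)) := fun k => rfl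
  have ni₁ : ∀ k, ‖i₁ k‖ = ‖k‖ := fun k => by simp [hi₁]
  have ni₂ : ∀ k, ‖i₂ k‖ = ‖k‖ := fun k => by simp [hi₂]
  set e₁ : Vec d := (InnerProductSpace.toDual ℝ (Vec d)).symm (p.comp i₁) with he₁
  set e₂ : Vec d := (InnerProductSpace.toDual ℝ (Vec d)).symm (p.comp i₂) with he₂
  have ie₁ : ∀ k, ⟪e₁, k⟫ = p ((0, k), 0) := fun k => by
    rw [he₁, InnerProductSpace.toDual_symm_apply]; rfl
  have ie₂ : ∀ k, ⟪e₂, k⟫ = p (0, (0, k)) := fun k => by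
    rw [he₂, InnerProductSpace.toDual_symm_apply]; rfl
  have ne : ∀ e : Vec d, ⟪e, e⟫ ≤ κ' * ‖e‖ → ‖e‖ ≤ κ' := by
    intro e he
    rw [real_inner_self_eq_norm_sq] at he
    by_contra! hcon
    have : κ' * ‖e‖ < ‖e‖ * ‖e‖ := mul_lt_mul_of_pos_right hcon (hκ'.trans hcon)
    nlinarith
  have ne₁ : ‖e₁‖ ≤ κ' := ne _ (by
    rw [ie₁, ← hi₁]; exact (hp _).trans (by rw [ni₁]))
  have ne₂ : ‖e₂‖ ≤ κ' := ne _ (by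
    rw [ie₂, ← hi₂]; exact (hp _).trans (by rw [ni₂]))
  have G₁ : φ₁.grad z₁.1 z₁.2 = (2 * c) • (ξ₁.2 - ξ₂.2) + (2 * β / (1 + ‖ξ₁.2‖ ^ 2)) • ξ₁.2
      + e₁ := by
    refine φ₁.grad_eq_of_upper _ _ _ (c + β + 2 * κ') fun k => ?_
    have a1 := hφ₁ (0, k)
    have a2 := hFp (i₁ k)
    have a3 := pen_add_le (c := c) (a := a) hβ.le ξ₁ ξ₂ (0, k) 0
    rw [ni₁, hi₁, ← ie₁] at a2
    have a4 := div_one_add_sq_le ξ₁.2 (‖k‖ ^ 2) (by positivity)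
    have a5 := mul_le_mul_of_nonneg_left a4 hβ.le
    rw [add_div, mul_add] at a3
    have a6 : ⟪(2 * c) • (ξ₁.2 - ξ₂.2) + (2 * β / (1 + ‖ξ₁.2‖ ^ 2)) • ξ₁.2 + e₁, k⟫ =
      2 * c * ⟪ξ₁.2 - ξ₂.2, k⟫ + β * (2 * ⟪ξ₁.2, k⟫ / (1 + ‖ξ₁.2‖ ^ 2)) + ⟪e₁, k⟫ := by
      rw [inner_add_left, inner_add_left, real_inner_smul_left, real_inner_smul_left]; ring
    rw [a6]
    simp only [add_zero, Prod.mk_add_mk, Prod.snd_zero, Prod.fst_zero, sub_zero, mul_zero,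
      inner_zero_right, norm_zero, ne_eq, OfNat.ofNat_ne_zero, not_false_eq_true, zero_pow,
      zero_div] at a1 a2 a3
    linarith
  have G₂ : φ₂.grad z₂.1 z₂.2 = -((2 * c) • (ξ₁.2 - ξ₂.2)) + (2 * β / (1 + ‖ξ₂.2‖ ^ 2)) • ξ₂.2
      + e₂ := by
    refine φ₂.grad_eq_of_upper _ _ _ (c + β + 2 * κ') fun k => ?_
    have a1 := hφ₂ (0, k)
    have a2 := hFp (i₂ k)
    have a3 := pen_add_le (c := c) (a := a) hβ.le ξ₁ ξ₂ 0 (0, k)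
    rw [ni₂, hi₂, ← ie₂] at a2
    have a4 := div_one_add_sq_le ξ₂.2 (‖k‖ ^ 2) (by positivity)
    have a5 := mul_le_mul_of_nonneg_left a4 hβ.le
    rw [add_div _ _ (1 + ‖ξ₂.2‖ ^ 2), mul_add] at a3
    have a6 : ⟪-((2 * c) • (ξ₁.2 - ξ₂.2)) + (2 * β / (1 + ‖ξ₂.2‖ ^ 2)) • ξ₂.2 + e₂, k⟫ =
      -(2 * c * ⟪ξ₁.2 - ξ₂.2, k⟫) + β * (2 * ⟪ξ₂.2, k⟫ / (1 + ‖ξ₂.2‖ ^ 2)) + ⟪e₂, k⟫ := by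
      rw [inner_add_left, inner_add_left, real_inner_smul_left, inner_neg_left,
        real_inner_smul_left]; ring
    rw [a6]
    simp only [add_zero, Prod.mk_add_mk, Prod.snd_zero, Prod.fst_zero, sub_zero, mul_zero,
      inner_zero_right, norm_zero, ne_eq, OfNat.ofNat_ne_zero, not_false_eq_true, zero_pow,
      zero_div, zero_sub, norm_neg, inner_neg_right] at a1 a2 a3
    linarith
  have dt₁ : φ₁.dt z₁.1 z₁.2 = p ((1, 0), 0) + 2 * a * (ξ₁.1 - ξ₂.1) := by
    refine φ₁.dt_eq_of_upper _ _ _ (a + 2 * κ') fun s => ?_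
    have a1 := hφ₁ (s, 0)
    have a2 := hFp ((s, 0), 0)
    have a3 := pen_add_le (c := c) (a := a) hβ.le ξ₁ ξ₂ (s, 0) 0
    have a4 : (((s, 0), 0) : (ℝ × Vec d) × (ℝ × Vec d)) = s • ((1, 0), 0) := by simp
    have a5 : ‖(((s, 0), 0) : (ℝ × Vec d) × (ℝ × Vec d))‖ ^ 2 = s ^ 2 := by simp
    have a6 : p ((s, 0), 0) = s * p ((1, 0), 0) := by rw [a4, map_smul, smul_eq_mul]
    rw [a5, a6] at a2
    simp only [add_zero, Prod.mk_add_mk, Prod.snd_zero, Prod.fst_zero, sub_zero, mul_zero,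
      inner_zero_right, norm_zero, ne_eq, OfNat.ofNat_ne_zero, not_false_eq_true, zero_pow,
      zero_div] at a1 a2 a3
    linarith
  have dt₂ : φ₂.dt z₂.1 z₂.2 = p (0, (1, 0)) - 2 * a * (ξ₁.1 - ξ₂.1) := by
    refine φ₂.dt_eq_of_upper _ _ _ (a + 2 * κ') fun s => ?_
    have a1 := hφ₂ (s, 0)
    have a2 := hFp (0, (s, 0))
    have a3 := pen_add_le (c := c) (a := a) hβ.le ξ₁ ξ₂ 0 (s, 0)
    have a4 : ((0, (s, 0)) : (ℝ × Vec d) × (ℝ × Vec d)) = s • (0, (1, 0)) := by simp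
    have a5 : ‖((0, (s, 0)) : (ℝ × Vec d) × (ℝ × Vec d))‖ ^ 2 = s ^ 2 := by simp
    have a6 : p (0, (s, 0)) = s * p (0, (1, 0)) := by rw [a4, map_smul, smul_eq_mul]
    rw [a5, a6] at a2
    simp only [add_zero, Prod.mk_add_mk, Prod.snd_zero, Prod.fst_zero, sub_zero, mul_zero,
      inner_zero_right, norm_zero, ne_eq, OfNat.ofNat_ne_zero, not_false_eq_true, zero_pow,
      zero_div, zero_sub, even_two, Even.neg_pow] at a1 a2 a3
    linarith
  refine ⟨⟨ξ₁, ξ₂, z₁, z₂, φ₁, φ₂, h₁.mem ξ₁, h₂.mem ξ₂, fun t ht x => ?_, fun t ht x => ?_,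
    fun y₁ y₂ ζ₁ ζ₂ hy₁ hy₂ => ?_, ?_, ?_, ?_, fun h k => ?_, fun h => ?_, fun h => ?_,
    fun h => ?_, fun h => ?_⟩⟩
  · linarith [hφu₁ t ht x]
  · linarith [hφu₂ t ht x]
  · linarith [hvalue y₁ y₂ ζ₁ ζ₂ hy₁ hy₂]
  · have a1 : φ₁.dt z₁.1 z₁.2 + φ₂.dt z₂.1 z₂.2 = p ((1, 0), (1, 0)) := by
      rw [dt₁, dt₂]
      have : (((1, 0), (1, 0)) : (ℝ × Vec d) × (ℝ × Vec d)) = ((1, 0), 0) + (0, (1, 0)) := by simp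
      rw [this, map_add]; ring
    have a2 := hp ((1, 0), (1, 0))
    have a3 := hp (-((1, 0), (1, 0)))
    have a4 : ‖(((1, 0), (1, 0)) : (ℝ × Vec d) × (ℝ × Vec d))‖ = 1 := by simp
    rw [norm_neg, a4, map_neg] at a3
    rw [a4] at a2
    rw [a1, abs_le]
    constructor <;> linarith
  · rw [G₁, add_sub_cancel_left]; linarith
  · rw [G₂, add_sub_cancel_left]; linarith
  · have a1 := up₁ (0, h)
    have a2 := up₂ (0, k)
    have a3 := hWp (ξ₁ + (0, h), ξ₂ + (0, k))
    have a4 := pen_add_le (c := c) (a := a) hβ.le ξ₁ ξ₂ (0, h) (0, k)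
    have a5 : (ξ₁ + (0, h), ξ₂ + (0, k)) - (ξ₁, ξ₂) = i₁ h + i₂ k := by
      simp [hi₁, hi₂]
    have a6 : p (i₁ h + i₂ k) = ⟪e₁, h⟫ + ⟪e₂, k⟫ := by
      rw [map_add, ie₁, ie₂, hi₁, hi₂]
    have a7 : ‖i₁ h + i₂ k‖ ^ 2 ≤ ‖h‖ ^ 2 + ‖k‖ ^ 2 := by
      have : ‖i₁ h + i₂ k‖ = max ‖h‖ ‖k‖ := by simp [hi₁, hi₂]
      rw [this]
      rcases le_total ‖h‖ ‖k‖ with h' | h'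
      · rw [max_eq_right h']; exact le_add_of_nonneg_left (sq_nonneg _)
      · rw [max_eq_left h']; exact le_add_of_nonneg_right (sq_nonneg _)
    rw [a5, a6] at a3
    have n1 : ‖((0 : ℝ), h)‖ = ‖h‖ := by simp
    have n2 : ‖((0 : ℝ), k)‖ = ‖k‖ := by simp
    rw [n1] at a1
    rw [n2] at a2
    have a8 := mul_le_mul_of_nonneg_left a7 hκ'.le
    have b1 : ⟪φ₁.grad z₁.1 z₁.2, h⟫ =
      2 * c * ⟪ξ₁.2 - ξ₂.2, h⟫ + β * (2 * ⟪ξ₁.2, h⟫ / (1 + ‖ξ₁.2‖ ^ 2)) + ⟪e₁, h⟫ := by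
      rw [G₁, inner_add_left, inner_add_left, real_inner_smul_left, real_inner_smul_left]; ring
    have b2 : ⟪φ₂.grad z₂.1 z₂.2, k⟫ =
      -(2 * c * ⟪ξ₁.2 - ξ₂.2, k⟫) + β * (2 * ⟪ξ₂.2, k⟫ / (1 + ‖ξ₂.2‖ ^ 2)) + ⟪e₂, k⟫ := by
      rw [G₂, inner_add_left, inner_add_left, real_inner_smul_left, inner_neg_left,
        real_inner_smul_left]; ring
    rw [b1, b2, hφz₁, hφz₂]
    rw [add_div, add_div, mul_add, mul_add] at a4
    simp only [add_zero, sub_zero, mul_zero, ne_eq, OfNat.ofNat_ne_zero, not_false_eq_true,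
      zero_pow, inner_sub_right] at a1 a2 a3 a4
    linarith
  · have := lo₁ h
    rwa [← g₁] at this
  · have := lo₂ h
    rwa [← g₂] at this
  · have a1 := up₁ (0, h)
    have a2 := hφu₁ z₁.1 (h₁.mem ξ₁) (z₁.2 + h)
    have a3 := abs_le.1 (hM₁ z₁.1 (z₁.2 + h))
    have a4 := h₁.le_of_bound hc.le ha.le hM₁ (ξ₁ + (0, h))
    have n1 : ‖((0 : ℝ), h)‖ = ‖h‖ := by simp
    have : 0 ≤ κ' * ‖h‖ ^ 2 := by positivity
    rw [n1] at a1
    simp only [add_zero] at a1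
    rw [hφz₁, abs_le]
    constructor <;> linarith
  · have a1 := up₂ (0, h)
    have a2 := hφu₂ z₂.1 (h₂.mem ξ₂) (z₂.2 + h)
    have a3 := abs_le.1 (hM₂ z₂.1 (z₂.2 + h))
    have a4 := h₂.le_of_bound hc.le ha.le hM₂ (ξ₂ + (0, h))
    have n1 : ‖((0 : ℝ), h)‖ = ‖h‖ := by simp
    have : 0 ≤ κ' * ‖h‖ ^ 2 := by positivity
    rw [n1] at a1
    simp only [add_zero] at a1
    rw [hφz₂, abs_le]
    constructor <;> linarith

lemma dbl_le_of_bound {c a β M : ℝ} (hc : 0 ≤ c) (ha : 0 ≤ a) (hβ : 0 ≤ β)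
    {u₁ u₂ : ℝ → Vec d → ℝ} (hM₁ : ∀ t x, |u₁ t x| ≤ M) (hM₂ : ∀ t x, |u₂ t x| ≤ M)
    (y₁ y₂ ξ₁ ξ₂ : ℝ × Vec d) : dbl c a β u₁ u₂ y₁ y₂ ξ₁ ξ₂ ≤ 2 * M := by
  have h1 := (abs_le.1 (hM₁ y₁.1 y₁.2)).2
  have h2 := (abs_le.1 (hM₂ y₂.1 y₂.2)).2
  have h3 := qd_nonneg hc ha (y₁ - ξ₁)
  have h4 := qd_nonneg hc ha (y₂ - ξ₂)
  have h5 := pen_nonneg hc ha hβ ξ₁ ξ₂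
  simp only [dbl]; linarith

/-- The spatial gap measured by the doubled functional. -/
def gapX (y₁ y₂ ξ₁ ξ₂ : ℝ × Vec d) : ℝ :=
  ‖y₁.2 - ξ₁.2‖ ^ 2 + ‖y₂.2 - ξ₂.2‖ ^ 2 + ‖ξ₁.2 - ξ₂.2‖ ^ 2

/-- The temporal gap measured by the doubled functional. -/
def gapT (y₁ y₂ ξ₁ ξ₂ : ℝ × Vec d) : ℝ :=
  (y₁.1 - ξ₁.1) ^ 2 + (y₂.1 - ξ₂.1) ^ 2 + (ξ₁.1 - ξ₂.1) ^ 2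

lemma gapX_nonneg (y₁ y₂ ξ₁ ξ₂ : ℝ × Vec d) : 0 ≤ gapX y₁ y₂ ξ₁ ξ₂ := by
  unfold gapX; positivity

lemma gapT_nonneg (y₁ y₂ ξ₁ ξ₂ : ℝ × Vec d) : 0 ≤ gapT y₁ y₂ ξ₁ ξ₂ := by
  unfold gapT; positivity

lemma dbl_eq (c a β : ℝ) (u₁ u₂ : ℝ → Vec d → ℝ) (y₁ y₂ ξ₁ ξ₂ : ℝ × Vec d) :
    dbl c a β u₁ u₂ y₁ y₂ ξ₁ ξ₂ = u₁ y₁.1 y₁.2 + u₂ y₂.1 y₂.2 - c * gapX y₁ y₂ ξ₁ ξ₂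
      - a * gapT y₁ y₂ ξ₁ ξ₂ - β * (logw ξ₁.2 + logw ξ₂.2) := by
  simp only [dbl, gapX, gapT, qd, pen, Prod.fst_sub, Prod.snd_sub]; ring

/-- Set of values of the doubled functional. -/
def dblValues (T c a β : ℝ) (u₁ u₂ : ℝ → Vec d → ℝ) : Set ℝ :=
  {r | ∃ y₁ y₂ ξ₁ ξ₂ : ℝ × Vec d, y₁.1 ∈ Icc (0 : ℝ) T ∧ y₂.1 ∈ Icc (0 : ℝ) T ∧
    r = dbl c a β u₁ u₂ y₁ y₂ ξ₁ ξ₂}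

theorem exists_good_jets {T β M θ : ℝ} (hT : 0 ≤ T) (hβ : 0 < β) (hθ : 0 < θ)
    {u₁ u₂ : ℝ → Vec d → ℝ} (hM₁ : ∀ t x, |u₁ t x| ≤ M) (hM₂ : ∀ t x, |u₂ t x| ≤ M)
    (hu₁ : UpperSemicontinuousOn (fun p : ℝ × Vec d => u₁ p.1 p.2) (Icc 0 T ×ˢ univ))
    (hu₂ : UpperSemicontinuousOn (fun p : ℝ × Vec d => u₂ p.1 p.2) (Icc 0 T ×ˢ univ))
    {z : ℝ × Vec d} (hzT : z.1 ∈ Icc (0 : ℝ) T)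
    (hz : 2 * θ ≤ u₁ z.1 z.2 + u₂ z.1 z.2 - 2 * β * logw z.2) {ε c₀ : ℝ} (hε : 0 < ε)
    (hc₀ : 0 < c₀) :
    ∃ c ≥ c₀, ∀ δ > 0, ∃ a κ, 0 < κ ∧ κ ≤ ε ∧ ∃ J : DoublingJets T c a β κ M u₁ u₂,
      c * gapX J.z₁ J.z₂ J.ξ₁ J.ξ₂ ≤ ε ∧ |J.z₁.1 - J.z₂.1| ≤ δ ∧
      θ + β * (logw J.ξ₁.2 + logw J.ξ₂.2) ≤ u₁ J.z₁.1 J.z₁.2 + u₂ J.z₂.1 J.z₂.2 := by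
  have hzd : ∀ c a, 2 * θ ≤ dbl c a β u₁ u₂ z z z z := fun c a => by
    rw [dbl_eq]; simp only [gapX, gapT, sub_self, norm_zero]; linarith
  set V : ℝ → ℝ → ℝ := fun c a => sSup (dblValues T c a β u₁ u₂) with hV
  have hbdd : ∀ c a, 0 < c → 0 < a → BddAbove (dblValues T c a β u₁ u₂) := by
    rintro c a hc ha
    refine ⟨2 * M, ?_⟩
    rintro r ⟨y₁, y₂, ξ₁, ξ₂, -, -, rfl⟩
    exact dbl_le_of_bound hc.le ha.le hβ.le hM₁ hM₂ _ _ _ _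
  have hne : ∀ c a, (dblValues T c a β u₁ u₂).Nonempty := fun c a =>
    ⟨_, z, z, z, z, hzT, hzT, rfl⟩
  have hVle : ∀ c a, 0 < c → 0 < a → ∀ y₁ y₂ ξ₁ ξ₂ : ℝ × Vec d, y₁.1 ∈ Icc (0 : ℝ) T →
      y₂.1 ∈ Icc (0 : ℝ) T → dbl c a β u₁ u₂ y₁ y₂ ξ₁ ξ₂ ≤ V c a :=
    fun c a hc ha y₁ y₂ ξ₁ ξ₂ h1 h2 => le_csSup (hbdd c a hc ha) ⟨y₁, y₂, ξ₁, ξ₂, h1, h2, rfl⟩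
  have hVpos : ∀ c a, 0 < c → 0 < a → 0 ≤ V c a := fun c a hc ha => by
    linarith [hVle c a hc ha z z z z hzT hzT, hzd c a]
  have hVanti : ∀ c a a', 0 < c → 0 < a → a ≤ a' → V c a' ≤ V c a := by
    intro c a a' hc ha haa
    refine csSup_le (hne c a') ?_
    rintro r ⟨y₁, y₂, ξ₁, ξ₂, h1, h2, rfl⟩
    refine le_trans ?_ (hVle c a hc ha y₁ y₂ ξ₁ ξ₂ h1 h2)
    rw [dbl_eq, dbl_eq]
    have := mul_le_mul_of_nonneg_right haa (gapT_nonneg y₁ y₂ ξ₁ ξ₂)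
    linarith
  set c : ℕ → ℝ := fun j => 2 ^ j * c₀ with hcdef
  have hcpos : ∀ j, 0 < c j := fun j => by positivity
  have hbb : ∀ j, BddBelow (V (c j) '' Ioi 0) := fun j => by
    refine ⟨0, ?_⟩
    rintro _ ⟨a, ha, rfl⟩
    exact hVpos _ _ (hcpos j) ha
  have hnn : ∀ j, (V (c j) '' Ioi 0).Nonempty := fun j => ⟨_, 1, mem_Ioi.2 one_pos, rfl⟩
  set S : ℕ → ℝ := fun j => sInf (V (c j) '' Ioi 0) with hS
  obtain ⟨j, hj⟩ : ∃ j, S j - S (j + 1) ≤ ε / 8 := by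
    by_contra! hcon
    have hind : ∀ j : ℕ, S j ≤ S 0 - j * (ε / 8) := by
      intro j
      induction j with
      | zero => simp
      | succ j ih => have := hcon j; push_cast; linarith
    obtain ⟨j, hj⟩ := exists_nat_gt (S 0 / (ε / 8))
    rw [div_lt_iff₀ (by positivity)] at hj
    have h1 : 0 ≤ S j := le_csInf (hnn j) (by
      rintro _ ⟨a, ha, rfl⟩
      exact hVpos _ _ (hcpos j) ha)
    linarith [hind j]
  have hc2 : c (j + 1) = 2 * c j := by simp only [hcdef]; ring
  refine ⟨c (j + 1), ?_, fun δ hδ => ?_⟩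
  · simp only [hcdef, ge_iff_le]
    exact le_mul_of_one_le_left hc₀.le (one_le_pow₀ (by norm_num))
  obtain ⟨_, ⟨a₀, ha₀, rfl⟩, ha₀S⟩ := exists_lt_of_csInf_lt (hnn j)
    (show sInf (V (c j) '' Ioi 0) < S j + ε / 8 by simp only [hS]; linarith)
  have ha₀' : 0 < a₀ := ha₀
  have hM0 : 0 ≤ M := (abs_nonneg _).trans (hM₁ 0 0)
  set a := a₀ + 6 * M / δ ^ 2 with ha
  have haa : a₀ ≤ a := by rw [ha]; exact le_add_of_nonneg_right (by positivity)
  have hapos : 0 < a := ha₀'.trans_le haa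
  set κ := min (ε / 8) θ with hκ
  have hκ0 : 0 < κ := lt_min (by positivity) hθ
  have hκ1 : κ ≤ ε / 8 := min_le_left _ _
  have hκ2 : κ ≤ θ := min_le_right _ _
  obtain ⟨J⟩ := exists_doublingJets hT (hcpos (j + 1)) hapos hβ hκ0 hM₁ hM₂ hu₁ hu₂ hzT
    (by linarith [hzd (c (j + 1)) a])
  refine ⟨a, κ, hκ0, by linarith, J, ?_, ?_, ?_⟩
  · have h1 : V (c (j + 1)) a ≤ dbl (c (j + 1)) a β u₁ u₂ J.z₁ J.z₂ J.ξ₁ J.ξ₂ + κ := by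
      refine csSup_le (hne _ _) ?_
      rintro r ⟨y₁, y₂, ξ₁, ξ₂, h1, h2, rfl⟩
      exact J.value _ _ _ _ h1 h2
    have h2 := hVle (c j) a (hcpos j) hapos J.z₁ J.z₂ J.ξ₁ J.ξ₂ J.mem₁ J.mem₂
    have h3 := hVanti (c j) a₀ a (hcpos j) ha₀' haa
    have h4 : S (j + 1) ≤ V (c (j + 1)) a := csInf_le (hbb _) ⟨a, hapos, rfl⟩
    rw [dbl_eq] at h1 h2
    simp only [hc2] at h1 h4 ⊢
    linarith
  · have h1 := J.value z z z z hzT hzT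
    have h2 := hzd (c (j + 1)) a
    rw [dbl_eq _ _ _ _ _ J.z₁] at h1
    have h3 := gapX_nonneg J.z₁ J.z₂ J.ξ₁ J.ξ₂
    have h3' := mul_nonneg (hcpos (j + 1)).le h3
    have h4 := (abs_le.1 (hM₁ J.z₁.1 J.z₁.2)).2
    have h5 := (abs_le.1 (hM₂ J.z₂.1 J.z₂.2)).2
    have h6 := mul_nonneg hβ.le (add_nonneg (logw_nonneg J.ξ₁.2) (logw_nonneg J.ξ₂.2))
    have h7 : a * gapT J.z₁ J.z₂ J.ξ₁ J.ξ₂ ≤ 2 * M := by linarith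
    have h8 : 6 * M / δ ^ 2 ≤ a := by rw [ha]; linarith
    have h9 : (J.z₁.1 - J.z₂.1) ^ 2 ≤ 3 * gapT J.z₁ J.z₂ J.ξ₁ J.ξ₂ := by
      simp only [gapT]
      nlinarith [sq_nonneg ((J.z₁.1 - J.ξ₁.1) - (J.ξ₁.1 - J.ξ₂.1)),
        sq_nonneg ((J.z₁.1 - J.ξ₁.1) + (J.z₂.1 - J.ξ₂.1)),
        sq_nonneg ((J.z₂.1 - J.ξ₂.1) + (J.ξ₁.1 - J.ξ₂.1))]
    have h10 : a * (J.z₁.1 - J.z₂.1) ^ 2 ≤ a * δ ^ 2 := by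
      have e1 := mul_le_mul_of_nonneg_left h9 hapos.le
      rw [div_le_iff₀ (by positivity)] at h8
      linarith
    have h11 := le_of_mul_le_mul_left h10 hapos
    exact abs_le_of_sq_le_sq h11 hδ.le
  · have h1 := J.value z z z z hzT hzT
    have h2 := hzd (c (j + 1)) a
    rw [dbl_eq _ _ _ _ _ J.z₁] at h1
    have h3 := mul_nonneg (hcpos (j + 1)).le (gapX_nonneg J.z₁ J.z₂ J.ξ₁ J.ξ₂)
    have h4 := mul_nonneg hapos.le (gapT_nonneg J.z₁ J.z₂ J.ξ₁ J.ξ₂)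
    linarith

lemma exists_initial_radius {T R θ : ℝ} (hθ : 0 < θ) {u₁ u₂ : ℝ → Vec d → ℝ}
    (hu₁ : UpperSemicontinuousOn (fun p : ℝ × Vec d => u₁ p.1 p.2) (Icc 0 T ×ˢ univ))
    (hu₂ : UpperSemicontinuousOn (fun p : ℝ × Vec d => u₂ p.1 p.2) (Icc 0 T ×ˢ univ))
    (h0 : ∀ x, u₁ 0 x + u₂ 0 x ≤ 0) :
    ∃ ρ > 0, ∀ t₁ ∈ Icc (0 : ℝ) T, ∀ t₂ ∈ Icc (0 : ℝ) T, ∀ x₁ x₂ : Vec d, ‖x₁‖ ≤ R → ‖x₂‖ ≤ R →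
      |t₁ - t₂| ≤ ρ → ‖x₁ - x₂‖ ≤ ρ → (t₁ = 0 ∨ t₂ = 0) → u₁ t₁ x₁ + u₂ t₂ x₂ < θ := by
  set D : Set (ℝ × Vec d) := Icc 0 T ×ˢ closedBall 0 R with hD
  have hDc : IsCompact D := isCompact_Icc.prod (isCompact_closedBall _ _)
  have hsub : D ⊆ Icc 0 T ×ˢ univ := prod_mono le_rfl (subset_univ _)
  set w : (ℝ × Vec d) × (ℝ × Vec d) → ℝ := fun z => u₁ z.1.1 z.1.2 + u₂ z.2.1 z.2.2 with hw
  have hwu : UpperSemicontinuousOn w (D ×ˢ D) := by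
    have e1 : UpperSemicontinuousOn (fun z : (ℝ × Vec d) × (ℝ × Vec d) => u₁ z.1.1 z.1.2)
        (D ×ˢ D) :=
      (hu₁.mono hsub).comp continuous_fst.continuousOn fun z hz => hz.1
    have e2 : UpperSemicontinuousOn (fun z : (ℝ × Vec d) × (ℝ × Vec d) => u₂ z.2.1 z.2.2)
        (D ×ˢ D) :=
      (hu₂.mono hsub).comp continuous_snd.continuousOn fun z hz => hz.2
    exact e1.add e2
  set K := (D ×ˢ D ∩ w ⁻¹' Ici θ) ∩ {z | z.1.1 = 0 ∨ z.2.1 = 0} with hK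
  have hKc : IsCompact K := by
    refine (hwu.isCompact_inter_preimage_Ici (hDc.prod hDc) θ).inter_right ?_
    exact (isClosed_eq (by fun_prop) continuous_const).union
      (isClosed_eq (by fun_prop) continuous_const)
  have key : ∀ ρ > 0, (∀ z ∈ K, ρ < dist z.1 z.2) → ∀ t₁ ∈ Icc (0 : ℝ) T, ∀ t₂ ∈ Icc (0 : ℝ) T,
      ∀ x₁ x₂ : Vec d, ‖x₁‖ ≤ R → ‖x₂‖ ≤ R →
      |t₁ - t₂| ≤ ρ → ‖x₁ - x₂‖ ≤ ρ → (t₁ = 0 ∨ t₂ = 0) → u₁ t₁ x₁ + u₂ t₂ x₂ < θ := by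
    intro ρ hρ hd t₁ ht₁ t₂ ht₂ x₁ x₂ hx₁ hx₂ ht hx h
    by_contra! hcon
    have := hd ((t₁, x₁), (t₂, x₂)) ⟨⟨⟨⟨ht₁, by simpa using hx₁⟩, ⟨ht₂, by simpa using hx₂⟩⟩,
      hcon⟩, h⟩
    rw [Prod.dist_eq, lt_max_iff, Real.dist_eq, dist_eq_norm] at this
    rcases this with h | h <;> simp only at h <;> linarith
  rcases K.eq_empty_or_nonempty with hE | hN
  · exact ⟨1, one_pos, key 1 one_pos (by simp [hE])⟩
  obtain ⟨z, hz, hmin⟩ := hKc.exists_isMinOn hN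
    (f := fun z : (ℝ × Vec d) × (ℝ × Vec d) => dist z.1 z.2) (by fun_prop)
  have hpos : 0 < dist z.1 z.2 := by
    rw [dist_pos]
    intro he
    have h1 : θ ≤ u₁ z.1.1 z.1.2 + u₂ z.2.1 z.2.2 := hz.1.2
    have h2 : z.2.1 = 0 := by
      rcases hz.2 with h | h
      · rw [← he]; exact h
      · exact h
    rw [he, h2] at h1
    linarith [h0 z.2.2]
  exact ⟨_, half_pos hpos, key _ (half_pos hpos) fun y hy =>
    (half_lt_self hpos).trans_le (hmin hy)⟩

section Coefficients

variable {ν : Measure (Vec n)} {A : Set (Vec m)} {T : ℝ}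
  {b : Vec m → Vec d → Vec d} {σ : Vec m → Vec d → Matrix (Fin d) (Fin d) ℝ}
  {η : Vec m → Vec d → Vec n → Vec d} {γ : Vec d → Vec n → ℝ}
  {f : Vec m → ℝ → Vec d → ℝ → Vec d → ℝ → ℝ}
  {ζ : ℝ → Vec d → ℝ} {g : Vec d → ℝ} {C : ℝ}

lemma AssumptionA.exists_growth (hA : AssumptionA ν A T b σ η γ f ζ g C) :
    ∃ S ≥ C, ∀ α ∈ A, ∀ x, ‖b α x‖ ≤ S * (1 + ‖x‖) ∧ ‖σ α x‖ ≤ S * (1 + ‖x‖) := by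
  obtain ⟨α₀, hα₀⟩ := hA.hAne
  obtain ⟨r, hr⟩ := hA.hAcpt.isBounded.subset_closedBall α₀
  have hC := hA.hC
  refine ⟨‖b α₀ 0‖ + ‖σ α₀ 0‖ + C * |r| + C, le_add_of_nonneg_left (by positivity), fun α hα x => ?_⟩
  have h := hA.hb α hα α₀ hα₀ x 0
  rw [sub_zero] at h
  have h1 : ‖α - α₀‖ ≤ |r| := by
    have := hr hα; rw [mem_closedBall, dist_eq_norm] at this; exact this.trans (le_abs_self r)
  have h2 := norm_sub_norm_le (b α x) (b α₀ 0)
  have h3 := norm_sub_norm_le (σ α x) (σ α₀ 0)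
  have h4 := norm_nonneg (b α x - b α₀ 0)
  have h5 := norm_nonneg (σ α x - σ α₀ 0)
  have h6 := norm_nonneg (b α₀ 0)
  have h7 := norm_nonneg (σ α₀ 0)
  have h8 : C * ‖α - α₀‖ ≤ C * |r| := by gcongr
  have h9 : 0 ≤ (‖b α₀ 0‖ + ‖σ α₀ 0‖ + C * |r|) * ‖x‖ := by positivity
  constructor <;> nlinarith

lemma AssumptionA.exists_obstacle_radius (hA : AssumptionA ν A T b σ η γ f ζ g C)
    (R : ℝ) {θ : ℝ} (hθ : 0 < θ) :
    ∃ ρ > 0, ∀ t₁ ∈ Icc (0 : ℝ) T, ∀ t₂ ∈ Icc (0 : ℝ) T, ∀ x₁ x₂ : Vec d, ‖x₁‖ ≤ R → ‖x₂‖ ≤ R →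
      |t₁ - t₂| ≤ ρ → ‖x₁ - x₂‖ ≤ ρ → |ζ t₁ x₁ - ζ t₂ x₂| < θ := by
  have hcont : Continuous fun p : ℝ × Vec d => ζ p.1 p.2 := by
    rw [continuous_iff_continuousAt]
    intro q
    rw [ContinuousAt, tendsto_iff_norm_sub_tendsto_zero]
    have hlim : Tendsto (fun p : ℝ × Vec d => C * ‖p.2 - q.2‖ + |ζ p.1 q.2 - ζ q.1 q.2|) (𝓝 q)
        (𝓝 0) := by
      have : Continuous (fun p : ℝ × Vec d => C * ‖p.2 - q.2‖ + |ζ p.1 q.2 - ζ q.1 q.2|) := by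
        have h1 := (hA.hζ_t_cont q.2).comp (continuous_fst (X := ℝ) (Y := Vec d))
        exact (by fun_prop : Continuous fun p : ℝ × Vec d => C * ‖p.2 - q.2‖).add
          (h1.sub continuous_const).abs
      have h := this.tendsto q
      simpa using h
    refine squeeze_zero (fun _ => norm_nonneg _) (fun p => ?_) hlim
    have h1 := hA.hζg_lip p.1 p.2 q.2
    have h2 := abs_nonneg (g p.2 - g q.2)
    have h3 := abs_sub_le (ζ p.1 p.2) (ζ p.1 q.2) (ζ q.1 q.2)
    rw [Real.norm_eq_abs]; linarith
  have hDc : IsCompact (Icc 0 T ×ˢ closedBall (0 : Vec d) R) :=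
    isCompact_Icc.prod (isCompact_closedBall _ _)
  obtain ⟨ρ, hρ, h⟩ := Metric.uniformContinuousOn_iff_le.1
    (hDc.uniformContinuousOn_of_continuous hcont.continuousOn) (θ / 2) (half_pos hθ)
  refine ⟨ρ, hρ, fun t₁ ht₁ t₂ ht₂ x₁ x₂ hx₁ hx₂ ht hx => ?_⟩
  have := h (t₁, x₁) ⟨ht₁, by simpa using hx₁⟩ (t₂, x₂) ⟨ht₂, by simpa using hx₂⟩
    (by rw [Prod.dist_eq, Real.dist_eq, dist_eq_norm]; exact max_le ht hx)
  rw [Real.dist_eq] at this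
  linarith

lemma AssumptionA.exists_time_modulus (hA : AssumptionA ν A T b σ η γ f ζ g C)
    {R : ℝ} (hR : 0 < R) {ε : ℝ} (hε : 0 < ε) :
    ∃ δ > 0, ∀ α ∈ A, ∀ t ∈ Icc (0 : ℝ) T, ∀ t' ∈ Icc (0 : ℝ) T, |t - t'| ≤ δ →
      ∀ (x : Vec d) (r : ℝ) (p : Vec d) (k : ℝ), ‖x‖ ≤ R → |r| ≤ R → ‖p‖ ≤ R → |k| ≤ R →
      |f α t x r p k - f α t' x r p k| ≤ ε := by
  obtain ⟨w, hw, hw0, -, hfw⟩ := hA.hf_x R hR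
  set D : Set (Vec m × ℝ × Vec d × ℝ × Vec d × ℝ) :=
    A ×ˢ Icc 0 T ×ˢ closedBall 0 R ×ˢ closedBall 0 R ×ˢ closedBall 0 R ×ˢ closedBall 0 R with hD
  have hDc : IsCompact D := hA.hAcpt.prod <| isCompact_Icc.prod <|
    (isCompact_closedBall _ _).prod <| (isCompact_closedBall _ _).prod <|
    (isCompact_closedBall _ _).prod (isCompact_closedBall _ _)
  have hcont : ContinuousOn (fun q : Vec m × ℝ × Vec d × ℝ × Vec d × ℝ =>
      f q.1 q.2.1 q.2.2.1 q.2.2.2.1 q.2.2.2.2.1 q.2.2.2.2.2) D := by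
    rintro ⟨α₀, t₀, x₀, r₀, p₀, k₀⟩ ⟨hα₀, ht₀, hx₀, hr₀, -, -⟩
    simp only [mem_closedBall, dist_zero_right, Real.norm_eq_abs] at hx₀ hr₀
    rw [ContinuousWithinAt, tendsto_iff_norm_sub_tendsto_zero]
    set B : Vec m × ℝ × Vec d × ℝ × Vec d × ℝ → ℝ := fun q =>
      C * (‖q.1 - α₀‖ + |q.2.2.2.1 - r₀| + ‖q.2.2.2.2.1 - p₀‖ + |q.2.2.2.2.2 - k₀|)
      + w (‖q.2.2.1 - x₀‖ * (1 + ‖p₀‖))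
      + |f α₀ q.2.1 x₀ r₀ p₀ k₀ - f α₀ t₀ x₀ r₀ p₀ k₀| with hB
    have hBc : Continuous B := by
      have h1 : Continuous fun q : Vec m × ℝ × Vec d × ℝ × Vec d × ℝ =>
        f α₀ q.2.1 x₀ r₀ p₀ k₀ := (hA.hf_t_cont α₀ x₀ r₀ p₀ k₀).comp (by fun_prop)
      simp only [hB, ← Real.norm_eq_abs]
      refine Continuous.add ?_ (h1.sub continuous_const).norm
      fun_prop
    have hlim : Tendsto B (𝓝[D] (α₀, t₀, x₀, r₀, p₀, k₀)) (𝓝 0) := by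
      have h := (hBc.tendsto (α₀, t₀, x₀, r₀, p₀, k₀)).mono_left (nhdsWithin_le_nhds (s := D))
      simpa [hB, hw0] using h
    refine squeeze_zero' (Eventually.of_forall fun _ => norm_nonneg _) ?_ hlim
    filter_upwards [self_mem_nhdsWithin]
    rintro ⟨α, t, x, r, p, k⟩ ⟨hα, ht, hx, hr, -, -⟩
    simp only [mem_closedBall, dist_zero_right, Real.norm_eq_abs] at hx hr
    have h1 := hA.hf_lip α hα α₀ hα₀ t ht x r r₀ p p₀ k k₀
    have h2 := hfw α₀ hα₀ t ht x x₀ r₀ p₀ k₀ hx hx₀ hr₀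
    simp only [hB, Real.norm_eq_abs]
    have h3 := abs_sub_le (f α t x r p k) (f α₀ t x r₀ p₀ k₀) (f α₀ t₀ x₀ r₀ p₀ k₀)
    have h4 := abs_sub_le (f α₀ t x r₀ p₀ k₀) (f α₀ t x₀ r₀ p₀ k₀) (f α₀ t₀ x₀ r₀ p₀ k₀)
    linarith
  obtain ⟨δ, hδ, h⟩ := Metric.uniformContinuousOn_iff_le.1
    (hDc.uniformContinuousOn_of_continuous hcont) ε hε
  refine ⟨δ, hδ, fun α hα t ht t' ht' htt x r p k hx hr hp hk => ?_⟩
  have := h (α, t, x, r, p, k) ⟨hα, ht, by simpa using hx, by simpa using hr, by simpa using hp,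
    by simpa using hk⟩ (α, t', x, r, p, k) ⟨hα, ht', by simpa using hx, by simpa using hr,
    by simpa using hp, by simpa using hk⟩
    (by simpa [Prod.dist_eq, Real.dist_eq, hδ.le] using htt)
  rwa [Real.dist_eq] at this

end Coefficients

namespace DoublingJets

variable {T c a β κ M : ℝ} {u₁ u₂ : ℝ → Vec d → ℝ}

/-- The size of the errors in the estimates for the operators applied to a pair of test
functions. -/
def err (J : DoublingJets T c a β κ M u₁ u₂) (R : ℝ) : ℝ :=
  c * gapX J.z₁ J.z₂ J.ξ₁ J.ξ₂ + β + κ * (2 + R) ^ 2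

/-- Pairs of increments of at most linear growth whose difference is Lipschitz. -/
structure Adm (J : DoublingJets T c a β κ M u₁ u₂) (H : ℝ) (h k : Vec d) : Prop where
  left : ‖h‖ ≤ H * (2 + ‖J.ξ₁.2‖)
  right : ‖k‖ ≤ H * (2 + ‖J.ξ₂.2‖)
  sub : ‖h - k‖ ≤ H * ‖J.z₁.2 - J.z₂.2‖

lemma Adm.smul {J : DoublingJets T c a β κ M u₁ u₂} {H : ℝ} {h k : Vec d}
    (hk : J.Adm H h k) (s : ℝ) : J.Adm (|s| * H) (s • h) (s • k) := by
  refine ⟨?_, ?_, ?_⟩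
  · rw [norm_smul, Real.norm_eq_abs, mul_assoc]; gcongr; exact hk.left
  · rw [norm_smul, Real.norm_eq_abs, mul_assoc]; gcongr; exact hk.right
  · rw [← smul_sub, norm_smul, Real.norm_eq_abs, mul_assoc]; gcongr; exact hk.sub

lemma norm_sub_le_gap (y₁ y₂ ξ₁ ξ₂ : ℝ × Vec d) :
    ‖y₁.2 - y₂.2‖ ^ 2 ≤ 3 * gapX y₁ y₂ ξ₁ ξ₂ ∧
      ‖y₁.2 - y₂.2‖ * ‖ξ₁.2 - ξ₂.2‖ ≤ 2 * gapX y₁ y₂ ξ₁ ξ₂ := by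
  have h : ‖y₁.2 - y₂.2‖ ≤ ‖y₁.2 - ξ₁.2‖ + ‖y₂.2 - ξ₂.2‖ + ‖ξ₁.2 - ξ₂.2‖ := by
    have e : y₁.2 - y₂.2 = (y₁.2 - ξ₁.2) - (y₂.2 - ξ₂.2) + (ξ₁.2 - ξ₂.2) := by abel
    rw [e]
    exact (norm_add_le _ _).trans (by gcongr; exact norm_sub_le _ _)
  unfold gapX
  have h0 := norm_nonneg (y₁.2 - y₂.2)
  set p := ‖y₁.2 - ξ₁.2‖
  set q := ‖y₂.2 - ξ₂.2‖
  set r := ‖ξ₁.2 - ξ₂.2‖ with hr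
  have hr0 : 0 ≤ r := norm_nonneg _
  constructor
  · refine (pow_le_pow_left₀ h0 h 2).trans ?_
    nlinarith [sq_nonneg (p - q), sq_nonneg (p - r), sq_nonneg (q - r)]
  · refine (mul_le_mul_of_nonneg_right h hr0).trans ?_
    nlinarith [sq_nonneg (p - r), sq_nonneg (q - r)]

lemma norm_div_one_add_sq_mul_le (ξ : Vec d) {H l : ℝ} (hl : l ≤ H * (2 + ‖ξ‖)) (hH : 0 ≤ H) :
    ‖ξ‖ / (1 + ‖ξ‖ ^ 2) * l ≤ 3 * H := by
  rw [div_mul_eq_mul_div, div_le_iff₀ (by positivity)]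
  refine (mul_le_mul_of_nonneg_left hl (norm_nonneg _)).trans ?_
  nlinarith [mul_nonneg hH (sq_nonneg (‖ξ‖ - 1)), mul_nonneg hH (sq_nonneg ‖ξ‖)]

lemma sq_div_one_add_sq_le (ξ : Vec d) {H l : ℝ} (hl : l ≤ H * (2 + ‖ξ‖)) (hl0 : 0 ≤ l) :
    l ^ 2 / (1 + ‖ξ‖ ^ 2) ≤ 5 * H ^ 2 := by
  rw [div_le_iff₀ (by positivity)]
  refine (pow_le_pow_left₀ hl0 hl 2).trans ?_
  nlinarith [mul_nonneg (sq_nonneg H) (sq_nonneg (2 * ‖ξ‖ - 1))]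

/-- The two-point bounds on the coordinates of the jets. -/
structure Local (J : DoublingJets T c a β κ M u₁ u₂) (R : ℝ) : Prop where
  c_pos : 0 < c
  β_pos : 0 < β
  κ_pos : 0 < κ
  left : ‖J.ξ₁.2‖ ≤ R
  right : ‖J.ξ₂.2‖ ≤ R
  close₁ : ‖J.z₁.2 - J.ξ₁.2‖ ≤ 1
  close₂ : ‖J.z₂.2 - J.ξ₂.2‖ ≤ 1

variable {J : DoublingJets T c a β κ M u₁ u₂} {R H : ℝ} {h k : Vec d}

lemma Local.gap_nonneg (hJ : J.Local R) : 0 ≤ c * gapX J.z₁ J.z₂ J.ξ₁ J.ξ₂ :=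
  mul_nonneg hJ.c_pos.le (gapX_nonneg _ _ _ _)

lemma Local.radius_nonneg (hJ : J.Local R) : 0 ≤ R := (norm_nonneg _).trans hJ.left

lemma Local.err_nonneg (hJ : J.Local R) : 0 ≤ J.err R := by
  have := hJ.gap_nonneg
  have := hJ.β_pos
  have := mul_nonneg hJ.κ_pos.le (sq_nonneg (2 + R))
  unfold err; linarith

lemma Local.norm_le₁ (hJ : J.Local R) : ‖J.z₁.2‖ ≤ 1 + ‖J.ξ₁.2‖ := by
  have := norm_add_le (J.z₁.2 - J.ξ₁.2) J.ξ₁.2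
  rw [sub_add_cancel] at this
  linarith [hJ.close₁]

lemma Local.norm_le₂ (hJ : J.Local R) : ‖J.z₂.2‖ ≤ 1 + ‖J.ξ₂.2‖ := by
  have := norm_add_le (J.z₂.2 - J.ξ₂.2) J.ξ₂.2
  rw [sub_add_cancel] at this
  linarith [hJ.close₂]

lemma Local.abs_inner_add_inner_le (hJ : J.Local R) (hH : 0 ≤ H) (hk : J.Adm H h k) :
    |⟪J.φ₁.grad J.z₁.1 J.z₁.2, h⟫ + ⟪J.φ₂.grad J.z₂.1 J.z₂.2, k⟫| ≤ 12 * H * J.err R := by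
  set g₁ := J.φ₁.grad J.z₁.1 J.z₁.2
  set g₂ := J.φ₂.grad J.z₂.1 J.z₂.2
  obtain ⟨e₁, he₁⟩ : ∃ e₁, e₁ = g₁ - ((2 * c) • (J.ξ₁.2 - J.ξ₂.2)
    + (2 * β / (1 + ‖J.ξ₁.2‖ ^ 2)) • J.ξ₁.2) := ⟨_, rfl⟩
  obtain ⟨e₂, he₂⟩ : ∃ e₂, e₂ = g₂ - (-((2 * c) • (J.ξ₁.2 - J.ξ₂.2))
    + (2 * β / (1 + ‖J.ξ₂.2‖ ^ 2)) • J.ξ₂.2) := ⟨_, rfl⟩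
  have n₁ : ‖e₁‖ ≤ κ := he₁ ▸ J.grad₁
  have n₂ : ‖e₂‖ ≤ κ := he₂ ▸ J.grad₂
  rw [eq_sub_iff_add_eq] at he₁ he₂
  have hid : ⟪g₁, h⟫ + ⟪g₂, k⟫ = ⟪e₁, h⟫ + ⟪e₂, k⟫ + 2 * c * ⟪J.ξ₁.2 - J.ξ₂.2, h - k⟫
      + 2 * β * (⟪J.ξ₁.2, h⟫ / (1 + ‖J.ξ₁.2‖ ^ 2))
      + 2 * β * (⟪J.ξ₂.2, k⟫ / (1 + ‖J.ξ₂.2‖ ^ 2)) := by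
    rw [← he₁, ← he₂]
    simp only [inner_add_left, inner_neg_left, real_inner_smul_left, inner_sub_right]
    ring
  have hR := hJ.radius_nonneg
  have hc := hJ.c_pos
  have hβ := hJ.β_pos
  have hκ := hJ.κ_pos
  have q₁ : |⟪e₁, h⟫| ≤ κ * (H * (2 + R) ^ 2) := by
    refine (abs_real_inner_le_norm _ _).trans ?_
    have : ‖h‖ ≤ H * (2 + R) ^ 2 := hk.left.trans (by
      gcongr; nlinarith [hJ.left])
    gcongr
  have q₂ : |⟪e₂, k⟫| ≤ κ * (H * (2 + R) ^ 2) := by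
    refine (abs_real_inner_le_norm _ _).trans ?_
    have : ‖k‖ ≤ H * (2 + R) ^ 2 := hk.right.trans (by
      gcongr; nlinarith [hJ.right])
    gcongr
  have q₃ : |2 * c * ⟪J.ξ₁.2 - J.ξ₂.2, h - k⟫| ≤
      2 * c * (H * (2 * gapX J.z₁ J.z₂ J.ξ₁ J.ξ₂)) := by
    rw [abs_mul, abs_of_nonneg (by positivity : 0 ≤ 2 * c)]
    gcongr
    refine (abs_real_inner_le_norm _ _).trans ?_
    refine (mul_le_mul_of_nonneg_left hk.sub (norm_nonneg _)).trans ?_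
    have := mul_le_mul_of_nonneg_left (norm_sub_le_gap J.z₁ J.z₂ J.ξ₁ J.ξ₂).2 hH
    linarith
  have aux : ∀ ξ l : Vec d, ‖l‖ ≤ H * (2 + ‖ξ‖) →
      |2 * β * (⟪ξ, l⟫ / (1 + ‖ξ‖ ^ 2))| ≤ 2 * β * (3 * H) := by
    intro ξ l hl
    rw [abs_mul, abs_of_nonneg (by positivity : 0 ≤ 2 * β), abs_div,
      abs_of_nonneg (by positivity : 0 ≤ 1 + ‖ξ‖ ^ 2)]
    gcongr
    refine le_trans ?_ (norm_div_one_add_sq_mul_le ξ hl hH)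
    rw [div_mul_eq_mul_div]
    gcongr
    exact abs_real_inner_le_norm _ _
  have q₄ := aux _ _ hk.left
  have q₅ := aux _ _ hk.right
  rw [hid]
  refine (abs_add_le _ _).trans ((add_le_add (abs_add_le _ _) le_rfl).trans ?_)
  refine (add_le_add (add_le_add (abs_add_le _ _) le_rfl) le_rfl).trans ?_
  refine (add_le_add (add_le_add (add_le_add (abs_add_le _ _) le_rfl) le_rfl) le_rfl).trans ?_
  have w₁ := mul_nonneg hH hJ.gap_nonneg
  have w₂ := mul_nonneg hH (mul_nonneg hκ.le (sq_nonneg (2 + R)))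
  unfold err
  nlinarith

lemma Local.increment_le (hJ : J.Local R) (hk : J.Adm H h k) :
    (J.φ₁.toFun J.z₁.1 (J.z₁.2 + h) - J.φ₁.toFun J.z₁.1 J.z₁.2)
      + (J.φ₂.toFun J.z₂.1 (J.z₂.2 + k) - J.φ₂.toFun J.z₂.1 J.z₂.2)
      ≤ (⟪J.φ₁.grad J.z₁.1 J.z₁.2, h⟫ + ⟪J.φ₂.grad J.z₂.1 J.z₂.2, k⟫) + 12 * H ^ 2 * J.err R := by
  have hu := J.upper h k
  have hR := hJ.radius_nonneg
  have hc := hJ.c_pos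
  have hβ := hJ.β_pos
  have hκ := hJ.κ_pos
  have q₁ : c * ‖h - k‖ ^ 2 ≤ c * (H ^ 2 * (3 * gapX J.z₁ J.z₂ J.ξ₁ J.ξ₂)) := by
    gcongr
    refine (pow_le_pow_left₀ (norm_nonneg _) hk.sub 2).trans ?_
    rw [mul_pow]; gcongr; exact (norm_sub_le_gap _ _ _ _).1
  have q₂ := mul_le_mul_of_nonneg_left
    (sq_div_one_add_sq_le J.ξ₁.2 hk.left (norm_nonneg _)) hβ.le
  have q₃ := mul_le_mul_of_nonneg_left
    (sq_div_one_add_sq_le J.ξ₂.2 hk.right (norm_nonneg _)) hβ.le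
  have q₄ : ‖h‖ ^ 2 ≤ H ^ 2 * (2 + R) ^ 2 := by
    refine (pow_le_pow_left₀ (norm_nonneg _) hk.left 2).trans ?_
    rw [mul_pow]; gcongr; exact hJ.left
  have q₅ : ‖k‖ ^ 2 ≤ H ^ 2 * (2 + R) ^ 2 := by
    refine (pow_le_pow_left₀ (norm_nonneg _) hk.right 2).trans ?_
    rw [mul_pow]; gcongr; exact hJ.right
  have q₆ := mul_le_mul_of_nonneg_left (add_le_add q₄ q₅) hκ.le
  have w₁ := mul_nonneg (sq_nonneg H) hJ.gap_nonneg
  have w₂ := mul_nonneg (sq_nonneg H) (mul_nonneg hκ.le (sq_nonneg (2 + R)))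
  have w₃ := mul_nonneg (sq_nonneg H) hβ.le
  unfold err
  nlinarith

lemma Local.hess_add_hess_le (hJ : J.Local R) (hk : J.Adm H h k) :
    ⟪Matrix.toEuclideanLin (J.φ₁.hess J.z₁.1 J.z₁.2) h, h⟫
      + ⟪Matrix.toEuclideanLin (J.φ₂.hess J.z₂.1 J.z₂.2) k, k⟫ ≤ 24 * H ^ 2 * J.err R := by
  refine (C12.hess_add_hess_le J.φ₁ J.φ₂ J.z₁.1 J.z₂.1 J.z₁.2 J.z₂.2 h k
    (⟪J.φ₁.grad J.z₁.1 J.z₁.2, h⟫ + ⟪J.φ₂.grad J.z₂.1 J.z₂.2, k⟫)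
    (12 * H ^ 2 * J.err R) fun s => ?_).trans_eq (by ring)
  have := hJ.increment_le (hk.smul s)
  rw [real_inner_smul_right, real_inner_smul_right, mul_pow, sq_abs] at this
  linarith

lemma Local.abs_increment_sub_inner_le₁ (hJ : J.Local R) (h : Vec d) :
    |J.φ₁.toFun J.z₁.1 (J.z₁.2 + h) - J.φ₁.toFun J.z₁.1 J.z₁.2 - ⟪h, J.φ₁.grad J.z₁.1 J.z₁.2⟫|
      ≤ (c + β + κ) * ‖h‖ ^ 2 := by
  have h1 := J.upper h 0
  have h2 := J.lower₁ h
  have h3 := mul_le_mul_of_nonneg_left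
    (div_one_add_sq_le J.ξ₁.2 (‖h‖ ^ 2) (by positivity)) hJ.β_pos.le
  have h4 := mul_nonneg hJ.κ_pos.le (sq_nonneg ‖h‖)
  have h5 := mul_nonneg hJ.β_pos.le (sq_nonneg ‖h‖)
  rw [real_inner_comm]
  simp only [add_zero, sub_zero, inner_zero_right, norm_zero] at h1
  rw [abs_le]
  constructor
  · linarith
  · norm_num at h1; linarith

lemma Local.abs_increment_sub_inner_le₂ (hJ : J.Local R) (h : Vec d) :
    |J.φ₂.toFun J.z₂.1 (J.z₂.2 + h) - J.φ₂.toFun J.z₂.1 J.z₂.2 - ⟪h, J.φ₂.grad J.z₂.1 J.z₂.2⟫|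
      ≤ (c + β + κ) * ‖h‖ ^ 2 := by
  have h1 := J.upper 0 h
  have h2 := J.lower₂ h
  have h3 := mul_le_mul_of_nonneg_left
    (div_one_add_sq_le J.ξ₂.2 (‖h‖ ^ 2) (by positivity)) hJ.β_pos.le
  have h4 := mul_nonneg hJ.κ_pos.le (sq_nonneg ‖h‖)
  have h5 := mul_nonneg hJ.β_pos.le (sq_nonneg ‖h‖)
  rw [real_inner_comm]
  simp only [add_zero, zero_sub, inner_zero_right, norm_zero, norm_neg] at h1
  rw [abs_le]
  constructor
  · linarith
  · norm_num at h1; linarith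

lemma Local.norm_grad_le_dist₂ (hJ : J.Local R) :
    ‖J.φ₂.grad J.z₂.1 J.z₂.2‖ ≤ 2 * c * ‖J.ξ₁.2 - J.ξ₂.2‖ + 2 * β + κ := by
  have h := J.grad₂
  have hc := hJ.c_pos
  have hβ := hJ.β_pos
  have h1 : ‖(-((2 * c) • (J.ξ₁.2 - J.ξ₂.2)) + (2 * β / (1 + ‖J.ξ₂.2‖ ^ 2)) • J.ξ₂.2)‖
      ≤ 2 * c * ‖J.ξ₁.2 - J.ξ₂.2‖ + 2 * β := by
    refine (norm_add_le _ _).trans (add_le_add ?_ ?_)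
    · rw [norm_neg, norm_smul, Real.norm_eq_abs, abs_of_pos (by positivity)]
    · rw [norm_smul, Real.norm_eq_abs, abs_of_pos (by positivity), div_mul_eq_mul_div,
        div_le_iff₀ (by positivity)]
      have := sq_nonneg (‖J.ξ₂.2‖ - 1)
      gcongr
      nlinarith [sq_nonneg ‖J.ξ₂.2‖]
  have := norm_le_norm_add_norm_sub' (J.φ₂.grad J.z₂.1 J.z₂.2)
    (-((2 * c) • (J.ξ₁.2 - J.ξ₂.2)) + (2 * β / (1 + ‖J.ξ₂.2‖ ^ 2)) • J.ξ₂.2)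
  linarith

lemma Local.norm_grad_le₂ (hJ : J.Local R) :
    ‖J.φ₂.grad J.z₂.1 J.z₂.2‖ ≤ 4 * c * R + 2 * β + κ := by
  have h1 : ‖J.ξ₁.2 - J.ξ₂.2‖ ≤ 2 * R := by
    linarith [norm_sub_le J.ξ₁.2 J.ξ₂.2, hJ.left, hJ.right]
  have h2 := mul_le_mul_of_nonneg_left h1 (mul_nonneg zero_le_two hJ.c_pos.le)
  linarith [hJ.norm_grad_le_dist₂]

end DoublingJets

lemma min_one_norm_sq (e : Vec n) : min 1 ‖e‖ ^ 2 = min 1 (‖e‖ ^ 2) := by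
  rcases le_total 1 ‖e‖ with h | h
  · rw [min_eq_left h, min_eq_left (one_le_pow₀ h), one_pow]
  · rw [min_eq_right h, min_eq_right (pow_le_one₀ (norm_nonneg _) h)]

section Operators

variable {ν : Measure (Vec n)} {A : Set (Vec m)} {T : ℝ}
  {b : Vec m → Vec d → Vec d} {σ : Vec m → Vec d → Matrix (Fin d) (Fin d) ℝ}
  {η : Vec m → Vec d → Vec n → Vec d} {γ : Vec d → Vec n → ℝ}
  {f : Vec m → ℝ → Vec d → ℝ → Vec d → ℝ → ℝ}
  {ζ : ℝ → Vec d → ℝ} {g : Vec d → ℝ} {C : ℝ}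

lemma Lop_neg (φ : C12 d) (α : Vec m) (t : ℝ) (x : Vec d) :
    Lop ν b σ η φ.neg α t x = -Lop ν b σ η φ α t x := by
  simp only [Lop, Aop, Kop, C12.neg]
  have h : ∀ e, -φ.toFun t (x + η α x e) - -φ.toFun t x - ⟪η α x e, -φ.grad t x⟫ =
      -(φ.toFun t (x + η α x e) - φ.toFun t x - ⟪η α x e, φ.grad t x⟫) := fun e => by
    rw [inner_neg_right]; ring
  simp only [h]
  rw [integral_neg, inner_neg_right, Matrix.mul_neg, Matrix.trace_neg]
  ring

lemma Bop_neg (φ : C12 d) (α : Vec m) (t : ℝ) (x : Vec d) :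
    Bop ν η γ φ.neg α t x = -Bop ν η γ φ α t x := by
  simp only [Bop, C12.neg]
  rw [← integral_neg]
  congr 1; ext e; ring

/-- The mass of the truncated square. -/
def levyMass (ν : Measure (Vec n)) : ℝ := ∫ e, min 1 (‖e‖ ^ 2) ∂ν

lemma levyMass_nonneg (ν : Measure (Vec n)) : 0 ≤ levyMass ν :=
  integral_nonneg fun e => by positivity

namespace AssumptionA

lemma integrable_Kop (hA : AssumptionA ν A T b σ η γ f ζ g C) {φ : C12 d} {α : Vec m} (hα : α ∈ A)
    {t : ℝ} {x : Vec d} {Q : ℝ} (hQ : 0 ≤ Q)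
    (hφ : ∀ h, |φ.toFun t (x + h) - φ.toFun t x - ⟪h, φ.grad t x⟫| ≤ Q * ‖h‖ ^ 2) :
    Integrable (fun e => φ.toFun t (x + η α x e) - φ.toFun t x - ⟪η α x e, φ.grad t x⟫) ν ∧
      |Kop ν η φ α t x| ≤ Q * C ^ 2 * levyMass ν := by
  have hm : Measurable fun e => φ.toFun t (x + η α x e) - φ.toFun t x - ⟪η α x e, φ.grad t x⟫ := by
    have h1 := hA.hη_meas α x
    refine ((φ.cont.measurable.comp (measurable_const.prodMk
      (measurable_const.add h1))).sub measurable_const).sub ?_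
    exact h1.inner measurable_const
  have hb : ∀ e, ‖φ.toFun t (x + η α x e) - φ.toFun t x - ⟪η α x e, φ.grad t x⟫‖ ≤
      Q * C ^ 2 * min 1 (‖e‖ ^ 2) := fun e => by
    rw [Real.norm_eq_abs, mul_assoc, ← min_one_norm_sq, ← mul_pow]
    refine (hφ _).trans ?_
    gcongr
    exact hA.hη_bdd α hα x e
  have hi := hA.hν_int.const_mul (Q * C ^ 2)
  refine ⟨hi.mono' hm.aestronglyMeasurable (Eventually.of_forall hb), ?_⟩
  rw [← Real.norm_eq_abs, levyMass, ← integral_const_mul]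
  exact norm_integral_le_of_norm_le hi (Eventually.of_forall hb)

lemma integrable_increment_mul (hA : AssumptionA ν A T b σ η γ f ζ g C) {φ : C12 d} {α : Vec m}
    (hα : α ∈ A) {t : ℝ} {x : Vec d} {Q : ℝ} (hQ : 0 ≤ Q)
    (hφ : ∀ h, |φ.toFun t (x + h) - φ.toFun t x - ⟪h, φ.grad t x⟫| ≤ Q * ‖h‖ ^ 2) (y : Vec d) :
    Integrable (fun e => (φ.toFun t (x + η α x e) - φ.toFun t x) * γ y e) ν ∧
      |∫ e, (φ.toFun t (x + η α x e) - φ.toFun t x) * γ y e ∂ν| ≤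
        (‖φ.grad t x‖ * C + Q * C ^ 2) * C * levyMass ν := by
  have hC := hA.hC
  have hm : Measurable fun e => (φ.toFun t (x + η α x e) - φ.toFun t x) * γ y e := by
    have h1 := hA.hη_meas α x
    exact ((φ.cont.measurable.comp (measurable_const.prodMk
      (measurable_const.add h1))).sub measurable_const).mul (hA.hγ_meas y)
  have hb : ∀ e, ‖(φ.toFun t (x + η α x e) - φ.toFun t x) * γ y e‖ ≤
      (‖φ.grad t x‖ * C + Q * C ^ 2) * C * min 1 (‖e‖ ^ 2) := fun e => by
    rw [Real.norm_eq_abs, abs_mul, ← min_one_norm_sq, abs_of_nonneg (hA.hγ_nonneg y e)]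
    have m0 : 0 ≤ min 1 ‖e‖ := by positivity
    have m1 : min 1 ‖e‖ ≤ 1 := min_le_left _ _
    have h1 := hφ (η α x e)
    have h2 := hA.hη_bdd α hα x e
    have h3 : |⟪η α x e, φ.grad t x⟫| ≤ ‖φ.grad t x‖ * (C * min 1 ‖e‖) := by
      refine (abs_real_inner_le_norm _ _).trans ?_
      rw [mul_comm]; gcongr
    have h4 : Q * ‖η α x e‖ ^ 2 ≤ Q * (C ^ 2 * min 1 ‖e‖) := by
      gcongr
      refine (pow_le_pow_left₀ (norm_nonneg _) h2 2).trans ?_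
      rw [mul_pow]; gcongr; nlinarith
    have h5 : |φ.toFun t (x + η α x e) - φ.toFun t x| ≤
        (‖φ.grad t x‖ * C + Q * C ^ 2) * min 1 ‖e‖ := by
      have := abs_sub_abs_le_abs_sub (φ.toFun t (x + η α x e) - φ.toFun t x)
        ⟪η α x e, φ.grad t x⟫
      linarith
    calc _ ≤ ((‖φ.grad t x‖ * C + Q * C ^ 2) * min 1 ‖e‖) * (C * min 1 ‖e‖) :=
          mul_le_mul h5 (hA.hγ_bdd y e) (hA.hγ_nonneg y e) (by positivity)
      _ = _ := by ring
  have hi := hA.hν_int.const_mul ((‖φ.grad t x‖ * C + Q * C ^ 2) * C)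
  refine ⟨hi.mono' hm.aestronglyMeasurable (Eventually.of_forall hb), ?_⟩
  rw [← Real.norm_eq_abs, levyMass, ← integral_const_mul]
  exact norm_integral_le_of_norm_le hi (Eventually.of_forall hb)

variable {T' c a β κ M : ℝ} {u₁ u₂ : ℝ → Vec d → ℝ} {J : DoublingJets T' c a β κ M u₁ u₂}
  {R S : ℝ} {α : Vec m}

lemma adm_drift (hA : AssumptionA ν A T b σ η γ f ζ g C) (hJ : J.Local R) (hα : α ∈ A)
    (hCS : C ≤ S) (hS : ∀ α ∈ A, ∀ x, ‖b α x‖ ≤ S * (1 + ‖x‖) ∧ ‖σ α x‖ ≤ S * (1 + ‖x‖)) :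
    J.Adm S (b α J.z₁.2) (b α J.z₂.2) := by
  have hS0 : 0 ≤ S := hA.hC.le.trans hCS
  refine ⟨(hS α hα _).1.trans ?_, (hS α hα _).1.trans ?_, ?_⟩
  · exact mul_le_mul_of_nonneg_left (by linarith [hJ.norm_le₁]) hS0
  · exact mul_le_mul_of_nonneg_left (by linarith [hJ.norm_le₂]) hS0
  · have := hA.hb α hα α hα J.z₁.2 J.z₂.2
    rw [sub_self, norm_zero, add_zero] at this
    have h2 := norm_nonneg (σ α J.z₁.2 - σ α J.z₂.2)
    exact (by linarith : _ ≤ C * ‖J.z₁.2 - J.z₂.2‖).trans (by gcongr)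

lemma adm_diffusion (hA : AssumptionA ν A T b σ η γ f ζ g C) (hJ : J.Local R) (hα : α ∈ A)
    (hCS : C ≤ S) (hS : ∀ α ∈ A, ∀ x, ‖b α x‖ ≤ S * (1 + ‖x‖) ∧ ‖σ α x‖ ≤ S * (1 + ‖x‖))
    (i : Fin d) : J.Adm (d * S) (colE (σ α J.z₁.2) i) (colE (σ α J.z₂.2) i) := by
  have hS0 : 0 ≤ S := hA.hC.le.trans hCS
  refine ⟨?_, ?_, ?_⟩
  · refine (norm_colE_le _ i).trans ?_
    rw [mul_assoc]; gcongr
    refine (hS α hα _).2.trans ?_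
    exact mul_le_mul_of_nonneg_left (by linarith [hJ.norm_le₁]) hS0
  · refine (norm_colE_le _ i).trans ?_
    rw [mul_assoc]; gcongr
    refine (hS α hα _).2.trans ?_
    exact mul_le_mul_of_nonneg_left (by linarith [hJ.norm_le₂]) hS0
  · rw [← colE_sub]
    refine (norm_colE_le _ i).trans ?_
    rw [mul_assoc]; gcongr
    have := hA.hb α hα α hα J.z₁.2 J.z₂.2
    rw [sub_self, norm_zero, add_zero] at this
    have h2 := norm_nonneg (b α J.z₁.2 - b α J.z₂.2)
    exact (by linarith : _ ≤ C * ‖J.z₁.2 - J.z₂.2‖).trans (by gcongr)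

lemma adm_jump (hA : AssumptionA ν A T b σ η γ f ζ g C) (hα : α ∈ A) (e : Vec n) :
    J.Adm (C * min 1 ‖e‖) (η α J.z₁.2 e) (η α J.z₂.2 e) := by
  have hC := hA.hC
  have h0 : 0 ≤ C * min 1 ‖e‖ := by positivity
  refine ⟨(hA.hη_bdd α hα _ e).trans ?_, (hA.hη_bdd α hα _ e).trans ?_, ?_⟩
  · exact le_mul_of_one_le_right h0 (by linarith [norm_nonneg J.ξ₁.2])
  · exact le_mul_of_one_le_right h0 (by linarith [norm_nonneg J.ξ₂.2])
  · have := hA.hη_lip α hα α hα J.z₁.2 J.z₂.2 e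
    rw [sub_self, norm_zero, add_zero] at this
    linarith

lemma Aop_add_le (hA : AssumptionA ν A T b σ η γ f ζ g C) (hJ : J.Local R) (hα : α ∈ A)
    (hCS : C ≤ S) (hS : ∀ α ∈ A, ∀ x, ‖b α x‖ ≤ S * (1 + ‖x‖) ∧ ‖σ α x‖ ≤ S * (1 + ‖x‖)) :
    Aop b σ J.φ₁ α J.z₁.1 J.z₁.2 + Aop b σ J.φ₂ α J.z₂.1 J.z₂.2 ≤
      (12 * d * (d * S) ^ 2 + 12 * S) * J.err R := by
  have hS0 : 0 ≤ S := hA.hC.le.trans hCS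
  have h1 := le_of_abs_le (hJ.abs_inner_add_inner_le hS0 (hA.adm_drift hJ hα hCS hS))
  have h2 : Matrix.trace (σ α J.z₁.2 * (σ α J.z₁.2)ᵀ * J.φ₁.hess J.z₁.1 J.z₁.2)
      + Matrix.trace (σ α J.z₂.2 * (σ α J.z₂.2)ᵀ * J.φ₂.hess J.z₂.1 J.z₂.2)
      ≤ d * (24 * (d * S) ^ 2 * J.err R) := by
    rw [trace_mul_transpose_mul, trace_mul_transpose_mul, ← Finset.sum_add_distrib]
    refine (Finset.sum_le_sum fun i _ =>
      hJ.hess_add_hess_le (hA.adm_diffusion hJ hα hCS hS i)).trans_eq ?_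
    simp
  rw [real_inner_comm, real_inner_comm (b α J.z₂.2)] at h1
  simp only [Aop]
  linarith

lemma Kop_add_le (hA : AssumptionA ν A T b σ η γ f ζ g C) (hJ : J.Local R) (hα : α ∈ A) :
    Kop ν η J.φ₁ α J.z₁.1 J.z₁.2 + Kop ν η J.φ₂ α J.z₂.1 J.z₂.2 ≤
      12 * C ^ 2 * levyMass ν * J.err R := by
  have hQ : 0 ≤ c + β + κ := by linarith [hJ.c_pos, hJ.β_pos, hJ.κ_pos]
  have i₁ := (hA.integrable_Kop hα hQ hJ.abs_increment_sub_inner_le₁).1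
  have i₂ := (hA.integrable_Kop hα hQ hJ.abs_increment_sub_inner_le₂).1
  rw [Kop, Kop, ← integral_add i₁ i₂]
  refine (integral_mono (i₁.add i₂) (hA.hν_int.const_mul (12 * C ^ 2 * J.err R))
    fun e => ?_).trans_eq ?_
  · have h := hJ.increment_le (hA.adm_jump hα e)
    rw [real_inner_comm, real_inner_comm (η α J.z₂.2 e), mul_pow, min_one_norm_sq] at h
    simp only [Pi.add_apply]
    linarith
  · rw [integral_const_mul, levyMass]; ring

lemma Bop_add_le (hA : AssumptionA ν A T b σ η γ f ζ g C) (hJ : J.Local R) (hα : α ∈ A) :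
    Bop ν η γ J.φ₁ α J.z₁.1 J.z₁.2 + Bop ν η γ J.φ₂ α J.z₂.1 J.z₂.2 ≤
      (12 * (C + C ^ 2) * C * J.err R + (4 * M + κ * C ^ 2) * (C * ‖J.z₁.2 - J.z₂.2‖))
        * levyMass ν := by
  have hC := hA.hC
  have hQ : 0 ≤ c + β + κ := by linarith [hJ.c_pos, hJ.β_pos, hJ.κ_pos]
  have i₁ := (hA.integrable_increment_mul hα hQ hJ.abs_increment_sub_inner_le₁ J.z₁.2).1
  have i₂ := (hA.integrable_increment_mul hα hQ hJ.abs_increment_sub_inner_le₂ J.z₂.2).1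
  rw [Bop, Bop, ← integral_add i₁ i₂]
  refine (integral_mono (i₁.add i₂) (hA.hν_int.const_mul _) fun e => ?_).trans_eq
    (by rw [integral_const_mul, levyMass])
  have m0 : 0 ≤ min 1 ‖e‖ := by positivity
  have m1 : min 1 ‖e‖ ≤ 1 := min_le_left _ _
  have hadm := hA.adm_jump (J := J) hα e
  have h1 := hJ.increment_le hadm
  have h2 := le_of_abs_le (hJ.abs_inner_add_inner_le (by positivity) hadm)
  have hE := hJ.err_nonneg
  have h3 : 12 * (C * min 1 ‖e‖) ^ 2 * J.err R ≤ 12 * (C ^ 2 * min 1 ‖e‖) * J.err R := by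
    rw [mul_pow]; gcongr; nlinarith
  have h4 := mul_le_mul_of_nonneg_right (h1.trans (add_le_add h2 h3)) (hA.hγ_nonneg J.z₁.2 e)
  have h5 := mul_le_mul_of_nonneg_left (hA.hγ_bdd J.z₁.2 e)
    (by positivity : 0 ≤ 12 * (C * min 1 ‖e‖) * J.err R + 12 * (C ^ 2 * min 1 ‖e‖) * J.err R)
  have h6 := J.osc₂ (η α J.z₂.2 e)
  have h7 : ‖η α J.z₂.2 e‖ ^ 2 ≤ C ^ 2 := by
    refine pow_le_pow_left₀ (norm_nonneg _) ((hA.hη_bdd α hα _ e).trans ?_) 2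
    exact mul_le_of_le_one_right hC.le m1
  have h8 := mul_le_mul_of_nonneg_left h7 hJ.κ_pos.le
  have h9 := hA.hγ_lip J.z₂.2 J.z₁.2 e
  have h10 : (J.φ₂.toFun J.z₂.1 (J.z₂.2 + η α J.z₂.2 e) - J.φ₂.toFun J.z₂.1 J.z₂.2)
      * (γ J.z₂.2 e - γ J.z₁.2 e) ≤
      (4 * M + κ * C ^ 2) * (C * ‖J.z₂.2 - J.z₁.2‖ * min 1 (‖e‖ ^ 2)) := by
    refine (le_abs_self _).trans ?_
    rw [abs_mul]
    exact mul_le_mul (by linarith) h9 (abs_nonneg _) (by linarith [(abs_nonneg _).trans h6])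
  rw [norm_sub_rev] at h10
  simp only [Pi.add_apply]
  rw [← min_one_norm_sq] at h10 ⊢
  linarith

lemma norm_mvE_add_le (hA : AssumptionA ν A T b σ η γ f ζ g C) (hJ : J.Local R) (hα : α ∈ A)
    (hCS : C ≤ S) (hS : ∀ α ∈ A, ∀ x, ‖b α x‖ ≤ S * (1 + ‖x‖) ∧ ‖σ α x‖ ≤ S * (1 + ‖x‖)) :
    ‖mvE (σ α J.z₁.2)ᵀ (J.φ₁.grad J.z₁.1 J.z₁.2) + mvE (σ α J.z₂.2)ᵀ (J.φ₂.grad J.z₂.1 J.z₂.2)‖ ≤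
      d * (12 * (d * S) * J.err R) := by
  have hS0 : 0 ≤ S := hA.hC.le.trans hCS
  refine (norm_le_sum_abs _).trans ?_
  refine (Finset.sum_le_sum fun i _ => ?_).trans_eq
    (by simp : ∑ _i : Fin d, 12 * (d * S) * J.err R = _)
  rw [PiLp.add_apply, mvE_transpose_apply, mvE_transpose_apply]
  exact hJ.abs_inner_add_inner_le (by positivity) (hA.adm_diffusion hJ hα hCS hS i)

lemma abs_Bop_le (hA : AssumptionA ν A T b σ η γ f ζ g C) (hJ : J.Local R) (hα : α ∈ A) :
    |Bop ν η γ J.φ₂ α J.z₂.1 J.z₂.2| ≤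
      ((4 * c * R + 2 * β + κ) * C + (c + β + κ) * C ^ 2) * C * levyMass ν := by
  have hC := hA.hC
  have hQ : 0 ≤ c + β + κ := by linarith [hJ.c_pos, hJ.β_pos, hJ.κ_pos]
  refine (hA.integrable_increment_mul hα hQ hJ.abs_increment_sub_inner_le₂ J.z₂.2).2.trans ?_
  have := levyMass_nonneg ν
  gcongr
  exact hJ.norm_grad_le₂

lemma norm_mvE_le (hA : AssumptionA ν A T b σ η γ f ζ g C) (hJ : J.Local R) (hα : α ∈ A)
    (hCS : C ≤ S) (hS : ∀ α ∈ A, ∀ x, ‖b α x‖ ≤ S * (1 + ‖x‖) ∧ ‖σ α x‖ ≤ S * (1 + ‖x‖)) :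
    ‖mvE (σ α J.z₂.2)ᵀ (J.φ₂.grad J.z₂.1 J.z₂.2)‖ ≤
      d * (d * (S * (2 + R)) * (4 * c * R + 2 * β + κ)) := by
  have hS0 : 0 ≤ S := hA.hC.le.trans hCS
  have hR := hJ.radius_nonneg
  refine (norm_mvE_transpose_le _ _).trans ?_
  have h1 : ‖σ α J.z₂.2‖ ≤ S * (2 + R) :=
    (hS α hα _).2.trans <| mul_le_mul_of_nonneg_left (by linarith [hJ.norm_le₂, hJ.right]) hS0
  gcongr
  exact hJ.norm_grad_le₂

lemma bddBelow_hamiltonian (hA : AssumptionA ν A T b σ η γ f ζ g C) {t : ℝ} (ht : t ∈ Icc (0 : ℝ) T)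
    (x : Vec d) (φ : C12 d) (r Q : ℝ) (hQ : 0 ≤ Q)
    (hφ : ∀ h, |φ.toFun t (x + h) - φ.toFun t x - ⟪h, φ.grad t x⟫| ≤ Q * ‖h‖ ^ 2) :
    BddBelow (range fun α : A => -(Lop ν b σ η φ α t x)
      - f α t x r (mvE (σ α x)ᵀ (φ.grad t x)) (Bop ν η γ φ α t x)) := by
  have hC := hA.hC
  obtain ⟨S, hCS, hS⟩ := hA.exists_growth
  have hS0 : 0 ≤ S := hC.le.trans hCS
  have hσ : ContinuousOn (fun α => σ α x) A := by
    refine (LipschitzOnWith.of_dist_le_mul (K := ⟨C, hC.le⟩) fun α hα α' hα' => ?_).continuousOn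
    have := hA.hb α hα α' hα' x x
    rw [sub_self, norm_zero, zero_add] at this
    rw [dist_eq_norm, dist_eq_norm]
    have h2 := norm_nonneg (b α x - b α' x)
    show _ ≤ C * _
    linarith
  have htr : ContinuousOn (fun α => Matrix.trace (σ α x * (σ α x)ᵀ * φ.hess t x)) A := by
    have : Continuous fun N : Matrix (Fin d) (Fin d) ℝ => Matrix.trace (N * Nᵀ * φ.hess t x) := by
      fun_prop
    exact this.comp_continuousOn hσ
  obtain ⟨B₁, hB₁⟩ := hA.hAcpt.exists_bound_of_continuousOn htr
  set P := d * (d * (S * (1 + ‖x‖)) * ‖φ.grad t x‖)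
  set K := (‖φ.grad t x‖ * C + Q * C ^ 2) * C * levyMass ν
  refine ⟨-((1 / 2) * B₁ + S * (1 + ‖x‖) * ‖φ.grad t x‖ + Q * C ^ 2 * levyMass ν
    + (C + C * (|r| + P + K))), ?_⟩
  rintro _ ⟨⟨α, hα⟩, rfl⟩
  have h1 := le_of_abs_le (hB₁ α hα)
  have h2 : ⟪b α x, φ.grad t x⟫ ≤ S * (1 + ‖x‖) * ‖φ.grad t x‖ :=
    (real_inner_le_norm _ _).trans (by gcongr; exact (hS α hα x).1)
  have h3 := le_of_abs_le (hA.integrable_Kop hα hQ hφ).2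
  have h4 : |Bop ν η γ φ α t x| ≤ K := (hA.integrable_increment_mul hα hQ hφ x).2
  have h5 : ‖mvE (σ α x)ᵀ (φ.grad t x)‖ ≤ P := (norm_mvE_transpose_le _ _).trans (by
    unfold P; gcongr; exact (hS α hα x).2)
  have h6 := hA.hf_lip α hα α hα t ht x r 0 (mvE (σ α x)ᵀ (φ.grad t x)) 0 (Bop ν η γ φ α t x) 0
  have h7 := hA.hf_bdd α hα t ht x
  simp only [sub_self, norm_zero, sub_zero, zero_add] at h6
  have h8 : C * (|r| + ‖mvE (σ α x)ᵀ (φ.grad t x)‖ + |Bop ν η γ φ α t x|) ≤ C * (|r| + P + K) := by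
    gcongr
  have h9 := (abs_le.1 h6).2
  have h10 := (abs_le.1 h7).2
  simp only [Lop, Aop]
  linarith

end AssumptionA

end Operators

section Comparison

variable {ν : Measure (Vec n)} {A : Set (Vec m)} {T : ℝ}
  {b : Vec m → Vec d → Vec d} {σ : Vec m → Vec d → Matrix (Fin d) (Fin d) ℝ}
  {η : Vec m → Vec d → Vec n → Vec d} {γ : Vec d → Vec n → ℝ}
  {f : Vec m → ℝ → Vec d → ℝ → Vec d → ℝ → ℝ}
  {ζ : ℝ → Vec d → ℝ} {g : Vec d → ℝ} {C : ℝ} {c a β κ M R S : ℝ} {u v : ℝ → Vec d → ℝ}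
  {J : DoublingJets T c a β κ M u fun t x => -v t x}

lemma mvE_neg_right (N : Matrix (Fin d) (Fin d) ℝ) (w : Vec d) : mvE N (-w) = -mvE N w := by
  ext i; simp [mvE, Matrix.mulVec_neg]

/-- A control that is nearly optimal for the subsolution at a pair of jets. -/
lemma AssumptionA.exists_control (hA : AssumptionA ν A T b σ η γ f ζ g C) (hJ : J.Local R)
    (hsub : SubsolnHJBVI ν A T b σ η γ f ζ u) (hsuper : SupersolnHJBVI ν A T b σ η γ f ζ v)
    (ht₁ : 0 < J.z₁.1) (ht₂ : 0 < J.z₂.1)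
    (hobs : ζ J.z₁.1 J.z₁.2 - ζ J.z₂.1 J.z₂.2 < u J.z₁.1 J.z₁.2 - v J.z₂.1 J.z₂.2) :
    ∃ α ∈ A, f α J.z₂.1 J.z₂.2 (v J.z₂.1 J.z₂.2)
        (-mvE (σ α J.z₂.2)ᵀ (J.φ₂.grad J.z₂.1 J.z₂.2)) (-Bop ν η γ J.φ₂ α J.z₂.1 J.z₂.2)
      - f α J.z₁.1 J.z₁.2 (u J.z₁.1 J.z₁.2)
        (mvE (σ α J.z₁.2)ᵀ (J.φ₁.grad J.z₁.1 J.z₁.2)) (Bop ν η γ J.φ₁ α J.z₁.1 J.z₁.2)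
      ≤ 2 * κ + (Lop ν b σ η J.φ₁ α J.z₁.1 J.z₁.2 + Lop ν b σ η J.φ₂ α J.z₂.1 J.z₂.2) := by
  have h1 := hsub J.φ₁ J.z₁.1 J.z₁.2 ⟨ht₁, J.mem₁.2⟩ J.max₁
  have h2 := hsuper J.φ₂.neg J.z₂.1 J.z₂.2 ⟨ht₂, J.mem₂.2⟩ fun t ht x => by
    have := J.max₂ t ht x
    simp only [C12.neg]
    linarith
  rw [le_min_iff] at h2
  have h3 : J.φ₁.dt J.z₁.1 J.z₁.2 + ⨅ α : A, (-(Lop ν b σ η J.φ₁ α J.z₁.1 J.z₁.2)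
      - f α J.z₁.1 J.z₁.2 (u J.z₁.1 J.z₁.2) (mvE (σ α J.z₁.2)ᵀ (J.φ₁.grad J.z₁.1 J.z₁.2))
        (Bop ν η γ J.φ₁ α J.z₁.1 J.z₁.2)) ≤ 0 :=
    (min_le_iff.1 h1).resolve_left fun h => by linarith [h2.1]
  have := hA.hAne.to_subtype
  obtain ⟨⟨α, hα⟩, h4⟩ := exists_lt_of_ciInf_lt
    (lt_of_le_of_lt (by linarith : _ ≤ -J.φ₁.dt J.z₁.1 J.z₁.2)
      (lt_add_of_pos_right _ hJ.κ_pos))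
  refine ⟨α, hα, ?_⟩
  have hQ : 0 ≤ c + β + κ := by linarith [hJ.c_pos, hJ.β_pos, hJ.κ_pos]
  have hbdd := hA.bddBelow_hamiltonian J.mem₂ J.z₂.2 J.φ₂.neg (v J.z₂.1 J.z₂.2) _ hQ fun h => by
    have := hJ.abs_increment_sub_inner_le₂ h
    rw [← abs_neg] at this
    simp only [C12.neg, inner_neg_right]
    convert this using 2
    ring
  have h5 := ciInf_le hbdd ⟨α, hα⟩
  have h6 := h2.2
  simp only [Lop_neg, Bop_neg] at h5 h6
  have hg : J.φ₂.neg.grad J.z₂.1 J.z₂.2 = -J.φ₂.grad J.z₂.1 J.z₂.2 := rfl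
  have hd : J.φ₂.neg.dt J.z₂.1 J.z₂.2 = -J.φ₂.dt J.z₂.1 J.z₂.2 := rfl
  simp only [hg, hd, mvE_neg_right] at h5 h6
  have h7 := (abs_le.1 J.dt).1
  simp only at h4
  linarith

lemma AssumptionA.nonlinearity_sub_le (hA : AssumptionA ν A T b σ η γ f ζ g C) {α : Vec m}
    (hα : α ∈ A) {t₁ t₂ : ℝ} (ht₁ : t₁ ∈ Icc (0 : ℝ) T) {x₁ x₂ p₁ p₂ : Vec d}
    {r₁ r₂ k₁ k₂ P K w ω : ℝ} (hr : r₂ ≤ r₁) (hp : ‖p₁ - p₂‖ ≤ P) (hK : 0 ≤ K) (hk : k₁ ≤ k₂ + K)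
    (hx : |f α t₁ x₁ r₂ p₂ k₂ - f α t₁ x₂ r₂ p₂ k₂| ≤ w)
    (ht : |f α t₁ x₂ r₂ p₂ k₂ - f α t₂ x₂ r₂ p₂ k₂| ≤ ω) :
    C * (r₁ - r₂) ≤ f α t₂ x₂ r₂ p₂ k₂ - f α t₁ x₁ r₁ p₁ k₁ + C * (P + K) + w + ω := by
  have h1 := hA.hf_k_mono α hα t₁ ht₁ x₁ r₁ p₁ hk
  have h2 := (abs_le.1 (hA.hf_lip α hα α hα t₁ ht₁ x₁ r₁ r₁ p₁ p₂ (k₂ + K) k₂)).2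
  have h3 := hA.hf_mono α hα t₁ ht₁ x₁ p₂ k₂ r₁ r₂ hr
  rw [sub_self, sub_self, norm_zero, abs_zero, zero_add, zero_add, add_sub_cancel_left,
    abs_of_nonneg hK] at h2
  have h4 := mul_le_mul_of_nonneg_left hp hA.hC.le
  have h5 := (abs_le.1 hx).2
  have h6 := (abs_le.1 ht).2
  simp only at h1
  linarith

lemma AssumptionA.gap_le (hA : AssumptionA ν A T b σ η γ f ζ g C) (hJ : J.Local R)
    (hsub : SubsolnHJBVI ν A T b σ η γ f ζ u) (hsuper : SupersolnHJBVI ν A T b σ η γ f ζ v)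
    (ht₁ : 0 < J.z₁.1) (ht₂ : 0 < J.z₂.1)
    (hobs : ζ J.z₁.1 J.z₁.2 - ζ J.z₂.1 J.z₂.2 < u J.z₁.1 J.z₁.2 - v J.z₂.1 J.z₂.2)
    (hM : 0 ≤ M) (huv : v J.z₂.1 J.z₂.2 ≤ u J.z₁.1 J.z₁.2) (hCS : C ≤ S)
    (hS : ∀ α ∈ A, ∀ x, ‖b α x‖ ≤ S * (1 + ‖x‖) ∧ ‖σ α x‖ ≤ S * (1 + ‖x‖)) {w ω : ℝ}
    (hx : ∀ α ∈ A,
      |f α J.z₁.1 J.z₁.2 (v J.z₂.1 J.z₂.2)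
          (-mvE (σ α J.z₂.2)ᵀ (J.φ₂.grad J.z₂.1 J.z₂.2)) (-Bop ν η γ J.φ₂ α J.z₂.1 J.z₂.2)
        - f α J.z₁.1 J.z₂.2 (v J.z₂.1 J.z₂.2)
          (-mvE (σ α J.z₂.2)ᵀ (J.φ₂.grad J.z₂.1 J.z₂.2)) (-Bop ν η γ J.φ₂ α J.z₂.1 J.z₂.2)| ≤ w)
    (ht : ∀ α ∈ A,
      |f α J.z₁.1 J.z₂.2 (v J.z₂.1 J.z₂.2)
          (-mvE (σ α J.z₂.2)ᵀ (J.φ₂.grad J.z₂.1 J.z₂.2)) (-Bop ν η γ J.φ₂ α J.z₂.1 J.z₂.2)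
        - f α J.z₂.1 J.z₂.2 (v J.z₂.1 J.z₂.2)
          (-mvE (σ α J.z₂.2)ᵀ (J.φ₂.grad J.z₂.1 J.z₂.2)) (-Bop ν η γ J.φ₂ α J.z₂.1 J.z₂.2)| ≤ ω) :
    C * (u J.z₁.1 J.z₁.2 - v J.z₂.1 J.z₂.2) ≤
      (12 * d * (d * S) ^ 2 + 12 * S + 12 * C ^ 2 * levyMass ν
          + C * (12 * (C + C ^ 2) * C * levyMass ν) + C * (d * (12 * (d * S)))) * J.err R
        + 2 * κ + C ^ 2 * ((4 * M + κ * C ^ 2) * ‖J.z₁.2 - J.z₂.2‖) * levyMass ν + w + ω := by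
  obtain ⟨α, hα, h⟩ := hA.exists_control hJ hsub hsuper ht₁ ht₂ hobs
  have hC := hA.hC
  have hI := levyMass_nonneg ν
  have hE := hJ.err_nonneg
  have hκ := hJ.κ_pos
  have hp := hA.norm_mvE_add_le hJ hα hCS hS
  rw [← sub_neg_eq_add] at hp
  have hk := hA.Bop_add_le hJ hα
  have key := hA.nonlinearity_sub_le hα J.mem₁ huv hp (k₁ := Bop ν η γ J.φ₁ α J.z₁.1 J.z₁.2)
    (K := (12 * (C + C ^ 2) * C * J.err R
      + (4 * M + κ * C ^ 2) * (C * ‖J.z₁.2 - J.z₂.2‖)) * levyMass ν) (by positivity)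
    (by linarith) (hx α hα) (ht α hα)
  have hAop := hA.Aop_add_le hJ hα hCS hS
  have hKop := hA.Kop_add_le hJ hα
  simp only [Lop] at h
  linarith

lemma AssumptionA.dist_mul_norm_mvE_le (hA : AssumptionA ν A T b σ η γ f ζ g C) (hJ : J.Local R)
    {α : Vec m} (hα : α ∈ A) (hCS : C ≤ S)
    (hS : ∀ α ∈ A, ∀ x, ‖b α x‖ ≤ S * (1 + ‖x‖) ∧ ‖σ α x‖ ≤ S * (1 + ‖x‖)) {ε : ℝ}
    (hβ : β ≤ 1) (hκ : κ ≤ 1) (hgap : c * gapX J.z₁ J.z₂ J.ξ₁ J.ξ₂ ≤ ε)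
    (hdist : ‖J.z₁.2 - J.z₂.2‖ ≤ ε) :
    ‖J.z₁.2 - J.z₂.2‖ * ‖mvE (σ α J.z₂.2)ᵀ (J.φ₂.grad J.z₂.1 J.z₂.2)‖ ≤
      d * (d * (S * (2 + R))) * (7 * ε) := by
  have hS0 : 0 ≤ S := hA.hC.le.trans hCS
  have hR := hJ.radius_nonneg
  have hσ : ‖σ α J.z₂.2‖ ≤ S * (2 + R) :=
    ((hS α hα _).2).trans (mul_le_mul_of_nonneg_left (by linarith [hJ.norm_le₂, hJ.right]) hS0)
  have h1 : ‖mvE (σ α J.z₂.2)ᵀ (J.φ₂.grad J.z₂.1 J.z₂.2)‖ ≤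
      d * (d * (S * (2 + R)) * ‖J.φ₂.grad J.z₂.1 J.z₂.2‖) :=
    (norm_mvE_transpose_le _ _).trans (by gcongr)
  have h2 : ‖J.z₁.2 - J.z₂.2‖ * ‖J.φ₂.grad J.z₂.1 J.z₂.2‖ ≤ 7 * ε := by
    have h3 := mul_le_mul_of_nonneg_left hJ.norm_grad_le_dist₂ (norm_nonneg (J.z₁.2 - J.z₂.2))
    have h4 := mul_le_mul_of_nonneg_left
      (DoublingJets.norm_sub_le_gap J.z₁ J.z₂ J.ξ₁ J.ξ₂).2 hJ.c_pos.le
    have h5 := mul_le_mul_of_nonneg_left (by linarith : 2 * β + κ ≤ 3)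
      (norm_nonneg (J.z₁.2 - J.z₂.2))
    linarith
  calc _ ≤ ‖J.z₁.2 - J.z₂.2‖ * (d * (d * (S * (2 + R)) * ‖J.φ₂.grad J.z₂.1 J.z₂.2‖)) := by gcongr
    _ = d * (d * (S * (2 + R))) * (‖J.z₁.2 - J.z₂.2‖ * ‖J.φ₂.grad J.z₂.1 J.z₂.2‖) := by ring
    _ ≤ _ := by gcongr

lemma norm_le_of_mul_logw_le {B : ℝ} (hβ : 0 < β) {x : Vec d} (h : β * logw x ≤ B) :
    ‖x‖ ≤ Real.exp (B / β) := by
  have h1 : logw x ≤ B / β := (le_div_iff₀' hβ).2 h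
  have h2 := (Real.log_le_iff_le_exp (by positivity)).1 h1
  nlinarith [sq_nonneg (‖x‖ - 1)]

/-- If all spatial gaps are small, the base points are localised. -/
lemma DoublingJets.exists_local {u₁ u₂ : ℝ → Vec d → ℝ} (J : DoublingJets T c a β κ M u₁ u₂)
    (hβ : 0 < β) (hκ : 0 < κ) {ε : ℝ} (hε : 0 < ε) (hε1 : ε ≤ 1) (hc : 3 / ε ≤ c)
    (hgap : c * gapX J.z₁ J.z₂ J.ξ₁ J.ξ₂ ≤ ε) (h₁ : ‖J.ξ₁.2‖ ≤ R) (h₂ : ‖J.ξ₂.2‖ ≤ R) :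
    J.Local R ∧ ‖J.z₁.2 - J.z₂.2‖ ≤ ε := by
  have hc0 : 0 < c := lt_of_lt_of_le (by positivity) hc
  have hG := gapX_nonneg J.z₁ J.z₂ J.ξ₁ J.ξ₂
  have h3 : 3 * gapX J.z₁ J.z₂ J.ξ₁ J.ξ₂ ≤ ε ^ 2 := by
    have h4 := mul_le_mul_of_nonneg_right hc hG
    rw [div_mul_eq_mul_div] at h4
    have := (div_le_iff₀ hε).1 (h4.trans hgap)
    linarith
  have h5 : ε ^ 2 ≤ 1 := pow_le_one₀ hε.le hε1
  have h6 := h3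
  rw [gapX] at h6
  refine ⟨⟨hc0, hβ, hκ, h₁, h₂, ?_, ?_⟩, ?_⟩
  · refine (sq_le_one_iff₀ (norm_nonneg _)).1 ?_
    nlinarith [sq_nonneg ‖J.z₂.2 - J.ξ₂.2‖, sq_nonneg ‖J.ξ₁.2 - J.ξ₂.2‖,
      sq_nonneg ‖J.z₁.2 - J.ξ₁.2‖]
  · refine (sq_le_one_iff₀ (norm_nonneg _)).1 ?_
    nlinarith [sq_nonneg ‖J.z₂.2 - J.ξ₂.2‖, sq_nonneg ‖J.ξ₁.2 - J.ξ₂.2‖,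
      sq_nonneg ‖J.z₁.2 - J.ξ₁.2‖]
  · exact (pow_le_pow_iff_left₀ (norm_nonneg _) hε.le two_ne_zero).1
      ((norm_sub_le_gap J.z₁ J.z₂ J.ξ₁ J.ξ₂).1.trans h3)

end Comparison

/-- Strong comparison principle for the nonlocal HJB variational
inequality: a bounded viscosity subsolution lies below a bounded viscosity
supersolution provided it does so at the initial time. -/
theorem comparison_principle_HJBVI
    {n d m : ℕ} (ν : Measure (Vec n)) (A : Set (Vec m)) (T : ℝ)
    (b : Vec m → Vec d → Vec d) (σ : Vec m → Vec d → Matrix (Fin d) (Fin d) ℝ)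
    (η : Vec m → Vec d → Vec n → Vec d) (γ : Vec d → Vec n → ℝ)
    (f : Vec m → ℝ → Vec d → ℝ → Vec d → ℝ → ℝ)
    (ζ : ℝ → Vec d → ℝ) (g : Vec d → ℝ) (C : ℝ)
    (hA : AssumptionA ν A T b σ η γ f ζ g C)
    (u v : ℝ → Vec d → ℝ)
    (hu_bdd : ∃ M, ∀ t x, |u t x| ≤ M)
    (hv_bdd : ∃ M, ∀ t x, |v t x| ≤ M)
    (hu_usc : UpperSemicontinuousOn (fun p : ℝ × Vec d => u p.1 p.2) (Icc 0 T ×ˢ univ))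
    (hv_lsc : LowerSemicontinuousOn (fun p : ℝ × Vec d => v p.1 p.2) (Icc 0 T ×ˢ univ))
    (hu_sub : SubsolnHJBVI ν A T b σ η γ f ζ u)
    (hv_super : SupersolnHJBVI ν A T b σ η γ f ζ v)
    (h0 : ∀ x, u 0 x ≤ v 0 x) :
    ∀ t ∈ Icc (0:ℝ) T, ∀ x, u t x ≤ v t x := by
  intro t₀ ht₀ x₀
  by_contra! hlt
  have hC := hA.hC
  have hT := hA.hT
  have hI := levyMass_nonneg ν
  obtain ⟨M₁, hM₁⟩ := hu_bdd
  obtain ⟨M₂, hM₂⟩ := hv_bdd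
  obtain ⟨M, hM, hMu, hMv⟩ : ∃ M, 0 ≤ M ∧ (∀ t x, |u t x| ≤ M) ∧ ∀ t x, |v t x| ≤ M :=
    ⟨max M₁ M₂, (abs_nonneg _).trans ((hM₁ 0 0).trans (le_max_left _ _)),
      fun t x => (hM₁ t x).trans (le_max_left _ _), fun t x => (hM₂ t x).trans (le_max_right _ _)⟩
  have hMv' : ∀ t x, |-v t x| ≤ M := fun t x => by rw [abs_neg]; exact hMv t x
  have hv_usc : UpperSemicontinuousOn (fun p : ℝ × Vec d => -v p.1 p.2) (Icc 0 T ×ˢ univ) :=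
    hv_lsc.neg
  obtain ⟨θ, hθ, hθuv⟩ : ∃ θ > 0, 3 * θ = u t₀ x₀ - v t₀ x₀ :=
    ⟨(u t₀ x₀ - v t₀ x₀) / 3, by linarith, by ring⟩
  have hCθ : 0 < C * θ := mul_pos hC hθ
  obtain ⟨S, hCS, hS⟩ := hA.exists_growth
  have hS0 : 0 ≤ S := hC.le.trans hCS
  set K₀ : ℝ := 12 * d * (d * S) ^ 2 + 12 * S + 12 * C ^ 2 * levyMass ν
    + C * (12 * (C + C ^ 2) * C * levyMass ν) + C * (d * (12 * (d * S))) with hK₀_def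
  have hK₀ : 0 ≤ K₀ := by positivity
  have hl := logw_nonneg x₀
  obtain ⟨β, hβ, hβ1, hβlog, hβK⟩ : ∃ β > 0, β ≤ 1 ∧ 2 * β * logw x₀ ≤ θ ∧ K₀ * β ≤ C * θ / 4 := by
    refine ⟨min 1 (min (θ / (2 * logw x₀ + 1)) (C * θ / 4 / (K₀ + 1))), by positivity,
      min_le_left _ _, ?_, ?_⟩
    · have h := (min_le_right 1 _).trans (min_le_left (θ / (2 * logw x₀ + 1)) (C * θ / 4 / (K₀ + 1)))
      generalize min 1 (min (θ / (2 * logw x₀ + 1)) (C * θ / 4 / (K₀ + 1))) = β at h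
      rcases le_total β 0 with h0 | h0
      · nlinarith
      · linarith [(le_div_iff₀ (by positivity)).1 h]
    · have h := (min_le_right 1 _).trans (min_le_right (θ / (2 * logw x₀ + 1)) (C * θ / 4 / (K₀ + 1)))
      generalize min 1 (min (θ / (2 * logw x₀ + 1)) (C * θ / 4 / (K₀ + 1))) = β at h
      rcases le_total β 0 with h0 | h0
      · nlinarith
      · linarith [(le_div_iff₀ (by positivity)).1 h]
  set R : ℝ := Real.exp (2 * M / β) with hR_def
  have hR : 0 < R := Real.exp_pos _
  obtain ⟨ρ₀, hρ₀, hinit⟩ := exists_initial_radius (R := 1 + R) (u₂ := fun t x => -v t x)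
    hθ hu_usc hv_usc fun x => by linarith [h0 x]
  obtain ⟨ρ₁, hρ₁, hobst⟩ := hA.exists_obstacle_radius (1 + R) hθ
  obtain ⟨w, hw, hw0, -, hfw⟩ := hA.hf_x (1 + R + M) (by positivity)
  obtain ⟨r, hr, hwr⟩ : ∃ r > 0, ∀ s, 0 ≤ s → s ≤ r → w s ≤ C * θ / 8 := by
    obtain ⟨r, hr, h⟩ := Metric.continuous_iff.1 hw 0 (C * θ / 8) (by positivity)
    refine ⟨r / 2, half_pos hr, fun s hs hsr => ?_⟩
    have := h s (by rw [Real.dist_eq, sub_zero, abs_of_nonneg hs]; linarith)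
    rw [hw0, Real.dist_eq, sub_zero] at this
    exact (le_abs_self _).trans this.le
  set G : ℝ := 1 + d * (d * (S * (2 + R))) * 7 with hG_def
  have hG : 0 < G := by positivity
  set W : ℝ := K₀ * (1 + (2 + R) ^ 2) + 2 + C ^ 2 * (4 * M + C ^ 2) * levyMass ν with hW_def
  have hW : 0 < W := by positivity
  obtain ⟨ε, hε, hε1, hεG, hεW, hερ₀, hερ₁⟩ :
      ∃ ε > 0, ε ≤ 1 ∧ ε * G ≤ r ∧ ε * W ≤ C * θ / 4 ∧ ε ≤ ρ₀ ∧ ε ≤ ρ₁ := by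
    have h : ∀ᶠ ε in 𝓝[>] (0 : ℝ), ε ≤ 1 ∧ ε ≤ r / G ∧ ε ≤ C * θ / 4 / W ∧ ε ≤ ρ₀ ∧ ε ≤ ρ₁ := by
      have h' : ∀ s > (0 : ℝ), ∀ᶠ ε in 𝓝[>] (0 : ℝ), ε ≤ s := fun s hs =>
        nhdsWithin_le_nhds (Iic_mem_nhds hs)
      filter_upwards [h' 1 one_pos, h' (r / G) (by positivity), h' (C * θ / 4 / W) (by positivity),
        h' ρ₀ hρ₀, h' ρ₁ hρ₁] with ε h1 h2 h3 h4 h5 using ⟨h1, h2, h3, h4, h5⟩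
    obtain ⟨ε, ⟨h1, h2, h3, h4, h5⟩, hε⟩ := (h.and self_mem_nhdsWithin).exists
    exact ⟨ε, hε, h1, (le_div_iff₀ hG).1 h2, (le_div_iff₀ hW).1 h3, h4, h5⟩
  obtain ⟨c, hc, hjets⟩ := exists_good_jets (z := (t₀, x₀)) (u₂ := fun t x => -v t x)
    hT.le hβ hθ hMu hMv' hu_usc hv_usc ht₀ (by simp only; linarith) hε (by positivity : 0 < 3 / ε)
  have hc0 : 0 < c := lt_of_lt_of_le (by positivity) hc
  set Rp : ℝ := d * (d * (S * (2 + R)) * (4 * c * R + 2 * β + 1)) with hRp_def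
  have hRp : 0 ≤ Rp := by positivity
  set Rk : ℝ := ((4 * c * R + 2 * β + 1) * C + (c + β + 1) * C ^ 2) * C * levyMass ν with hRk_def
  have hRk : 0 ≤ Rk := by positivity
  obtain ⟨δ, hδ, hfδ⟩ := hA.exists_time_modulus (R := 1 + R + M + Rp + Rk) (by positivity)
    (ε := C * θ / 8) (by positivity)
  obtain ⟨a, κ, hκ, hκε, J, hgap, hdt, hval⟩ := hjets (min δ (min ρ₀ ρ₁)) (by positivity)
  have hκ1 : κ ≤ 1 := hκε.trans hε1
  have hu1 := (abs_le.1 (hMu J.z₁.1 J.z₁.2)).2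
  have hv1 := (abs_le.1 (hMv' J.z₂.1 J.z₂.2)).2
  have hl1 := mul_nonneg hβ.le (logw_nonneg J.ξ₁.2)
  have hl2 := mul_nonneg hβ.le (logw_nonneg J.ξ₂.2)
  obtain ⟨hJ, hdist⟩ := J.exists_local hβ hκ hε hε1 hc hgap
    (norm_le_of_mul_logw_le hβ (B := 2 * M) (by linarith))
    (norm_le_of_mul_logw_le hβ (B := 2 * M) (by linarith))
  rw [← hR_def] at hJ
  have hz₁ : ‖J.z₁.2‖ ≤ 1 + R := hJ.norm_le₁.trans (by linarith [hJ.left])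
  have hz₂ : ‖J.z₂.2‖ ≤ 1 + R := hJ.norm_le₂.trans (by linarith [hJ.right])
  have hdtρ₀ : |J.z₁.1 - J.z₂.1| ≤ ρ₀ := hdt.trans ((min_le_right _ _).trans (min_le_left _ _))
  have hdtρ₁ : |J.z₁.1 - J.z₂.1| ≤ ρ₁ := hdt.trans ((min_le_right _ _).trans (min_le_right _ _))
  have hpos : ¬(J.z₁.1 = 0 ∨ J.z₂.1 = 0) := fun h => by
    have := hinit _ J.mem₁ _ J.mem₂ _ _ hz₁ hz₂ hdtρ₀ (hdist.trans hερ₀) h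
    linarith
  rw [not_or] at hpos
  have hobs : ζ J.z₁.1 J.z₁.2 - ζ J.z₂.1 J.z₂.2 < u J.z₁.1 J.z₁.2 - v J.z₂.1 J.z₂.2 := by
    have := hobst _ J.mem₁ _ J.mem₂ _ _ hz₁ hz₂ hdtρ₁ (hdist.trans hερ₁)
    linarith [le_abs_self (ζ J.z₁.1 J.z₁.2 - ζ J.z₂.1 J.z₂.2)]
  have key := hA.gap_le hJ hu_sub hv_super (J.mem₁.1.lt_of_ne' hpos.1) (J.mem₂.1.lt_of_ne' hpos.2)
    hobs hM (by linarith) hCS hS (w := C * θ / 8) (ω := C * θ / 8)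
    (fun α hα => by
      refine (hfw α hα _ J.mem₁ _ _ _ _ _ (by linarith) (by linarith)
        ((hMv _ _).trans (by linarith))).trans (hwr _ (by positivity) ?_)
      have := hA.dist_mul_norm_mvE_le hJ hα hCS hS hβ1 hκ1 hgap hdist
      rw [norm_neg]
      linarith)
    (fun α hα => by
      refine hfδ α hα _ J.mem₁ _ J.mem₂ (hdt.trans (min_le_left _ _)) _ _ _ _ (by linarith)
        ((hMv _ _).trans (by linarith)) ?_ ?_
      · rw [norm_neg]
        have : d * (d * (S * (2 + R)) * (4 * c * R + 2 * β + κ)) ≤ Rp := by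
          rw [hRp_def]; gcongr
        linarith [hA.norm_mvE_le hJ hα hCS hS]
      · rw [abs_neg]
        have : ((4 * c * R + 2 * β + κ) * C + (c + β + κ) * C ^ 2) * C * levyMass ν ≤ Rk := by
          rw [hRk_def]; gcongr
        linarith [hA.abs_Bop_le hJ hα])
  have herr : J.err R ≤ β + ε * (1 + (2 + R) ^ 2) := by
    have := mul_le_mul_of_nonneg_right hκε (sq_nonneg (2 + R))
    rw [DoublingJets.err]
    linarith
  have h1 := mul_le_mul_of_nonneg_left herr hK₀
  have h2 : C ^ 2 * ((4 * M + κ * C ^ 2) * ‖J.z₁.2 - J.z₂.2‖) * levyMass ν ≤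
      C ^ 2 * ((4 * M + 1 * C ^ 2) * ε) * levyMass ν := by gcongr
  have h3 := mul_le_mul_of_nonneg_left (by linarith : θ ≤ u J.z₁.1 J.z₁.2 - v J.z₂.1 J.z₂.2) hC.le
  rw [hW_def] at hεW
  linarith
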